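/- Suppose ε_{n,i} = ε_n and μ_{n,i} = μ_n do not depend on i, define H_n(v) = ( |k_n ε_n(μ_n((0,v]) − v)| + |k_n ε_n(μ_n((1−v,1)) − v)| ) / √(k_n v) for v ∈ (0,1/2), and assume P_(n) and Q_(n) are mutually contiguous (for every sequence of measurable sets A_n: Q_(n)(A_n) → 0 if and only if P_(n)(A_n) → 0). If there are sequences r_n, s_n, t_n, u_n ∈ (0,1) with log(r_n)/log(k_n) → −1, log(u_n)/log(k_n) → 0, log(s_n)/log(k_n) → −κ and log(t_n)/log(k_n) → −κ for some κ ∈ (0,1), such that a_n · sup{ H_n(v) : v ∈ [r_n,s_n] ∪ [t_n,u_n] } → 0, then for every x ∈ ℝ: Q_(n)( a_n·HC_n − b_n ≤ x ) → exp(−2·exp(−x)). -/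

import Mathlib

open MeasureTheory Filter Topology

noncomputable section

/-- Mixture `Q = (1-e)·P + e·μ`. -/
def Qmix {α : Type*} [MeasurableSpace α] (P μ : Measure α) (e : ℝ) : Measure α :=
  (ENNReal.ofReal (1 - e)) • P + (ENNReal.ofReal e) • μ

/-- The uniform distribution on `(0,1)`. -/
def unif : Measure ℝ := volume.restrict (Set.Ioo 0 1)

/-- Empirical distribution function of `y : Fin k → ℝ` at `t`. -/
def empCdf (k : ℕ) (y : Fin k → ℝ) (t : ℝ) : ℝ :=
  (∑ i : Fin k, if y i ≤ t then (1 : ℝ) else 0) / k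

/-- Higher criticism statistic
`HC = sup_{t ∈ (0,1)} |√k (𝔽(t) − t) / √(t(1−t))|`. -/
def HCstat (k : ℕ) (y : Fin k → ℝ) : ℝ :=
  ⨆ t : Set.Ioo (0 : ℝ) 1,
    |Real.sqrt k * (empCdf k y t.1 - t.1) / Real.sqrt (t.1 * (1 - t.1))|

/-- Normalising constant `a_n = √(2 log log k_n)`. -/
def aHC (k : ℕ) : ℝ := Real.sqrt (2 * Real.log (Real.log k))

/-- Normalising constant
`b_n = 2 log log k_n + (1/2) log log log k_n − (1/2) log π`. -/
def bHC (k : ℕ) : ℝ :=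
  2 * Real.log (Real.log k) + (1 / 2) * Real.log (Real.log (Real.log k)) -
    (1 / 2) * Real.log Real.pi

/-- `H_n(v)` from Theorem 3.1/3.2. -/
def Hfun (μ : ℕ → ℕ → Measure ℝ) (ε : ℕ → ℕ → ℝ) (k : ℕ → ℕ) (n : ℕ) (v : ℝ) : ℝ :=
  (|∑ i ∈ Finset.range (k n), ε n i * (((μ n i) (Set.Ioc 0 v)).toReal - v)| +
   |∑ i ∈ Finset.range (k n), ε n i * (((μ n i) (Set.Ioo (1 - v) 1)).toReal - v)|) /
    Real.sqrt (k n * v)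

/-- Product null measure (product of uniforms). -/
def PprodU (k : ℕ → ℕ) (n : ℕ) : Measure (Fin (k n) → ℝ) :=
  Measure.pi (fun _ => unif)

/-- Product alternative measure `Q_(n)`. -/
def QprodU (μ : ℕ → ℕ → Measure ℝ) (ε : ℕ → ℕ → ℝ) (k : ℕ → ℕ) (n : ℕ) :
    Measure (Fin (k n) → ℝ) :=
  Measure.pi (fun i => Qmix unif (μ n i) (ε n i))

end

namespace HC
open MeasureTheory Filter Topology ProbabilityTheory
open scoped ENNReal NNReal

/-- `e^θ` as a nonnegative real. -/
noncomputable def ex (θ : ℝ) : ℝ≥0 := Real.toNNReal (Real.exp θ)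

@[simp] lemma coe_ex (θ : ℝ) : ((ex θ : ℝ≥0) : ℝ) = Real.exp θ :=
  Real.coe_toNNReal _ (Real.exp_pos θ).le

/-- `A` depends only on the coordinates in `I`. -/
def DepOn {ι : Type*} (I : Finset ι) (A : Set (ι → ℕ)) : Prop :=
  ∀ ω ω' : ι → ℕ, (∀ i ∈ I, ω i = ω' i) → ω ∈ A → ω' ∈ A

/-- Independent Poisson variables with rates `l`. -/
noncomputable def IP {ι : Type*} (l : ι → ℝ≥0) : Measure (ι → ℕ) :=
  Measure.infinitePi (fun i => poissonMeasure (l i))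

instance {ι : Type*} (l : ι → ℝ≥0) : IsProbabilityMeasure (IP l) := by
  unfold IP; infer_instance

section
variable {ι : Type*}

/-- extension by zero -/
noncomputable def ext0 [DecidableEq ι] (I : Finset ι) (z : I → ℕ) : ι → ℕ :=
  fun i => if h : i ∈ I then z ⟨i, h⟩ else 0

lemma measurable_ext0 [DecidableEq ι] (I : Finset ι) : Measurable (ext0 I) := by
  refine measurable_pi_iff.2 fun i => ?_
  unfold ext0
  by_cases h : i ∈ I
  · simp only [h, dite_true]; exact measurable_pi_apply _
  · simp only [h, dite_false]; exact measurable_const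

lemma dep_eq_preimage [DecidableEq ι] (I : Finset ι) {A : Set (ι → ℕ)}
    (hdep : DepOn I A) :
    A = I.restrict ⁻¹' (ext0 I ⁻¹' A) := by
  ext ω
  have h : ∀ i ∈ I, ω i = ext0 I (I.restrict ω) i := by
    intro i hi; simp [ext0, hi]
  constructor
  · intro hω
    exact hdep _ _ h hω
  · intro hω
    exact hdep _ _ (fun i hi => (h i hi).symm) hω

lemma DepOn.meas {I : Finset ι} {A : Set (ι → ℕ)} (h : DepOn I A) : MeasurableSet A := by
  classical
  rw [dep_eq_preimage I h]
  have : Measurable (I.restrict : (ι → ℕ) → (I → ℕ)) := by fun_prop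
  exact this (MeasurableSet.of_discrete)

lemma DepOn.mono {I J : Finset ι} {A : Set (ι → ℕ)} (h : DepOn I A) (hIJ : I ⊆ J) : DepOn J A :=
  fun ω ω' hω => h ω ω' fun i hi => hω i (hIJ hi)

lemma DepOn.compl {I : Finset ι} {A : Set (ι → ℕ)} (h : DepOn I A) : DepOn I Aᶜ :=
  fun ω ω' hω hA hA' => hA (h ω' ω (fun i hi => (hω i hi).symm) hA')

lemma DepOn.inter {I : Finset ι} {A B : Set (ι → ℕ)} (h : DepOn I A) (h' : DepOn I B) :
    DepOn I (A ∩ B) :=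
  fun ω ω' hω hA => ⟨h ω ω' hω hA.1, h' ω ω' hω hA.2⟩

lemma DepOn.iUnion {κ : Sort*} {I : Finset ι} {A : κ → Set (ι → ℕ)} (h : ∀ k, DepOn I (A k)) :
    DepOn I (⋃ k, A k) := by
  intro ω ω' hω hA
  obtain ⟨k, hk⟩ := Set.mem_iUnion.1 hA
  exact Set.mem_iUnion.2 ⟨k, h k ω ω' hω hk⟩

lemma DepOn.iInter {κ : Sort*} {I : Finset ι} {A : κ → Set (ι → ℕ)} (h : ∀ k, DepOn I (A k)) :
    DepOn I (⋂ k, A k) := by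
  intro ω ω' hω hA
  exact Set.mem_iInter.2 fun k => h k ω ω' hω (Set.mem_iInter.1 hA k)

lemma tilt_pi (I : Finset ι) (l : ι → ℝ≥0) (θ : ℝ) :
    Measure.pi (fun i : I => poissonMeasure (l i * ex θ)) =
      (Measure.pi (fun i : I => poissonMeasure (l i))).withDensity
        (fun z => ENNReal.ofReal (Real.exp (θ * ∑ i, (z i : ℝ)
          - (∑ i : I, (l i : ℝ)) * (Real.exp θ - 1)))) := by
  refine Measure.ext_of_singleton fun z => ?_
  rw [withDensity_apply _ (measurableSet_singleton _), Measure.restrict_singleton,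
    lintegral_smul_measure, lintegral_dirac, Measure.pi_singleton, Measure.pi_singleton]
  simp only [poissonMeasure_singleton]
  rw [← ENNReal.ofReal_prod_of_nonneg (fun i _ => by positivity),
    ← ENNReal.ofReal_prod_of_nonneg (fun i _ => by positivity), smul_eq_mul,
    ← ENNReal.ofReal_mul (Finset.prod_nonneg fun i _ => by positivity)]
  congr 1
  rw [Finset.mul_sum, Finset.sum_mul, ← Finset.sum_sub_distrib, Real.exp_sum,
    ← Finset.prod_mul_distrib]
  refine Finset.prod_congr rfl fun i _ => ?_
  push_cast
  rw [coe_ex, mul_pow, ← Real.exp_nat_mul]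
  have : Real.exp (-(↑(l i) * Real.exp θ)) * (Real.exp ((z i:ℝ) * θ))
      = Real.exp (-(l i:ℝ)) * Real.exp (θ * (z i:ℝ) - (l i) * (Real.exp θ - 1)) := by
    rw [← Real.exp_add, ← Real.exp_add]; congr 1; ring
  calc _ = (Real.exp (-(↑(l i) * Real.exp θ)) * (Real.exp ((z i:ℝ) * θ))) * (l i:ℝ)^(z i) / (z i).factorial := by
        ring
    _ = _ := by rw [this]; ring

lemma IP_apply_dep [DecidableEq ι] (I : Finset ι) (l : ι → ℝ≥0) {A : Set (ι → ℕ)}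
    (hdep : DepOn I A) :
    IP l A = Measure.pi (fun i : I => poissonMeasure (l i)) (ext0 I ⁻¹' A) := by
  conv_lhs => rw [dep_eq_preimage I hdep]
  rw [← Measure.map_apply (by fun_prop) (measurable_ext0 I hdep.meas), IP,
    Measure.infinitePi_map_restrict]

/-- exponential tilting of finitely many coordinates -/
theorem tilt [DecidableEq ι] (I : Finset ι) (l : ι → ℝ≥0) (θ : ℝ) {A : Set (ι → ℕ)}
    (hdep : DepOn I A) :
    IP (fun i => l i * ex θ) A =
      ∫⁻ ω in A, ENNReal.ofReal (Real.exp (θ * ∑ i ∈ I, (ω i : ℝ)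
          - (∑ i ∈ I, (l i : ℝ)) * (Real.exp θ - 1))) ∂(IP l) := by
  rw [IP_apply_dep I _ hdep, tilt_pi, withDensity_apply _ (measurable_ext0 I hdep.meas)]
  conv_rhs => rw [dep_eq_preimage I hdep]
  rw [← Measure.infinitePi_map_restrict (fun i => poissonMeasure (l i)) (I := I),
    setLIntegral_map (measurable_ext0 I hdep.meas) (by fun_prop) (by fun_prop)]
  refine lintegral_congr fun ω => ?_
  simp only [Finset.restrict]
  rw [Finset.sum_coe_sort I (fun i => (l i : ℝ)), Finset.sum_coe_sort I (fun i => (ω i : ℝ))]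


lemma IP_reindex {κ : Type*} (l : ι → ℝ≥0) (f : κ → ι) (hf : Function.Injective f)
    {A : Set (κ → ℕ)} (hA : MeasurableSet A) :
    IP l {ω | (fun i => ω (f i)) ∈ A} = IP (fun i => l (f i)) A := by
  unfold IP
  rw [← Measure.map_infinitePi_infinitePi_of_inj (P := fun i => poissonMeasure (l i)) hf,
    Measure.map_apply (by fun_prop) hA]
  rfl

lemma IP_indep [DecidableEq ι] (l : ι → ℝ≥0) {I J : Finset ι} (hIJ : Disjoint I J)
    {A B : Set (ι → ℕ)} (hA : DepOn I A) (hB : DepOn J B) :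
    IP l (A ∩ B) = IP l A * IP l B := by
  have h0 : iIndepFun (fun (i : ι) (ω : ι → ℕ) => ω i) (IP l) := by
    unfold IP
    exact iIndepFun_infinitePi (P := fun i => poissonMeasure (l i)) (X := fun i (x : ℕ) => x)
      (fun i => measurable_id)
  have h1 := h0.indepFun_finset I J hIJ (fun i => measurable_pi_apply i)
  have h2 := h1.measure_inter_preimage_eq_mul (ext0 I ⁻¹' A) (ext0 J ⁻¹' B)
    (measurable_ext0 I hA.meas) (measurable_ext0 J hB.meas)
  have e1 : A = (fun (a : ι → ℕ) (i : I) => a i) ⁻¹' (ext0 I ⁻¹' A) := dep_eq_preimage I hA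
  have e2 : B = (fun (a : ι → ℕ) (i : J) => a i) ⁻¹' (ext0 J ⁻¹' B) := dep_eq_preimage J hB
  rw [← e1, ← e2] at h2
  exact h2

lemma DepOn.biInter_finset [DecidableEq ι] {β : Type*} (s : Finset β) {I : β → Finset ι}
    {A : β → Set (ι → ℕ)} (hA : ∀ b ∈ s, DepOn (I b) (A b)) :
    DepOn (s.biUnion I) (⋂ b ∈ s, A b) := by
  intro ω ω' hω h
  simp only [Set.mem_iInter] at h ⊢
  intro b hb
  exact hA b hb ω ω' (fun i hi => hω i (Finset.mem_biUnion.2 ⟨b, hb, hi⟩)) (h b hb)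

lemma IP_prod [DecidableEq ι] {β : Type*} [DecidableEq β] (l : ι → ℝ≥0) (s : Finset β) {I : β → Finset ι}
    {A : β → Set (ι → ℕ)} (hA : ∀ b ∈ s, DepOn (I b) (A b))
    (hd : ∀ b ∈ s, ∀ c ∈ s, b ≠ c → Disjoint (I b) (I c)) :
    IP l (⋂ b ∈ s, A b) = ∏ b ∈ s, IP l (A b) := by
  induction s using Finset.induction_on with
  | empty => simp
  | insert a s ha ih =>
    rw [Finset.prod_insert ha, Finset.set_biInter_insert, ← ih
      (fun b hb => hA b (Finset.mem_insert_of_mem hb))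
      (fun b hb c hc => hd b (Finset.mem_insert_of_mem hb) c (Finset.mem_insert_of_mem hc))]
    refine IP_indep l (I := I a) (J := s.biUnion I) ?_ (hA a (Finset.mem_insert_self _ _))
      (DepOn.biInter_finset s fun b hb => hA b (Finset.mem_insert_of_mem hb))
    rw [Finset.disjoint_biUnion_right]
    intro c hc
    exact hd a (Finset.mem_insert_self _ _) c (Finset.mem_insert_of_mem hc)
      (fun h => ha (h ▸ hc))

end

/-- partial sums of counts -/
noncomputable def S (ω : ℕ → ℕ) (j : ℕ) : ℝ := ∑ i ∈ Finset.range j, (ω i : ℝ)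

/-- partial sums of rates -/
noncomputable def Lam (l : ℕ → ℝ≥0) (j : ℕ) : ℝ := ∑ i ∈ Finset.range j, (l i : ℝ)

lemma Lam_mono (l : ℕ → ℝ≥0) : Monotone (Lam l) := by
  intro i j hij
  exact Finset.sum_le_sum_of_subset_of_nonneg (Finset.range_subset_range.2 hij)
    (fun _ _ _ => by positivity)

lemma Lam_nonneg (l : ℕ → ℝ≥0) (j : ℕ) : 0 ≤ Lam l j :=
  Finset.sum_nonneg fun _ _ => by positivity

lemma S_congr {ω ω' : ℕ → ℕ} {j : ℕ} (h : ∀ i ∈ Finset.range j, ω i = ω' i) : S ω j = S ω' j :=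
  Finset.sum_congr rfl fun i hi => by rw [h i hi]

lemma measurable_S (j : ℕ) : Measurable (fun ω : ℕ → ℕ => S ω j) := by
  unfold S; fun_prop

lemma depS (j : ℕ) (p : ℝ → Prop) : DepOn (Finset.range j) {ω : ℕ → ℕ | p (S ω j)} := by
  intro ω ω' h hω
  simp only [Set.mem_ofPred_eq] at *
  rwa [← S_congr h]

/-- likelihood ratio -/
noncomputable def dens (l : ℕ → ℝ≥0) (j : ℕ) (θ : ℝ) (ω : ℕ → ℕ) : ℝ :=
  Real.exp (θ * S ω j - Lam l j * (Real.exp θ - 1))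

/-- mixture likelihood ratio -/
noncomputable def mixL (l : ℕ → ℝ≥0) (ν : Measure ℝ) (j : ℕ) (ω : ℕ → ℕ) : ℝ≥0∞ :=
  ∫⁻ θ, ENNReal.ofReal (dens l j θ ω) ∂ν

/-- rates tilted by `θ` -/
noncomputable def tl (l : ℕ → ℝ≥0) (θ : ℝ) : ℕ → ℝ≥0 := fun i => l i * ex θ

lemma Lam_tl (l : ℕ → ℝ≥0) (θ : ℝ) (j : ℕ) : Lam (tl l θ) j = Lam l j * Real.exp θ := by
  simp [Lam, tl, Finset.sum_mul]

lemma tilt' (l : ℕ → ℝ≥0) (j : ℕ) (θ : ℝ) {A : Set (ℕ → ℕ)} (hA : DepOn (Finset.range j) A) :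
    IP (tl l θ) A = ∫⁻ ω in A, ENNReal.ofReal (dens l j θ ω) ∂(IP l) :=
  tilt (Finset.range j) l θ hA

lemma measurable_dens (l : ℕ → ℝ≥0) (j : ℕ) :
    Measurable (fun p : (ℕ → ℕ) × ℝ => ENNReal.ofReal (dens l j p.2 p.1)) := by
  unfold dens
  have := (measurable_S j).comp (measurable_fst : Measurable (Prod.fst : (ℕ → ℕ) × ℝ → _))
  have h2 : Measurable (fun p : (ℕ → ℕ) × ℝ => S p.1 j) := this
  fun_prop

lemma mix_eq (l : ℕ → ℝ≥0) (ν : Measure ℝ) [SFinite ν] (s : Finset ℕ) {D : ℕ → Set (ℕ → ℕ)}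
    (hD : ∀ j ∈ s, DepOn (Finset.range j) (D j))
    (hdisj : (s : Set ℕ).PairwiseDisjoint D) :
    ∫⁻ θ, IP (tl l θ) (⋃ j ∈ s, D j) ∂ν = ∑ j ∈ s, ∫⁻ ω in D j, mixL l ν j ω ∂(IP l) := by
  have h1 : ∀ θ, IP (tl l θ) (⋃ j ∈ s, D j) =
      ∑ j ∈ s, ∫⁻ ω in D j, ENNReal.ofReal (dens l j θ ω) ∂(IP l) := by
    intro θ
    rw [measure_biUnion_finset hdisj (fun j hj => (hD j hj).meas)]
    exact Finset.sum_congr rfl fun j hj => tilt' l j θ (hD j hj)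
  simp_rw [h1]
  rw [lintegral_finsetSum']
  · refine Finset.sum_congr rfl fun j hj => ?_
    unfold mixL
    rw [lintegral_lintegral_swap]
    exact ((measurable_dens l j).comp measurable_swap).aemeasurable
  · intro j hj
    refine Measurable.aemeasurable ?_
    exact Measurable.lintegral_prod_left (measurable_dens l j)

lemma upperAbs (l : ℕ → ℝ≥0) (ν : Measure ℝ) [SFinite ν] (s : Finset ℕ) {D : ℕ → Set (ℕ → ℕ)}
    (hD : ∀ j ∈ s, DepOn (Finset.range j) (D j))
    (hdisj : (s : Set ℕ).PairwiseDisjoint D) (B : ℝ≥0∞)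
    (hB : ∀ j ∈ s, ∀ ω ∈ D j, B ≤ mixL l ν j ω) :
    B * IP l (⋃ j ∈ s, D j) ≤ ν Set.univ := by
  calc B * IP l (⋃ j ∈ s, D j) = ∑ j ∈ s, ∫⁻ ω in D j, B ∂(IP l) := by
        rw [measure_biUnion_finset hdisj (fun j hj => (hD j hj).meas), Finset.mul_sum]
        simp
    _ ≤ ∑ j ∈ s, ∫⁻ ω in D j, mixL l ν j ω ∂(IP l) :=
        Finset.sum_le_sum fun j hj => setLIntegral_mono' (hD j hj).meas (hB j hj)
    _ = ∫⁻ θ, IP (tl l θ) (⋃ j ∈ s, D j) ∂ν := (mix_eq l ν s hD hdisj).symm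
    _ ≤ ∫⁻ θ, 1 ∂ν := lintegral_mono fun θ => prob_le_one
    _ = _ := by simp

lemma lowerAbs (l : ℕ → ℝ≥0) (ν : Measure ℝ) [SFinite ν] (s : Finset ℕ) {D : ℕ → Set (ℕ → ℕ)}
    (hD : ∀ j ∈ s, DepOn (Finset.range j) (D j))
    (hdisj : (s : Set ℕ).PairwiseDisjoint D) (B : ℝ≥0∞)
    (hB : ∀ j ∈ s, ∀ ω ∈ D j, mixL l ν j ω ≤ B) :
    ∫⁻ θ, IP (tl l θ) (⋃ j ∈ s, D j) ∂ν ≤ B * IP l (⋃ j ∈ s, D j) := by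
  rw [mix_eq l ν s hD hdisj]
  calc ∑ j ∈ s, ∫⁻ ω in D j, mixL l ν j ω ∂(IP l) ≤ ∑ j ∈ s, ∫⁻ ω in D j, B ∂(IP l) :=
        Finset.sum_le_sum fun j hj => setLIntegral_mono' (hD j hj).meas (hB j hj)
    _ = _ := by
        rw [measure_biUnion_finset hdisj (fun j hj => (hD j hj).meas), Finset.mul_sum]
        simp

/-- first-hit decomposition -/
def firstHit (Ex : ℕ → Set (ℕ → ℕ)) (j1 j : ℕ) : Set (ℕ → ℕ) :=
  Ex j ∩ ⋂ i ∈ Finset.Ico j1 j, (Ex i)ᶜ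

lemma dep_firstHit {Ex : ℕ → Set (ℕ → ℕ)} (hE : ∀ j, DepOn (Finset.range j) (Ex j)) (j1 j : ℕ) :
    DepOn (Finset.range j) (firstHit Ex j1 j) := by
  refine (hE j).inter (DepOn.iInter fun i => DepOn.iInter fun hi => ?_)
  refine ((hE i).mono ?_).compl
  exact Finset.range_subset_range.2 (Finset.mem_Ico.1 hi).2.le

lemma disj_firstHit (Ex : ℕ → Set (ℕ → ℕ)) (j1 j2 : ℕ) :
    ((Finset.Icc j1 j2 : Finset ℕ) : Set ℕ).PairwiseDisjoint (firstHit Ex j1) := by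
  have key : ∀ i j, j1 ≤ i → i < j → Disjoint (firstHit Ex j1 i) (firstHit Ex j1 j) := by
    intro i j hi hij
    refine Set.disjoint_left.2 fun ω h1 h2 => ?_
    have := Set.mem_iInter₂.1 h2.2 i (Finset.mem_Ico.2 ⟨hi, hij⟩)
    exact this h1.1
  intro i hi j hj hij
  simp only [Finset.coe_Icc, Set.mem_Icc] at hi hj
  rcases lt_or_gt_of_ne hij with h | h
  · exact key i j hi.1 h
  · exact (key j i hj.1 h).symm

lemma union_firstHit (Ex : ℕ → Set (ℕ → ℕ)) (j1 j2 : ℕ) :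
    (⋃ j ∈ Finset.Icc j1 j2, firstHit Ex j1 j) = ⋃ j ∈ Finset.Icc j1 j2, Ex j := by
  ext ω
  simp only [Set.mem_iUnion, Finset.mem_Icc, exists_prop]
  constructor
  · rintro ⟨j, hj, h⟩
    exact ⟨j, hj, h.1⟩
  · rintro ⟨j, hj, h⟩
    classical
    have hex : ∃ j, (j1 ≤ j ∧ j ≤ j2) ∧ ω ∈ Ex j := ⟨j, hj, h⟩
    refine ⟨Nat.find hex, (Nat.find_spec hex).1, (Nat.find_spec hex).2, ?_⟩
    refine Set.mem_iInter₂.2 fun i hi hE => ?_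
    rw [Finset.mem_Ico] at hi
    exact Nat.find_min hex hi.2 ⟨⟨hi.1, by have := (Nat.find_spec hex).1.2; omega⟩, hE⟩

/-- Chernoff -/
lemma chernoff (l : ℕ → ℝ≥0) (j : ℕ) (θ y : ℝ) {A : Set (ℕ → ℕ)} (hA : DepOn (Finset.range j) A)
    (h : ∀ ω ∈ A, y ≤ θ * S ω j - Lam l j * (Real.exp θ - 1)) :
    IP l A ≤ ENNReal.ofReal (Real.exp (-y)) := by
  have h1 : ENNReal.ofReal (Real.exp y) * IP l A ≤ 1 := by
    calc ENNReal.ofReal (Real.exp y) * IP l A = ∫⁻ ω in A, ENNReal.ofReal (Real.exp y) ∂(IP l) := by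
          simp
      _ ≤ ∫⁻ ω in A, ENNReal.ofReal (dens l j θ ω) ∂(IP l) :=
          setLIntegral_mono' hA.meas fun ω hω =>
            ENNReal.ofReal_le_ofReal (Real.exp_le_exp.2 (h ω hω))
      _ = IP (tl l θ) A := (tilt' l j θ hA).symm
      _ ≤ 1 := prob_le_one
  calc IP l A = ENNReal.ofReal (Real.exp (-y)) * (ENNReal.ofReal (Real.exp y) * IP l A) := by
        rw [← mul_assoc, ← ENNReal.ofReal_mul (Real.exp_pos _).le, ← Real.exp_add]; simp
    _ ≤ ENNReal.ofReal (Real.exp (-y)) * 1 := by gcongr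
    _ = _ := mul_one _

lemma exp_sub_le_sq {θ : ℝ} (h : |θ| ≤ 1) : Real.exp θ - 1 - θ ≤ θ ^ 2 := by
  have := Real.abs_exp_sub_one_sub_id_le h
  exact (le_abs_self _).trans this

lemma chernoff_abs (l : ℕ → ℝ≥0) (j : ℕ) (c : ℝ) (hL : 1 ≤ Lam l j) :
    IP l {ω | c * Real.sqrt (Lam l j) ≤ |S ω j - Lam l j|} ≤
      ENNReal.ofReal (2 * Real.exp (1 - c)) := by
  set L := Lam l j with hLdef
  have hs : 1 ≤ Real.sqrt L := Real.one_le_sqrt.2 hL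
  have hsq : Real.sqrt L ^ 2 = L := Real.sq_sqrt (by linarith)
  have key : ∀ θ : ℝ, θ ^ 2 * L ≤ 1 → |θ| ≤ 1 → L * (Real.exp θ - 1) ≤ L * θ + 1 := by
    intro θ h1 h2
    have := exp_sub_le_sq h2
    nlinarith
  have hi : |(Real.sqrt L)⁻¹| ≤ 1 := by
    rw [abs_of_pos (by positivity)]; exact inv_le_one_of_one_le₀ hs
  have hq : (Real.sqrt L)⁻¹ ^ 2 * L ≤ 1 := by
    rw [inv_pow, hsq, inv_mul_cancel₀ (by linarith)]
  have hp : (Real.sqrt L)⁻¹ * Real.sqrt L = 1 := inv_mul_cancel₀ (by positivity)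
  have hsub : {ω : ℕ → ℕ | c * Real.sqrt L ≤ |S ω j - L|} ⊆
      {ω | c * Real.sqrt L ≤ S ω j - L} ∪ {ω | c * Real.sqrt L ≤ -(S ω j - L)} := by
    intro ω hω
    simp only [Set.mem_ofPred_eq, Set.mem_union] at *
    exact le_abs.1 hω
  have h1 : IP l {ω | c * Real.sqrt L ≤ S ω j - L} ≤ ENNReal.ofReal (Real.exp (-(c - 1))) := by
    refine chernoff l j (Real.sqrt L)⁻¹ (c - 1)
      (depS j (fun x => c * Real.sqrt L ≤ x - L)) fun ω hω => ?_
    simp only [Set.mem_ofPred_eq] at hω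
    have h3 := key _ hq hi
    have : (Real.sqrt L)⁻¹ * (c * Real.sqrt L) ≤ (Real.sqrt L)⁻¹ * (S ω j - L) := by gcongr
    have h4 : (Real.sqrt L)⁻¹ * (c * Real.sqrt L) = c := by
      rw [mul_left_comm, hp, mul_one]
    rw [← hLdef]
    nlinarith
  have h2 : IP l {ω | c * Real.sqrt L ≤ -(S ω j - L)} ≤ ENNReal.ofReal (Real.exp (-(c - 1))) := by
    refine chernoff l j (-(Real.sqrt L)⁻¹) (c - 1)
      (depS j (fun x => c * Real.sqrt L ≤ -(x - L))) fun ω hω => ?_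
    simp only [Set.mem_ofPred_eq] at hω
    have h3 := key (-(Real.sqrt L)⁻¹) (by rw [neg_sq]; exact hq) (by rw [abs_neg]; exact hi)
    have : (Real.sqrt L)⁻¹ * (c * Real.sqrt L) ≤ (Real.sqrt L)⁻¹ * (-(S ω j - L)) := by gcongr
    have h4 : (Real.sqrt L)⁻¹ * (c * Real.sqrt L) = c := by
      rw [mul_left_comm, hp, mul_one]
    rw [← hLdef]
    nlinarith
  calc _ ≤ _ := measure_mono hsub
    _ ≤ _ := measure_union_le _ _
    _ ≤ ENNReal.ofReal (Real.exp (-(c - 1))) + ENNReal.ofReal (Real.exp (-(c - 1))) :=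
        add_le_add h1 h2
    _ = _ := by
        rw [← ENNReal.ofReal_add (by positivity) (by positivity)]
        congr 1
        rw [neg_sub]; ring

end HC

namespace HC
open MeasureTheory Filter Topology ProbabilityTheory
open scoped ENNReal NNReal

/-- `u φ(u)` -/
noncomputable def ph (u : ℝ) : ℝ := u * Real.exp (-(u ^ 2 / 2)) / Real.sqrt (2 * Real.pi)

lemma ph_pos {u : ℝ} (hu : 0 < u) : 0 < ph u := by
  unfold ph; positivity

/-- mixing measure `dθ/θ` on `s * [θ1, θ2]` -/
noncomputable def nu (s θ1 θ2 : ℝ) : Measure ℝ :=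
  ((volume.restrict (Set.Icc θ1 θ2)).withDensity (fun θ => ENNReal.ofReal θ⁻¹)).map (fun θ => s * θ)

instance (s θ1 θ2 : ℝ) : SFinite (nu s θ1 θ2) := by
  unfold nu; infer_instance

lemma lintegral_nu (s θ1 θ2 : ℝ) {f : ℝ → ℝ≥0∞} (hf : Measurable f) :
    ∫⁻ θ, f θ ∂(nu s θ1 θ2) = ∫⁻ θ in Set.Icc θ1 θ2, ENNReal.ofReal θ⁻¹ * f (s * θ) := by
  unfold nu
  rw [lintegral_map hf (by fun_prop), lintegral_withDensity_eq_lintegral_mul _ (by fun_prop)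
    (by fun_prop)]
  rfl

lemma ofReal_intervalIntegral {f : ℝ → ℝ} {a b : ℝ} (hab : a ≤ b)
    (hf : ContinuousOn f (Set.Icc a b)) (h0 : ∀ x ∈ Set.Icc a b, 0 ≤ f x) :
    ∫⁻ θ in Set.Icc a b, ENNReal.ofReal (f θ) = ENNReal.ofReal (∫ x in a..b, f x) := by
  rw [intervalIntegral.integral_of_le hab, ← integral_Icc_eq_integral_Ioc,
    ofReal_integral_eq_lintegral_ofReal (hf.integrableOn_Icc)]
  exact (ae_restrict_iff' measurableSet_Icc).2 (Eventually.of_forall h0)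

lemma nu_univ {s θ1 θ2 : ℝ} (h1 : 0 < θ1) (h2 : θ1 ≤ θ2) :
    nu s θ1 θ2 Set.univ = ENNReal.ofReal (Real.log (θ2 / θ1)) := by
  have := lintegral_nu s θ1 θ2 (f := fun _ => 1) measurable_const
  simp only [lintegral_one, mul_one] at this
  rw [this, ofReal_intervalIntegral h2, integral_inv_of_pos h1 (h1.trans_le h2)]
  · intro x hx
    exact (continuousAt_inv₀ (by have := hx.1; intro h; rw [h] at this; linarith)).continuousWithinAt
  · intro x hx
    exact inv_nonneg.2 (h1.le.trans hx.1)

lemma mixL_nu (l : ℕ → ℝ≥0) (s θ1 θ2 : ℝ) (j : ℕ) (ω : ℕ → ℕ) :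
    mixL l (nu s θ1 θ2) j ω =
      ∫⁻ θ in Set.Icc θ1 θ2, ENNReal.ofReal θ⁻¹ * ENNReal.ofReal (dens l j (s * θ) ω) := by
  unfold mixL
  rw [lintegral_nu]
  unfold dens
  fun_prop

/-- Gaussian integral over `[-c, c]` -/
noncomputable def G (c : ℝ) : ℝ := ∫ w in (-c)..c, Real.exp (-(w ^ 2 / 2))

lemma integrable_gauss : Integrable (fun w : ℝ => Real.exp (-(w ^ 2 / 2))) := by
  have := integrable_exp_neg_mul_sq (b := 1 / 2) (by norm_num)
  refine this.congr (Eventually.of_forall fun x => ?_)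
  simp only; congr 1; ring

lemma integral_gauss' : ∫ w : ℝ, Real.exp (-(w ^ 2 / 2)) = Real.sqrt (2 * Real.pi) := by
  have := integral_gaussian (1 / 2)
  rw [show Real.pi / (1 / 2) = 2 * Real.pi by ring] at this
  rw [← this]
  congr 1; ext w; congr 1; ring

lemma tendsto_G : Tendsto G atTop (𝓝 (Real.sqrt (2 * Real.pi))) := by
  rw [← integral_gauss']
  exact intervalIntegral_tendsto_integral integrable_gauss tendsto_neg_atTop_atBot tendsto_id

/-- cubic upper bound -/
lemma exp_cubic_upper {x : ℝ} (h : |x| ≤ 1) : Real.exp x - 1 - x ≤ x ^ 2 / 2 + |x| ^ 3 := by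
  have := Real.exp_bound h (n := 3) (by norm_num)
  have h2 := (abs_le.1 this).2
  simp [Finset.sum_range_succ, Nat.factorial] at h2
  have : 0 ≤ |x| ^ 3 := by positivity
  nlinarith

lemma exp_cubic_lower {x : ℝ} (h : |x| ≤ 1) : x ^ 2 / 2 - |x| ^ 3 ≤ Real.exp x - 1 - x := by
  have := Real.exp_bound h (n := 3) (by norm_num)
  have h2 := (abs_le.1 this).1
  simp [Finset.sum_range_succ, Nat.factorial] at h2
  have : 0 ≤ |x| ^ 3 := by positivity
  nlinarith

/-- lower bound for the mixture on exceedance -/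
lemma mix_lower (l : ℕ → ℝ≥0) (s : ℝ) (hs : s = 1 ∨ s = -1) (u L1 L2 : ℝ) (hu : 4 ≤ u)
    (j : ℕ) (ω : ℕ → ℕ)
    (hL0 : u ^ 8 ≤ L1) (hL1 : L1 ≤ Lam l j) (hL2 : Lam l j ≤ L2)
    (hex : u * Real.sqrt (Lam l j) ≤ s * (S ω j - Lam l j)) :
    ENNReal.ofReal (Real.exp (u ^ 2 / 2 - 8 / u) / (u + Real.sqrt u) * G (Real.sqrt u)) ≤
      mixL l (nu s ((u - Real.sqrt u) / Real.sqrt L2) ((u + Real.sqrt u) / Real.sqrt L1)) j ω := by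
  rw [mixL_nu]
  set L := Lam l j with hL
  set q := Real.sqrt L with hq
  set v := Real.sqrt u with hv
  have hu0 : 0 < u := by linarith
  have hv2 : v ^ 2 = u := Real.sq_sqrt hu0.le
  have hv0 : 2 ≤ v := by
    rw [hv]; exact Real.le_sqrt_of_sq_le (by linarith)
  have hvu : v < u := by nlinarith
  have hL1p : 0 < L1 := lt_of_lt_of_le (by positivity) hL0
  have hLp : 0 < L := hL1p.trans_le hL1
  have hq2 : q ^ 2 = L := Real.sq_sqrt hLp.le
  have hqu : u ^ 4 ≤ q := by
    rw [hq]; refine Real.le_sqrt_of_sq_le ?_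
    calc (u ^ 4) ^ 2 = u ^ 8 := by ring
      _ ≤ L := hL0.trans hL1
  have hq0 : 0 < q := lt_of_lt_of_le (by positivity) hqu
  have hsub : Set.Icc ((u - v) / q) ((u + v) / q) ⊆
      Set.Icc ((u - v) / Real.sqrt L2) ((u + v) / Real.sqrt L1) := by
    refine Set.Icc_subset_Icc ?_ ?_
    · exact div_le_div_of_nonneg_left (by linarith) hq0 (Real.sqrt_le_sqrt hL2)
    · exact div_le_div_of_nonneg_left (by linarith) (Real.sqrt_pos.2 hL1p) (Real.sqrt_le_sqrt hL1)
  refine le_trans ?_ (lintegral_mono_set hsub)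
  have hpt : ∀ θ ∈ Set.Icc ((u - v) / q) ((u + v) / q),
      ENNReal.ofReal (q / (u + v) * Real.exp (u ^ 2 / 2 - 8 / u) *
        Real.exp (-((q * θ - u) ^ 2 / 2))) ≤
      ENNReal.ofReal θ⁻¹ * ENNReal.ofReal (dens l j (s * θ) ω) := by
    intro θ hθ
    have ha : u - v ≤ q * θ := by
      have := hθ.1; rw [div_le_iff₀ hq0] at this; linarith
    have hb : q * θ ≤ u + v := by
      have := hθ.2; rw [le_div_iff₀ hq0] at this; linarith
    have hθ0 : 0 < θ := by
      have : 0 < q * θ := by linarith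
      exact pos_of_mul_pos_right this hq0.le
    have hqθ : q * θ ≤ 2 * u := by linarith
    have hθ1 : θ ≤ 1 := by
      have : q * θ ≤ q * 1 := by
        have : 2 * u ≤ u ^ 4 := by nlinarith [pow_le_pow_left₀ (by norm_num) hu 3]
        linarith
      exact le_of_mul_le_mul_left this hq0
    rw [← ENNReal.ofReal_mul (by positivity)]
    refine ENNReal.ofReal_le_ofReal ?_
    rw [mul_assoc, ← Real.exp_add]
    have h1 : q / (u + v) ≤ θ⁻¹ := by
      rw [div_le_iff₀ (by linarith), inv_mul_eq_div, le_div_iff₀ hθ0]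
      exact hb
    have habs : |s * θ| = θ := by
      rcases hs with h | h <;> simp [h, abs_of_pos hθ0]
    have hss : s ^ 2 = 1 := by rcases hs with h | h <;> simp [h]
    have h3 := exp_cubic_upper (x := s * θ) (by rw [habs]; exact hθ1)
    rw [habs] at h3
    have hcub : L * θ ^ 3 ≤ 8 / u := by
      rw [le_div_iff₀ hu0]
      have e1 : q * (L * θ ^ 3 * u) = (q * θ) ^ 3 * u := by rw [← hq2]; ring
      have e2 : (q * θ) ^ 3 * u ≤ (2 * u) ^ 3 * u := by gcongr
      have e3 : q * (L * θ ^ 3 * u) ≤ q * 8 := by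
        rw [e1]; nlinarith
      exact le_of_mul_le_mul_left e3 hq0
    have h2 : Real.exp (u ^ 2 / 2 - 8 / u + -((q * θ - u) ^ 2 / 2)) ≤ dens l j (s * θ) ω := by
      unfold dens
      refine Real.exp_le_exp.2 ?_
      rw [← hL]
      have e4 : L * (Real.exp (s * θ) - 1) ≤ L * (s * θ + ((s * θ) ^ 2 / 2 + θ ^ 3)) := by
        gcongr; linarith
      have e5 : θ * (u * q) ≤ θ * (s * (S ω j - L)) := by gcongr
      rw [mul_pow, hss] at e4
      have e6 : (q * θ) ^ 2 = L * θ ^ 2 := by rw [mul_pow, hq2]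
      nlinarith
    exact mul_le_mul h1 h2 (Real.exp_pos _).le (by positivity)
  refine le_trans ?_ (setLIntegral_mono' measurableSet_Icc hpt)
  have hcont : Continuous (fun θ : ℝ => q / (u + v) * Real.exp (u ^ 2 / 2 - 8 / u) *
        Real.exp (-((q * θ - u) ^ 2 / 2))) := by fun_prop
  rw [ofReal_intervalIntegral (by gcongr; linarith) hcont.continuousOn (fun x _ => by positivity)]
  refine ENNReal.ofReal_le_ofReal (le_of_eq ?_)
  rw [intervalIntegral.integral_const_mul,
    intervalIntegral.integral_comp_mul_sub (fun w => Real.exp (-(w ^ 2 / 2))) hq0.ne' u]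
  have e1 : q * ((u - v) / q) - u = -v := by field_simp; ring
  have e2 : q * ((u + v) / q) - u = v := by field_simp; ring
  rw [e1, e2, smul_eq_mul]
  unfold G
  field_simp

lemma windowU_side (l : ℕ → ℝ≥0) (s : ℝ) (hs : s = 1 ∨ s = -1) (u : ℝ) (hu : 16 ≤ u)
    (j1 j2 : ℕ) (hj : j1 ≤ j2) (hL0 : u ^ 8 ≤ Lam l j1) :
    ENNReal.ofReal (Real.exp (u ^ 2 / 2 - 8 / u) / (u + Real.sqrt u) * G (Real.sqrt u)) *
      IP l (⋃ j ∈ Finset.Icc j1 j2, {ω | u * Real.sqrt (Lam l j) ≤ s * (S ω j - Lam l j)}) ≤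
      ENNReal.ofReal (1 / 2 * Real.log (Lam l j2 / Lam l j1) + 1) := by
  set Ex : ℕ → Set (ℕ → ℕ) := fun j => {ω | u * Real.sqrt (Lam l j) ≤ s * (S ω j - Lam l j)} with hEx
  have hE : ∀ j, DepOn (Finset.range j) (Ex j) := fun j =>
    depS j (fun x => u * Real.sqrt (Lam l j) ≤ s * (x - Lam l j))
  have h1 := upperAbs l (nu s ((u - Real.sqrt u) / Real.sqrt (Lam l j2))
      ((u + Real.sqrt u) / Real.sqrt (Lam l j1))) (Finset.Icc j1 j2) (D := firstHit Ex j1)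
      (fun j _ => dep_firstHit hE j1 j) (disj_firstHit Ex j1 j2)
      (ENNReal.ofReal (Real.exp (u ^ 2 / 2 - 8 / u) / (u + Real.sqrt u) * G (Real.sqrt u)))
      (fun j hj ω hω => mix_lower l s hs u _ _ (by linarith) j ω hL0
        (Lam_mono l (Finset.mem_Icc.1 hj).1) (Lam_mono l (Finset.mem_Icc.1 hj).2) hω.1)
  rw [union_firstHit] at h1
  refine h1.trans ?_
  set v := Real.sqrt u with hv
  have hu0 : 0 < u := by linarith
  have hv2 : v ^ 2 = u := Real.sq_sqrt hu0.le
  have hv0 : 4 ≤ v := by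
    rw [hv]; exact Real.le_sqrt_of_sq_le (by linarith)
  have hvu : v ≤ u / 4 := by nlinarith
  have hL1p : 0 < Lam l j1 := lt_of_lt_of_le (by positivity) hL0
  have hL12 := Lam_mono l hj
  have hL2p : 0 < Lam l j2 := hL1p.trans_le hL12
  have hp1 : 0 < u - v := by linarith
  have hp2 : 0 < u + v := by linarith
  have hs1 : 0 < Real.sqrt (Lam l j1) := Real.sqrt_pos.2 hL1p
  have hs2 : 0 < Real.sqrt (Lam l j2) := Real.sqrt_pos.2 hL2p
  rw [nu_univ (by positivity)]
  · refine ENNReal.ofReal_le_ofReal ?_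
    rw [Real.log_div (by positivity) (by positivity), Real.log_div (by positivity) (by positivity),
      Real.log_div hp1.ne' (by positivity), Real.log_div hL2p.ne' hL1p.ne',
      Real.log_sqrt hL1p.le, Real.log_sqrt hL2p.le]
    have : Real.log (u + v) - Real.log (u - v) ≤ 1 := by
      rw [← Real.log_div hp2.ne' hp1.ne', Real.log_le_iff_le_exp (by positivity)]
      have : (2:ℝ) ≤ Real.exp 1 := by linarith [Real.add_one_le_exp (1:ℝ)]
      refine le_trans ?_ this
      rw [div_le_iff₀ hp1]; linarith
    linarith
  · have := Real.sqrt_le_sqrt hL12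
    gcongr; linarith

theorem windowU (ε : ℝ) (hε : 0 < ε) : ∃ u0 : ℝ, 16 ≤ u0 ∧ ∀ u ≥ u0, ∀ (l : ℕ → ℝ≥0) (j1 j2 : ℕ),
    j1 ≤ j2 → u ^ 8 ≤ Lam l j1 →
    IP l {ω | ∃ j ∈ Finset.Icc j1 j2, u * Real.sqrt (Lam l j) ≤ |S ω j - Lam l j|} ≤
      ENNReal.ofReal ((1 + ε) * (2 * ph u * (1 / 2 * Real.log (Lam l j2 / Lam l j1) + 1))) := by
  have hlim : Tendsto (fun u : ℝ => (1 + ε) * (Real.exp (-(8 / u)) / (1 + (Real.sqrt u)⁻¹)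
      * G (Real.sqrt u) / Real.sqrt (2 * Real.pi))) atTop (𝓝 ((1 + ε) * (Real.exp (-0) / (1 + 0) *
        Real.sqrt (2 * Real.pi) / Real.sqrt (2 * Real.pi)))) := by
    refine Tendsto.const_mul _ (Tendsto.div_const (Tendsto.mul (Tendsto.div ?_ ?_ (by norm_num))
      (tendsto_G.comp Real.tendsto_sqrt_atTop)) _)
    · exact (Real.continuous_exp.tendsto _).comp (Tendsto.neg (tendsto_const_nhds.div_atTop tendsto_id))
    · exact tendsto_const_nhds.add (tendsto_inv_atTop_zero.comp Real.tendsto_sqrt_atTop)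
  have hsp : 0 < Real.sqrt (2 * Real.pi) := by positivity
  have h1 : (1:ℝ) < ((1 + ε) * (Real.exp (-0) / (1 + 0) *
        Real.sqrt (2 * Real.pi) / Real.sqrt (2 * Real.pi))) := by
    rw [neg_zero, Real.exp_zero, add_zero, div_one, one_mul, div_self hsp.ne']; linarith
  obtain ⟨u1, hu1⟩ := eventually_atTop.1 (hlim.eventually (lt_mem_nhds h1))
  refine ⟨max u1 16, le_max_right _ _, fun u hu l j1 j2 hj hL0 => ?_⟩
  have h16 : 16 ≤ u := (le_max_right _ _).trans hu
  have hu0 : 0 < u := by linarith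
  have hkey := hu1 u ((le_max_left _ _).trans hu)
  set B := Real.exp (u ^ 2 / 2 - 8 / u) / (u + Real.sqrt u) * G (Real.sqrt u) with hB
  have hs0 : 0 < Real.sqrt u := Real.sqrt_pos.2 hu0
  have hss : Real.sqrt u * Real.sqrt u = u := Real.mul_self_sqrt hu0.le
  have hBe : (1 + ε) * (Real.exp (-(8 / u)) / (1 + (Real.sqrt u)⁻¹)
      * G (Real.sqrt u) / Real.sqrt (2 * Real.pi)) = (1 + ε) * ph u * B := by
    have e2 : Real.exp (-(u ^ 2 / 2)) * Real.exp (u ^ 2 / 2 - 8 / u) = Real.exp (-(8 / u)) := by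
      rw [← Real.exp_add]; congr 1; ring
    have e3 : u * (1 + (Real.sqrt u)⁻¹) = u + Real.sqrt u := by
      field_simp; linear_combination -hss
    rw [hB, ph, ← e2, ← e3]
    field_simp
  rw [hBe] at hkey
  have hBpos : 0 < B := by
    have : 0 < (1 + ε) * ph u := by have := ph_pos hu0; positivity
    by_contra h
    push Not at h
    nlinarith
  set R := 1 / 2 * Real.log (Lam l j2 / Lam l j1) + 1 with hR
  have hR0 : 0 ≤ R := by
    have hL1p : 0 < Lam l j1 := lt_of_lt_of_le (by positivity) hL0
    have := Real.log_nonneg ((one_le_div hL1p).2 (Lam_mono l hj))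
    rw [hR]; linarith
  have side : ∀ s : ℝ, (s = 1 ∨ s = -1) → IP l (⋃ j ∈ Finset.Icc j1 j2,
      {ω | u * Real.sqrt (Lam l j) ≤ s * (S ω j - Lam l j)}) ≤
      ENNReal.ofReal ((1 + ε) * ph u * R) := by
    intro s hs
    have h := windowU_side l s hs u h16 j1 j2 hj hL0
    rw [← hB, ← hR] at h
    have h2 : IP l (⋃ j ∈ Finset.Icc j1 j2,
      {ω | u * Real.sqrt (Lam l j) ≤ s * (S ω j - Lam l j)}) ≤ ENNReal.ofReal R / ENNReal.ofReal B := by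
      rw [ENNReal.le_div_iff_mul_le (by left; simpa using hBpos) (by left; simp), mul_comm]
      exact h
    refine h2.trans ?_
    rw [← ENNReal.ofReal_div_of_pos hBpos]
    refine ENNReal.ofReal_le_ofReal ?_
    rw [div_le_iff₀ hBpos]
    nlinarith
  have hsub : {ω : ℕ → ℕ | ∃ j ∈ Finset.Icc j1 j2, u * Real.sqrt (Lam l j) ≤ |S ω j - Lam l j|} ⊆
      (⋃ j ∈ Finset.Icc j1 j2, {ω | u * Real.sqrt (Lam l j) ≤ 1 * (S ω j - Lam l j)}) ∪
      (⋃ j ∈ Finset.Icc j1 j2, {ω | u * Real.sqrt (Lam l j) ≤ (-1) * (S ω j - Lam l j)}) := by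
    rintro ω ⟨j, hj, h⟩
    rcases le_abs.1 h with h | h
    · exact Or.inl (Set.mem_iUnion₂.2 ⟨j, hj, by simpa using h⟩)
    · exact Or.inr (Set.mem_iUnion₂.2 ⟨j, hj, by simpa using h⟩)
  calc _ ≤ _ := measure_mono hsub
    _ ≤ _ := measure_union_le _ _
    _ ≤ _ := add_le_add (side 1 (Or.inl rfl)) (side (-1) (Or.inr rfl))
    _ = _ := by
      have : 0 ≤ (1 + ε) * ph u * R := by have := ph_pos hu0; positivity
      rw [← ENNReal.ofReal_add this this]
      congr 1; ring

end HC

namespace HC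
open MeasureTheory Filter Topology ProbabilityTheory
open scoped ENNReal NNReal

lemma lintegral_gauss_affine (b q c : ℝ) (hb : 0 < b) (hq : 0 < q) :
    ∫⁻ θ : ℝ, ENNReal.ofReal (Real.exp (-b * (q * θ - c) ^ 2)) =
      ENNReal.ofReal (Real.sqrt (Real.pi / b) / q) := by
  have hi0 := integrable_exp_neg_mul_sq hb
  have hi1 : Integrable (fun y : ℝ => Real.exp (-b * (y - c) ^ 2)) := hi0.comp_sub_right c
  have hi2 : Integrable (fun θ : ℝ => Real.exp (-b * (q * θ - c) ^ 2)) :=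
    (integrable_comp_mul_left_iff (fun y : ℝ => Real.exp (-b * (y - c) ^ 2)) hq.ne').2 hi1
  rw [← ofReal_integral_eq_lintegral_ofReal hi2 (Eventually.of_forall fun x => (Real.exp_pos _).le)]
  congr 1
  rw [Measure.integral_comp_mul_left (fun y : ℝ => Real.exp (-b * (y - c) ^ 2)),
    integral_sub_right_eq_self (fun y : ℝ => Real.exp (-b * y ^ 2)) c, integral_gaussian,
    abs_of_pos (by positivity), smul_eq_mul]
  field_simp

lemma mix_upper_opp (l : ℕ → ℝ≥0) (s θ1 θ2 : ℝ) (h1 : 0 < θ1) (h2 : θ1 ≤ θ2)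
    (j : ℕ) (ω : ℕ → ℕ) (hW : s * (S ω j - Lam l j) ≤ 0) :
    mixL l (nu s θ1 θ2) j ω ≤ ENNReal.ofReal (Real.log (θ2 / θ1)) := by
  rw [← nu_univ (s := s) h1 h2, mixL_nu]
  have := lintegral_nu s θ1 θ2 (f := fun _ => 1) measurable_const
  simp only [lintegral_one, mul_one] at this
  rw [this]
  refine setLIntegral_mono' measurableSet_Icc fun θ hθ => ?_
  have hθ0 : 0 < θ := h1.trans_le hθ.1
  calc _ ≤ ENNReal.ofReal θ⁻¹ * 1 := by
        gcongr
        refine ENNReal.ofReal_le_one.2 (Real.exp_le_one_iff.2 ?_)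
        have e1 := Real.add_one_le_exp (s * θ)
        have e2 := Lam_nonneg l j
        have e3 : θ * (s * (S ω j - Lam l j)) ≤ 0 := mul_nonpos_of_nonneg_of_nonpos hθ0.le hW
        nlinarith
    _ = _ := mul_one _

set_option maxHeartbeats 1000000 in
lemma mix_upper_same (l : ℕ → ℝ≥0) (s : ℝ) (hs : s = 1 ∨ s = -1) (u δ θ1 L1 : ℝ)
    (hu : 64 ≤ u) (hδ0 : 0 < δ) (hδ1 : δ ≤ 1) (hδu : 8 ≤ δ * u)
    (j : ℕ) (ω : ℕ → ℕ)
    (hL0 : u ^ 8 ≤ L1) (hL1 : L1 ≤ Lam l j) (hθ1 : 0 < θ1)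
    (hθ12 : θ1 ≤ (u - Real.sqrt u) / Real.sqrt L1)
    (hW : s * (S ω j - Lam l j) ≤ (u + δ / u) * Real.sqrt (Lam l j)) :
    mixL l (nu s θ1 ((u - Real.sqrt u) / Real.sqrt L1)) j ω ≤
      ENNReal.ofReal (Real.exp 2 * Real.log (((u - Real.sqrt u) / Real.sqrt L1) / θ1) +
        Real.exp (u ^ 2 / 2 + 2 * δ) * (u * Real.exp (-(u / 8)) *
          Real.sqrt (Real.pi / ((1 - 2 / u ^ 3) / 4)) +
          Real.sqrt (Real.pi / ((1 - 2 / u ^ 3) / 2)) / (u - Real.sqrt u))) := by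
  set L := Lam l j with hL
  set q := Real.sqrt L with hq
  set v := Real.sqrt u with hv
  set θ2 := (u - v) / Real.sqrt L1 with hθ2
  set ρ := 1 - 2 / u ^ 3 with hρ
  set z := u + δ / u with hz
  have hu0 : 0 < u := by linarith
  have hv2 : v ^ 2 = u := Real.sq_sqrt hu0.le
  have hv0 : 8 ≤ v := by rw [hv]; exact Real.le_sqrt_of_sq_le (by linarith)
  have hvu : v < u := by nlinarith
  have hL1p : 0 < L1 := lt_of_lt_of_le (by positivity) hL0
  have hLp : 0 < L := hL1p.trans_le hL1
  have hq2 : q ^ 2 = L := Real.sq_sqrt hLp.le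
  have hs1 : u ^ 4 ≤ Real.sqrt L1 := Real.le_sqrt_of_sq_le (by
    calc (u ^ 4) ^ 2 = u ^ 8 := by ring
      _ ≤ L1 := hL0)
  have hs1p : 0 < Real.sqrt L1 := Real.sqrt_pos.2 hL1p
  have hqu : Real.sqrt L1 ≤ q := Real.sqrt_le_sqrt hL1
  have hq0 : 0 < q := hs1p.trans_le hqu
  have hu3 : (64:ℝ) ^ 3 ≤ u ^ 3 := pow_le_pow_left₀ (by norm_num) hu 3
  have hu3' : 1 / u ^ 3 ≤ 1 / 64 ^ 3 := one_div_le_one_div_of_le (by norm_num) hu3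
  have hρe : ρ = 1 - 2 * (1 / u ^ 3) := by rw [hρ]; ring
  have hρ1 : 1 / 2 ≤ ρ := by rw [hρe]; norm_num at hu3' ⊢; linarith
  have hρ2 : ρ ≤ 1 := by
    rw [hρe]; have : 0 ≤ 1 / u ^ 3 := by positivity
    linarith
  have hρ0 : 0 < ρ := by linarith
  have hzρ : z ^ 2 / (2 * ρ) ≤ u ^ 2 / 2 + 2 * δ := by
    rw [div_le_iff₀ (by positivity)]
    have i1 : 1 / u ≤ δ / 8 := by rw [div_le_div_iff₀ hu0 (by norm_num)]; linarith
    have e1 : z ^ 2 = u ^ 2 + 2 * δ + δ ^ 2 * (1 / u) ^ 2 := by rw [hz]; field_simp; ring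
    have e2 : (u ^ 2 / 2 + 2 * δ) * (2 * ρ) = u ^ 2 + 4 * δ - 2 * (1 / u) - 8 * δ * (1 / u ^ 3) := by
      rw [hρ]; field_simp; ring
    rw [e1, e2]
    have i2 : (1 / u) ^ 2 ≤ 1 / 64 ^ 2 := by
      rw [div_pow, one_pow]
      exact one_div_le_one_div_of_le (by norm_num) (pow_le_pow_left₀ (by norm_num) hu 2)
    have i3 : 8 * δ * (1 / u ^ 3) ≤ 8 * δ * (1 / 64 ^ 3) := by gcongr
    have i4 : δ ^ 2 * (1 / u) ^ 2 ≤ δ * (1 / 64 ^ 2) := by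
      have : δ ^ 2 ≤ δ := by nlinarith
      exact mul_le_mul this i2 (by positivity) hδ0.le
    norm_num at i3 i4 ⊢
    norm_num at i1
    linarith
  set c := z / ρ with hc
  have hzu : u ≤ z := by rw [hz]; have : 0 ≤ δ / u := by positivity
                         linarith
  have hcu : u ≤ c := by
    rw [hc, le_div_iff₀ hρ0]
    calc u * ρ ≤ u * 1 := by gcongr
      _ ≤ z := by linarith
  set E := Real.exp (u ^ 2 / 2 + 2 * δ) with hE
  have hpt : ∀ θ ∈ Set.Icc θ1 θ2, ENNReal.ofReal θ⁻¹ * ENNReal.ofReal (dens l j (s * θ) ω) ≤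
      ENNReal.ofReal (Real.exp 2) * ENNReal.ofReal θ⁻¹ +
      (ENNReal.ofReal (u * q * E * Real.exp (-(u / 8))) *
          ENNReal.ofReal (Real.exp (-(ρ / 4) * (q * θ - c) ^ 2)) +
        ENNReal.ofReal (q / (u - v) * E) *
          ENNReal.ofReal (Real.exp (-(ρ / 2) * (q * θ - c) ^ 2))) := by
    intro θ hθ
    have hθ0 : 0 < θ := hθ1.trans_le hθ.1
    have hi0 : 0 < θ⁻¹ := by positivity
    have hθu : θ ≤ 1 / u ^ 3 := by
      refine hθ.2.trans ?_
      rw [hθ2, div_le_div_iff₀ hs1p (by positivity)]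
      calc (u - v) * u ^ 3 ≤ u * u ^ 3 := by gcongr; linarith
        _ = u ^ 4 := by ring
        _ ≤ _ := by linarith
    have hθ11 : θ ≤ 1 := by
      refine hθu.trans (hu3'.trans (by norm_num))
    have habs : |s * θ| = θ := by
      rcases hs with h | h <;> simp [h, abs_of_pos hθ0]
    have hss : s ^ 2 = 1 := by rcases hs with h | h <;> simp [h]
    have h3 := exp_cubic_lower (x := s * θ) (by rw [habs]; exact hθ11)
    rw [habs, mul_pow, hss, one_mul] at h3
    set y := q * θ with hy
    have hy0 : 0 < y := by positivity
    have hyL : y ^ 2 = L * θ ^ 2 := by rw [hy, mul_pow, hq2]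
    have hexp : s * θ * S ω j - L * (Real.exp (s * θ) - 1) ≤ y * z - ρ * y ^ 2 / 2 := by
      have e1 : L * (θ ^ 2 / 2 - θ ^ 3) ≤ L * (Real.exp (s * θ) - 1 - s * θ) := by gcongr
      have e2 : θ * (s * (S ω j - L)) ≤ θ * (z * q) := by gcongr
      have e3 : L * θ ^ 3 ≤ L * θ ^ 2 * (1 / u ^ 3) := by
        calc L * θ ^ 3 = L * θ ^ 2 * θ := by ring
          _ ≤ _ := by gcongr
      have e4 : ρ * y ^ 2 / 2 = L * θ ^ 2 / 2 - L * θ ^ 2 * (1 / u ^ 3) := by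
        rw [hyL, hρ]; ring
      have e5 : s * θ * S ω j - L * (Real.exp (s * θ) - 1) =
          θ * (s * (S ω j - L)) - L * (Real.exp (s * θ) - 1 - s * θ) := by ring
      have e6 : y * z = θ * (z * q) := by rw [hy]; ring
      have e7 : L * (θ ^ 2 / 2 - θ ^ 3) = L * θ ^ 2 / 2 - L * θ ^ 3 := by ring
      rw [e4, e5, e6]
      linarith
    have hsq : y * z - ρ * y ^ 2 / 2 = z ^ 2 / (2 * ρ) - ρ / 2 * (y - c) ^ 2 := by
      rw [hc]; field_simp; ring
    have hd : dens l j (s * θ) ω ≤ E * Real.exp (-(ρ / 2) * (y - c) ^ 2) := by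
      rw [hE, ← Real.exp_add]
      unfold dens
      refine Real.exp_le_exp.2 ?_
      rw [← hL]
      linarith
    have hdens0 : 0 ≤ dens l j (s * θ) ω := (Real.exp_pos _).le
    rw [← ENNReal.ofReal_mul hi0.le]
    by_cases c1 : y ≤ 1 / u
    · refine le_trans ?_ le_self_add
      rw [← ENNReal.ofReal_mul (Real.exp_pos _).le, mul_comm θ⁻¹]
      refine ENNReal.ofReal_le_ofReal ?_
      gcongr
      unfold dens
      refine Real.exp_le_exp.2 ?_
      rw [← hL]
      have : y * z ≤ 1 / u * z := by gcongr
      have e5 : 1 / u * z = 1 + δ / u ^ 2 := by rw [hz]; field_simp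
      have e6 : δ / u ^ 2 ≤ 1 := by rw [div_le_one (by positivity)]; exact hδ1.trans (one_le_pow₀ (by linarith))
      have : 0 ≤ ρ * y ^ 2 / 2 := by positivity
      linarith
    push Not at c1
    by_cases c2 : y ≤ u - v
    · refine le_trans ?_ (le_trans le_self_add le_add_self)
      rw [← ENNReal.ofReal_mul (by positivity)]
      refine ENNReal.ofReal_le_ofReal ?_
      have f1 : θ⁻¹ ≤ u * q := by
        rw [inv_le_iff_one_le_mul₀ hθ0]
        rw [div_lt_iff₀ hu0] at c1
        have : u * q * θ = y * u := by rw [hy]; ring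
        rw [this]; exact c1.le
      have f2 : Real.exp (-(ρ / 2) * (y - c) ^ 2) ≤
          Real.exp (-(u / 8)) * Real.exp (-(ρ / 4) * (y - c) ^ 2) := by
        rw [← Real.exp_add]
        refine Real.exp_le_exp.2 ?_
        have g1 : v ≤ c - y := by linarith
        have g2 : u ≤ (y - c) ^ 2 := by
          have := pow_le_pow_left₀ (by linarith) g1 2
          rw [hv2] at this
          calc u ≤ (c - y) ^ 2 := this
            _ = _ := by ring
        have g3 : 1 / 2 * u ≤ ρ * (y - c) ^ 2 := mul_le_mul hρ1 g2 hu0.le hρ0.le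
        linarith
      calc θ⁻¹ * dens l j (s * θ) ω ≤ (u * q) * (E * (Real.exp (-(u / 8)) *
            Real.exp (-(ρ / 4) * (y - c) ^ 2))) := by
            refine mul_le_mul f1 (hd.trans ?_) hdens0 (by positivity)
            gcongr
        _ = _ := by ring
    · push Not at c2
      refine le_trans ?_ (le_trans le_add_self le_add_self)
      have huv : 0 < u - v := by linarith
      rw [← ENNReal.ofReal_mul (by positivity)]
      refine ENNReal.ofReal_le_ofReal ?_
      have f1 : θ⁻¹ ≤ q / (u - v) := by
        rw [le_div_iff₀ huv, inv_mul_le_iff₀ hθ0]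
        linarith
      rw [mul_assoc]
      exact mul_le_mul f1 hd hdens0 (by positivity)
  rw [mixL_nu]
  refine (setLIntegral_mono' measurableSet_Icc hpt).trans ?_
  have huv : 0 < u - v := by linarith
  rw [lintegral_add_left (by fun_prop), lintegral_const_mul _ (by fun_prop),
    lintegral_add_left (by fun_prop), lintegral_const_mul _ (by fun_prop),
    lintegral_const_mul _ (by fun_prop)]
  have hnu := lintegral_nu s θ1 θ2 (f := fun _ => 1) measurable_const
  simp only [lintegral_one, mul_one] at hnu
  rw [← hnu, nu_univ hθ1 hθ12]
  have hlog : 0 ≤ Real.log (θ2 / θ1) := Real.log_nonneg ((one_le_div hθ1).2 hθ12)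
  have g1 := setLIntegral_le_lintegral (μ := volume) (Set.Icc θ1 θ2)
    (fun θ => ENNReal.ofReal (Real.exp (-(ρ / 4) * (q * θ - c) ^ 2)))
  have g2 := setLIntegral_le_lintegral (μ := volume) (Set.Icc θ1 θ2)
    (fun θ => ENNReal.ofReal (Real.exp (-(ρ / 2) * (q * θ - c) ^ 2)))
  rw [lintegral_gauss_affine _ _ _ (by positivity) hq0] at g1 g2
  refine (add_le_add le_rfl (add_le_add (mul_le_mul_right g1 _) (mul_le_mul_right g2 _))).trans ?_
  rw [← ENNReal.ofReal_mul (by positivity), ← ENNReal.ofReal_mul (by positivity),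
    ← ENNReal.ofReal_mul (by positivity), ← ENNReal.ofReal_add (by positivity) (by positivity),
    ← ENNReal.ofReal_add (by positivity) (by positivity)]
  refine ENNReal.ofReal_le_ofReal (le_of_eq ?_)
  field_simp

end HC

namespace HC
open MeasureTheory Filter Topology ProbabilityTheory
open scoped ENNReal NNReal

lemma chernoff_coord (l : ℕ → ℝ≥0) (i : ℕ) (x : ℝ) :
    IP l {ω | x ≤ ω i} ≤ ENNReal.ofReal (Real.exp (-(x - 2 * l i))) := by
  have hA : DepOn {i} {ω : ℕ → ℕ | x ≤ ω i} := by
    intro ω ω' h hω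
    simp only [Set.mem_ofPred_eq] at *
    rwa [← h i (by simp)]
  set y := x - 2 * (l i : ℝ) with hy
  have h1 : ENNReal.ofReal (Real.exp y) * IP l {ω | x ≤ ω i} ≤ 1 := by
    calc ENNReal.ofReal (Real.exp y) * IP l {ω | x ≤ ω i}
        = ∫⁻ ω in {ω | x ≤ ω i}, ENNReal.ofReal (Real.exp y) ∂(IP l) := by
          simp
      _ ≤ ∫⁻ ω in {ω | x ≤ ω i}, ENNReal.ofReal (Real.exp (1 * ∑ i ∈ {i}, (ω i : ℝ)
          - (∑ i ∈ {i}, (l i : ℝ)) * (Real.exp 1 - 1))) ∂(IP l) := by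
          refine setLIntegral_mono' hA.meas fun ω hω => ?_
          refine ENNReal.ofReal_le_ofReal (Real.exp_le_exp.2 ?_)
          simp only [Finset.sum_singleton, one_mul]
          simp only [Set.mem_ofPred_eq] at hω
          have h3 := Real.exp_one_lt_three
          have : (l i : ℝ) * (Real.exp 1 - 1) ≤ l i * 2 := by gcongr; linarith
          linarith
      _ = IP (fun i => l i * ex 1) {ω | x ≤ ω i} := (tilt {i} l 1 hA).symm
      _ ≤ 1 := prob_le_one
  calc IP l {ω | x ≤ ω i} = ENNReal.ofReal (Real.exp (-y)) *
        (ENNReal.ofReal (Real.exp y) * IP l {ω | x ≤ ω i}) := by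
        rw [← mul_assoc, ← ENNReal.ofReal_mul (Real.exp_pos _).le, ← Real.exp_add]; simp
    _ ≤ ENNReal.ofReal (Real.exp (-y)) * 1 := by gcongr
    _ = _ := mul_one _

lemma S_succ (ω : ℕ → ℕ) (j : ℕ) : S ω (j + 1) = S ω j + ω j := Finset.sum_range_succ _ _

lemma Lam_succ (l : ℕ → ℝ≥0) (j : ℕ) : Lam l (j + 1) = Lam l j + l j := Finset.sum_range_succ _ _

/-- tilted concentration -/
lemma tilt_conc (l : ℕ → ℝ≥0) (j : ℕ) (x c : ℝ) (hx : |x| ≤ 1 / 8) (hL : 2 ≤ Lam l j) (hc : 0 ≤ c) :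
    IP (tl l x) {ω | 3 / 2 * c * Real.sqrt (Lam l j) ≤ |S ω j - Lam l j * Real.exp x|} ≤
      ENNReal.ofReal (2 * Real.exp (1 - c)) := by
  have hx' := abs_le.1 hx
  have h1 : 1 / 2 ≤ Real.exp x := by linarith [Real.add_one_le_exp x]
  have h2 : Real.exp x ≤ 9 / 4 := by
    have := exp_sub_le_sq (θ := x) (by linarith)
    have : x ^ 2 ≤ 1 := by nlinarith
    linarith
  have h3 := chernoff_abs (tl l x) j c (by rw [Lam_tl]; nlinarith)
  rw [Lam_tl] at h3
  refine le_trans (measure_mono ?_) h3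
  intro ω hω
  simp only [Set.mem_ofPred_eq] at hω ⊢
  refine le_trans ?_ hω
  rw [Real.sqrt_mul (by linarith)]
  have : Real.sqrt (Real.exp x) ≤ 3 / 2 := by
    rw [Real.sqrt_le_left (by norm_num)]; linarith
  have := mul_le_mul_of_nonneg_left this (mul_nonneg hc (Real.sqrt_nonneg (Lam l j)))
  linarith

/-- good first hit events -/
def goodHit (l : ℕ → ℝ≥0) (u δ : ℝ) (j1 j : ℕ) : Set (ℕ → ℕ) :=
  firstHit (fun j => {ω | u * Real.sqrt (Lam l j) ≤ |S ω j - Lam l j|}) j1 j ∩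
    {ω | |S ω j - Lam l j| ≤ (u + δ / u) * Real.sqrt (Lam l j)}

lemma dep_exceed (l : ℕ → ℝ≥0) (u : ℝ) (j : ℕ) :
    DepOn (Finset.range j) {ω | u * Real.sqrt (Lam l j) ≤ |S ω j - Lam l j|} :=
  depS j (fun x => u * Real.sqrt (Lam l j) ≤ |x - Lam l j|)

lemma dep_goodHit (l : ℕ → ℝ≥0) (u δ : ℝ) (j1 j : ℕ) :
    DepOn (Finset.range j) (goodHit l u δ j1 j) :=
  (dep_firstHit (fun j => dep_exceed l u j) j1 j).inter
    (depS j (fun x => |x - Lam l j| ≤ (u + δ / u) * Real.sqrt (Lam l j)))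

lemma bad_subset (l : ℕ → ℝ≥0) (u δ : ℝ) (hu : 0 < u) (j1 j2 : ℕ) (hj : j1 ≤ j2)
    (hjump : ∀ i ∈ Finset.Ico j1 j2, 8 * (l i : ℝ) ≤ δ * Real.sqrt (Lam l (i + 1)) / u) :
    (⋃ j ∈ Finset.Icc j1 j2, goodHit l u δ j1 j)ᶜ ⊆
      {ω | |S ω j2 - Lam l j2| < u * Real.sqrt (Lam l j2)} ∪
      {ω | u * Real.sqrt (Lam l j1) ≤ |S ω j1 - Lam l j1|} ∪
      ⋃ i ∈ Finset.Ico j1 j2, {ω | δ * Real.sqrt (Lam l (i + 1)) / u ≤ ω i} := by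
  intro ω hω
  by_contra hcon
  simp only [Set.mem_union, not_or, Set.mem_iUnion, not_exists, Set.mem_ofPred_eq, not_le, not_lt] at hcon
  obtain ⟨⟨h2, h1⟩, hj'⟩ := hcon
  apply hω
  set Ex : ℕ → Set (ℕ → ℕ) := fun j => {ω | u * Real.sqrt (Lam l j) ≤ |S ω j - Lam l j|} with hEx
  have hmem : ω ∈ ⋃ j ∈ Finset.Icc j1 j2, firstHit Ex j1 j := by
    rw [union_firstHit]
    exact Set.mem_iUnion₂.2 ⟨j2, Finset.mem_Icc.2 ⟨hj, le_rfl⟩, h2⟩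
  obtain ⟨j, hjm, hhit⟩ := Set.mem_iUnion₂.1 hmem
  refine Set.mem_iUnion₂.2 ⟨j, hjm, hhit, ?_⟩
  rw [Finset.mem_Icc] at hjm
  have hne : j1 < j := by
    rcases hjm.1.lt_or_eq with h | h
    · exact h
    · subst h
      exact absurd hhit.1 (not_le.2 h1)
  obtain ⟨i, rfl⟩ : ∃ i, j = i + 1 := ⟨j - 1, by omega⟩
  have hi : i ∈ Finset.Ico j1 j2 := Finset.mem_Ico.2 ⟨by omega, by omega⟩
  have hprev : ω ∉ Ex i :=
    Set.mem_iInter₂.1 hhit.2 i (Finset.mem_Ico.2 ⟨by omega, by omega⟩)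
  have hprev' : |S ω i - Lam l i| < u * Real.sqrt (Lam l i) := not_le.1 hprev
  have hjp := hj' i hi
  have hjm2 := hjump i hi
  simp only [Set.mem_ofPred_eq]
  have hmono : Real.sqrt (Lam l i) ≤ Real.sqrt (Lam l (i + 1)) :=
    Real.sqrt_le_sqrt (Lam_mono l (Nat.le_succ i))
  have e1 : (u + δ / u) * Real.sqrt (Lam l (i + 1)) =
    u * Real.sqrt (Lam l (i + 1)) + δ * Real.sqrt (Lam l (i + 1)) / u := by ring
  have e2 := mul_le_mul_of_nonneg_left hmono hu.le
  have hli : 0 ≤ (l i : ℝ) := by positivity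
  have hωi : (0:ℝ) ≤ ω i := by positivity
  rw [e1, S_succ, Lam_succ l i, ← Lam_succ l i]
  rw [abs_lt] at hprev'
  rw [abs_le]
  have := Lam_succ l i
  constructor <;> linarith

set_option maxHeartbeats 1000000 in
lemma tilt_good (l : ℕ → ℝ≥0) (u δ θ s : ℝ) (hs : s = 1 ∨ s = -1) (hu : 64 ≤ u)
    (j1 j2 : ℕ) (hj : j1 ≤ j2) (hL0 : u ^ 8 ≤ Lam l j1)
    (hjump : ∀ i ∈ Finset.Ico j1 j2, 8 * (l i : ℝ) ≤ δ * Real.sqrt (Lam l (i + 1)) / u)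
    (h1 : (u + 2 * Real.sqrt u) / Real.sqrt (Lam l j2) ≤ θ)
    (h2 : θ ≤ (u - Real.sqrt u) / Real.sqrt (Lam l j1)) :
    IP (tl l (s * θ)) (⋃ j ∈ Finset.Icc j1 j2, goodHit l u δ j1 j)ᶜ ≤
      ENNReal.ofReal (4 * Real.exp (1 - Real.sqrt u / 2) +
        ∑ i ∈ Finset.Ico j1 j2, Real.exp (-(δ * Real.sqrt (Lam l (i + 1)) / u / 2))) := by
  set v := Real.sqrt u with hv
  have hu0 : 0 < u := by linarith
  have hv2 : v ^ 2 = u := Real.sq_sqrt hu0.le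
  have hv0 : 8 ≤ v := by rw [hv]; exact Real.le_sqrt_of_sq_le (by linarith)
  have hvu : v < u := by nlinarith
  set L1 := Lam l j1 with hL1
  set L2 := Lam l j2 with hL2
  have hL12 : L1 ≤ L2 := Lam_mono l hj
  have hu8 : 64 ≤ u ^ 8 := by
    calc (64:ℝ) ≤ u ^ 1 := by simpa using hu
      _ ≤ u ^ 8 := pow_le_pow_right₀ (by linarith) (by norm_num)
  have hL1p : 0 < L1 := by linarith
  have hq1 : u ^ 4 ≤ Real.sqrt L1 := Real.le_sqrt_of_sq_le (by
    calc (u ^ 4) ^ 2 = u ^ 8 := by ring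
      _ ≤ L1 := hL0)
  set q1 := Real.sqrt L1 with hq1d
  set q2 := Real.sqrt L2 with hq2d
  have hq10 : 0 < q1 := Real.sqrt_pos.2 hL1p
  have hq12 : q1 ≤ q2 := Real.sqrt_le_sqrt hL12
  have hq20 : 0 < q2 := by linarith
  have hqq1 : q1 ^ 2 = L1 := Real.sq_sqrt hL1p.le
  have hqq2 : q2 ^ 2 = L2 := Real.sq_sqrt (by linarith)
  have hθ0 : 0 < θ := lt_of_lt_of_le (by positivity) h1
  have g1 : u + 2 * v ≤ q2 * θ := by rw [div_le_iff₀ hq20] at h1; linarith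
  have g2 : q1 * θ ≤ u - v := by rw [le_div_iff₀ hq10] at h2; linarith
  have hθu : u ^ 3 * θ ≤ 1 := by
    have : u ^ 4 * θ ≤ q1 * θ := by gcongr
    have h4 : u * (u ^ 3 * θ) ≤ u * 1 := by
      calc u * (u ^ 3 * θ) = u ^ 4 * θ := by ring
        _ ≤ u * 1 := by linarith
    exact le_of_mul_le_mul_left h4 hu0
  have hu2 : 4096 ≤ u ^ 2 := by nlinarith
  have hθ2 : u * θ ≤ 1 / 64 := by
    have : u ^ 2 * (u * θ) ≤ 1 := by calc u ^ 2 * (u * θ) = u ^ 3 * θ := by ring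
                                       _ ≤ 1 := hθu
    have h5 : 0 ≤ u * θ := by positivity
    nlinarith
  have hθ8 : θ ≤ 1 / 8 := by nlinarith
  have habs : |s * θ| = θ := by
    rcases hs with h | h <;> simp [h, abs_of_pos hθ0]
  have hss : s * s = 1 := by rcases hs with h | h <;> simp [h]
  have hsabs : ∀ w : ℝ, |w| = |s * w| := by
    intro w; rcases hs with h | h <;> simp [h]
  have hexp := Real.abs_exp_sub_one_sub_id_le (x := s * θ) (by rw [habs]; linarith)
  rw [mul_pow, sq s, hss, one_mul, abs_le] at hexp
  have hsE : θ - θ ^ 2 ≤ s * (Real.exp (s * θ) - 1) ∧ s * (Real.exp (s * θ) - 1) ≤ θ + θ ^ 2 := by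
    rcases hs with h | h
    · subst h; simp only [one_mul] at *; constructor <;> linarith [hexp.1, hexp.2]
    · subst h; simp only [neg_mul, one_mul] at *; constructor <;> linarith [hexp.1, hexp.2]
  -- event a
  have ea : IP (tl l (s * θ)) {ω | |S ω j2 - L2| < u * q2} ≤
      ENNReal.ofReal (2 * Real.exp (1 - v / 2)) := by
    refine le_trans (measure_mono ?_) (tilt_conc l j2 (s * θ) (v / 2) (by rw [habs]; exact hθ8)
      (by linarith) (by positivity))
    intro ω hω
    simp only [Set.mem_ofPred_eq] at hω ⊢
    rw [← hL2, ← hq2d]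
    have k1 : s * (S ω j2 - L2) ≤ |S ω j2 - L2| := by rw [hsabs]; exact le_abs_self _
    have k2 : -(s * (S ω j2 - L2 * Real.exp (s * θ))) ≤ |S ω j2 - L2 * Real.exp (s * θ)| := by
      rw [hsabs]; exact neg_le_abs _
    have k3 : L2 * (θ - θ ^ 2) ≤ L2 * (s * (Real.exp (s * θ) - 1)) := by
      exact mul_le_mul_of_nonneg_left hsE.1 (by linarith)
    have k4 : q2 * (u + v) ≤ L2 * (θ - θ ^ 2) := by
      have : q2 * θ * (1 - θ) * q2 = L2 * (θ - θ ^ 2) := by rw [← hqq2]; ring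
      rw [← this, mul_comm q2 (u + v)]
      refine mul_le_mul_of_nonneg_right ?_ hq20.le
      calc u + v ≤ (u + 2 * v) * (1 - θ) := by
            have : v * θ ≤ u * θ := by gcongr
            linarith
        _ ≤ q2 * θ * (1 - θ) := by gcongr; linarith
    have k5 : -(s * (S ω j2 - L2 * Real.exp (s * θ))) =
        L2 * (s * (Real.exp (s * θ) - 1)) - s * (S ω j2 - L2) := by ring
    have k6 : 0 < v * q2 := by positivity
    linarith
  have eb : IP (tl l (s * θ)) {ω | u * q1 ≤ |S ω j1 - L1|} ≤
      ENNReal.ofReal (2 * Real.exp (1 - v / 2)) := by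
    refine le_trans (measure_mono ?_) (tilt_conc l j1 (s * θ) (v / 2) (by rw [habs]; exact hθ8)
      (by linarith) (by positivity))
    intro ω hω
    simp only [Set.mem_ofPred_eq] at hω ⊢
    rw [← hL1, ← hq1d]
    have k1 : |S ω j1 - L1| ≤ |S ω j1 - L1 * Real.exp (s * θ)| + L1 * (θ + θ ^ 2) := by
      have : S ω j1 - L1 = (S ω j1 - L1 * Real.exp (s * θ)) + L1 * (Real.exp (s * θ) - 1) := by ring
      rw [this]
      refine (abs_add_le _ _).trans ?_
      gcongr
      rw [abs_mul, abs_of_pos hL1p]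
      gcongr
      rw [hsabs, abs_le]
      constructor
      · linarith [hsE.1]
      · exact hsE.2
    have k4 : L1 * (θ + θ ^ 2) ≤ q1 * (u - v + 1 / 64) := by
      have : q1 * θ * (1 + θ) * q1 = L1 * (θ + θ ^ 2) := by rw [← hqq1]; ring
      rw [← this, mul_comm q1 (u - v + 1 / 64)]
      refine mul_le_mul_of_nonneg_right ?_ hq10.le
      calc q1 * θ * (1 + θ) ≤ (u - v) * (1 + θ) := by gcongr
        _ ≤ _ := by
          have : (u - v) * θ ≤ u * θ := mul_le_mul_of_nonneg_right (by linarith) hθ0.le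
          linarith
    have k6 : q1 * 8 ≤ q1 * v := by gcongr
    linarith
  have ec : IP (tl l (s * θ)) (⋃ i ∈ Finset.Ico j1 j2, {ω | δ * Real.sqrt (Lam l (i + 1)) / u ≤ ω i}) ≤
      ENNReal.ofReal (∑ i ∈ Finset.Ico j1 j2, Real.exp (-(δ * Real.sqrt (Lam l (i + 1)) / u / 2))) := by
    refine (measure_biUnion_finset_le _ _).trans ?_
    rw [ENNReal.ofReal_sum_of_nonneg (fun i _ => (Real.exp_pos _).le)]
    refine Finset.sum_le_sum fun i hi => ?_
    refine (chernoff_coord _ i _).trans (ENNReal.ofReal_le_ofReal (Real.exp_le_exp.2 ?_))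
    have := hjump i hi
    have hle : ((tl l (s * θ) i : ℝ≥0) : ℝ) ≤ 2 * l i := by
      simp only [tl, NNReal.coe_mul, coe_ex]
      have : Real.exp (s * θ) ≤ 2 := by
        have := hexp.2
        have : s * θ ≤ θ := le_trans (le_abs_self _) habs.le
        nlinarith
      have hli : 0 ≤ (l i : ℝ) := by positivity
      nlinarith
    linarith
  refine (measure_mono (bad_subset l u δ hu0 j1 j2 hj hjump)).trans ?_
  refine (measure_union_le _ _).trans ?_
  refine (add_le_add ((measure_union_le _ _).trans (add_le_add ea eb)) ec).trans ?_
  rw [← ENNReal.ofReal_add (by positivity) (by positivity),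
    ← ENNReal.ofReal_add (by positivity) (Finset.sum_nonneg fun i _ => (Real.exp_pos _).le)]
  refine ENNReal.ofReal_le_ofReal (le_of_eq ?_)
  ring


lemma nu_ae (s θ1 θ2 : ℝ) (hs : s = 1 ∨ s = -1) :
    ∀ᵐ x ∂(nu s θ1 θ2), s * x ∈ Set.Icc θ1 θ2 := by
  unfold nu
  have hm : MeasurableSet {x : ℝ | s * x ∈ Set.Icc θ1 θ2} :=
    measurableSet_Icc.preimage (by fun_prop)
  rw [ae_map_iff (by fun_prop) hm]
  refine (withDensity_absolutelyContinuous _ _).ae_le ?_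
  filter_upwards [ae_restrict_mem measurableSet_Icc] with x hx
  have : s * (s * x) = x := by rcases hs with h | h <;> simp [h]
  rw [this]; exact hx

/-- error term in the mixture upper bound -/
noncomputable def Tu (u : ℝ) : ℝ := u * (u * Real.exp (-(u / 8)) *
          Real.sqrt (Real.pi / ((1 - 2 / u ^ 3) / 4)) +
          Real.sqrt (Real.pi / ((1 - 2 / u ^ 3) / 2)) / (u - Real.sqrt u)) / Real.sqrt (2 * Real.pi)

lemma tendsto_Tu : Tendsto Tu atTop (𝓝 1) := by
  have h3 : Tendsto (fun u : ℝ => 1 - 2 / u ^ 3) atTop (𝓝 (1 - 0)) :=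
    tendsto_const_nhds.sub (tendsto_const_nhds.div_atTop (tendsto_pow_atTop (by norm_num)))
  have ha : Tendsto (fun u : ℝ => Real.sqrt (Real.pi / ((1 - 2 / u ^ 3) / 4))) atTop
      (𝓝 (Real.sqrt (Real.pi / ((1 - 0) / 4)))) :=
    (Real.continuous_sqrt.tendsto _).comp (tendsto_const_nhds.div (h3.div_const _) (by norm_num))
  have hb : Tendsto (fun u : ℝ => Real.sqrt (Real.pi / ((1 - 2 / u ^ 3) / 2))) atTop
      (𝓝 (Real.sqrt (Real.pi / ((1 - 0) / 2)))) :=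
    (Real.continuous_sqrt.tendsto _).comp (tendsto_const_nhds.div (h3.div_const _) (by norm_num))
  have hc : Tendsto (fun u : ℝ => u ^ 2 * Real.exp (-(u / 8))) atTop (𝓝 0) := by
    have := (Real.tendsto_pow_mul_exp_neg_atTop_nhds_zero 2).comp
      (tendsto_id.atTop_div_const (show (0:ℝ) < 8 by norm_num))
    have h2 := this.const_mul 64
    rw [mul_zero] at h2
    refine h2.congr fun u => ?_
    simp only [Function.comp, id]
    ring
  have hd : Tendsto (fun u : ℝ => (1 - (Real.sqrt u)⁻¹)⁻¹) atTop (𝓝 (1 - 0)⁻¹) :=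
    Tendsto.inv₀ (tendsto_const_nhds.sub (tendsto_inv_atTop_zero.comp Real.tendsto_sqrt_atTop))
      (by norm_num)
  have hall := ((hc.mul ha).add (hb.mul hd)).div_const (Real.sqrt (2 * Real.pi))
  have hval : (0 * Real.sqrt (Real.pi / ((1 - 0) / 4)) + Real.sqrt (Real.pi / ((1 - 0) / 2)) *
      (1 - 0)⁻¹) / Real.sqrt (2 * Real.pi) = 1 := by
    have hsp : 0 < Real.sqrt (2 * Real.pi) := by positivity
    rw [show Real.pi / ((1 - 0) / 2) = 2 * Real.pi by ring]
    rw [zero_mul, zero_add, sub_zero, inv_one, mul_one, div_self hsp.ne']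
  rw [hval] at hall
  refine hall.congr' ?_
  filter_upwards [eventually_gt_atTop 4] with u hu
  have hv : 0 < Real.sqrt u := Real.sqrt_pos.2 (by linarith)
  have hvv : Real.sqrt u * Real.sqrt u = u := Real.mul_self_sqrt (by linarith)
  have hv2 : 2 ≤ Real.sqrt u := Real.le_sqrt_of_sq_le (by linarith)
  have hne : u - Real.sqrt u ≠ 0 := by nlinarith
  unfold Tu
  congr 1
  have : (1 - (Real.sqrt u)⁻¹)⁻¹ = u / (u - Real.sqrt u) := by
    have e : u - Real.sqrt u = u * (1 - (Real.sqrt u)⁻¹) := by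
      field_simp; linear_combination -hvv
    rw [e, div_mul_cancel_left₀ (by linarith)]
  rw [this]
  ring

theorem windowL (ε : ℝ) (hε : 0 < ε) (hε1 : ε < 1) : ∃ δ : ℝ, 0 < δ ∧ ∃ u0 : ℝ, 64 ≤ u0 ∧
    ∀ u ≥ u0, ∀ (l : ℕ → ℝ≥0) (j1 j2 : ℕ), j1 ≤ j2 → u ^ 8 ≤ Lam l j1 →
    (∀ i ∈ Finset.Ico j1 j2, 8 * (l i : ℝ) ≤ δ * Real.sqrt (Lam l (i + 1)) / u) →
    ∑ i ∈ Finset.Ico j1 j2, Real.exp (-(δ * Real.sqrt (Lam l (i + 1)) / u / 2)) ≤ δ →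
    1 / 2 * Real.log (Lam l j2 / Lam l j1) ≤ δ * (Real.exp (u ^ 2 / 2) / u) →
    ENNReal.ofReal ((1 - ε) * (2 * ph u * (1 / 2 * Real.log (Lam l j2 / Lam l j1) - 1))) ≤
    IP l {ω | ∃ j ∈ Finset.Icc j1 j2, u * Real.sqrt (Lam l j) ≤ |S ω j - Lam l j|} := by
  have hsp : 0 < Real.sqrt (2 * Real.pi) := by positivity
  -- choice of δ
  obtain ⟨δ, hδ0, hδ1, hδ⟩ : ∃ δ : ℝ, 0 < δ ∧ δ ≤ 1 ∧
      (1 - ε) * ((Real.exp 2 + 1) * δ / Real.sqrt (2 * Real.pi) + Real.exp (2 * δ) * 1) < 1 - δ := by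
    have hc : Tendsto (fun δ : ℝ => (1 - δ) -
        (1 - ε) * ((Real.exp 2 + 1) * δ / Real.sqrt (2 * Real.pi) + Real.exp (2 * δ) * 1))
        (𝓝[>] 0) (𝓝 ((1 - 0) -
        (1 - ε) * ((Real.exp 2 + 1) * 0 / Real.sqrt (2 * Real.pi) + Real.exp (2 * 0) * 1))) := by
      refine Tendsto.mono_left ?_ nhdsWithin_le_nhds
      refine Continuous.tendsto ?_ 0
      fun_prop
    have hpos : 0 < ((1 - 0) -
        (1 - ε) * ((Real.exp 2 + 1) * 0 / Real.sqrt (2 * Real.pi) + Real.exp (2 * 0) * 1)) := by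
      simp [hε]
    have h1 := hc.eventually (lt_mem_nhds hpos)
    have h2 : ∀ᶠ δ : ℝ in 𝓝[>] 0, δ ∈ Set.Ioo (0:ℝ) 1 := Ioo_mem_nhdsGT (by norm_num)
    obtain ⟨δ, h3, h4⟩ := (h1.and h2).exists
    exact ⟨δ, h4.1, h4.2.le, by linarith⟩
  refine ⟨δ, hδ0, ?_⟩
  have hlim : Tendsto (fun u : ℝ => (1 - δ - 4 * Real.exp (1 - Real.sqrt u / 2)) -
      (1 - ε) * ((Real.exp 2 + 1) * δ / Real.sqrt (2 * Real.pi) + Real.exp (2 * δ) * Tu u)) atTop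
      (𝓝 ((1 - δ - 4 * 0) -
      (1 - ε) * ((Real.exp 2 + 1) * δ / Real.sqrt (2 * Real.pi) + Real.exp (2 * δ) * 1))) := by
    refine Tendsto.sub (tendsto_const_nhds.sub (Tendsto.const_mul _ ?_))
      (Tendsto.const_mul _ (tendsto_const_nhds.add (tendsto_Tu.const_mul _)))
    refine Real.tendsto_exp_atBot.comp ?_
    exact tendsto_atBot_add_const_left _ _ (tendsto_neg_atTop_atBot.comp
      (Real.tendsto_sqrt_atTop.atTop_div_const (by norm_num)))
  obtain ⟨u1, hu1⟩ := eventually_atTop.1 (hlim.eventually (lt_mem_nhds (a := 0) (by linarith)))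
  refine ⟨max (max u1 64) (8 / δ), (le_max_right _ _).trans (le_max_left _ _), ?_⟩
  intro u hu l j1 j2 hj hL0 hjump hsum hR
  have hu64 : 64 ≤ u := ((le_max_right _ _).trans (le_max_left _ _)).trans hu
  have hkey := hu1 u (((le_max_left _ _).trans (le_max_left _ _)).trans hu)
  have hδu : 8 ≤ δ * u := by
    have := (le_max_right _ _).trans hu
    rw [div_le_iff₀ hδ0] at this; linarith
  have hu0 : 0 < u := by linarith
  set R := 1 / 2 * Real.log (Lam l j2 / Lam l j1) with hRd
  have hph := ph_pos hu0
  by_cases hR1 : R ≤ 1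
  · rw [ENNReal.ofReal_of_nonpos]
    · exact zero_le
    · have : ph u * (R - 1) ≤ 0 := mul_nonpos_of_nonneg_of_nonpos hph.le (by linarith)
      nlinarith
  push Not at hR1
  set v := Real.sqrt u with hv
  have hv2 : v ^ 2 = u := Real.sq_sqrt hu0.le
  have hv0 : 8 ≤ v := by rw [hv]; exact Real.le_sqrt_of_sq_le (by linarith)
  have hvu : v ≤ u / 8 := by nlinarith
  have hL1p : 0 < Lam l j1 := lt_of_lt_of_le (by positivity) hL0
  have hL12 := Lam_mono l hj
  have hL2p : 0 < Lam l j2 := hL1p.trans_le hL12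
  have hs1 : 0 < Real.sqrt (Lam l j1) := Real.sqrt_pos.2 hL1p
  have hs2 : 0 < Real.sqrt (Lam l j2) := Real.sqrt_pos.2 hL2p
  have huv : 0 < u - v := by linarith
  set θ1 := (u + 2 * v) / Real.sqrt (Lam l j2) with hθ1
  set θ2 := (u - v) / Real.sqrt (Lam l j1) with hθ2
  have hθ1p : 0 < θ1 := by positivity
  have hθ2p : 0 < θ2 := by positivity
  have hlog : Real.log (θ2 / θ1) = R - (Real.log (u + 2 * v) - Real.log (u - v)) := by
    rw [Real.log_div (by positivity) (by positivity), hθ1, hθ2,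
      Real.log_div huv.ne' (by positivity), Real.log_div (by positivity) (by positivity), hRd,
      Real.log_div hL2p.ne' hL1p.ne', Real.log_sqrt hL1p.le, Real.log_sqrt hL2p.le]
    ring
  have hl1 : Real.log (u + 2 * v) - Real.log (u - v) ≤ 1 := by
    rw [← Real.log_div (by positivity) huv.ne', Real.log_le_iff_le_exp (by positivity)]
    have : (2:ℝ) ≤ Real.exp 1 := by linarith [Real.add_one_le_exp (1:ℝ)]
    refine le_trans ?_ this
    rw [div_le_iff₀ huv]; linarith
  have hl2 : 0 ≤ Real.log (u + 2 * v) - Real.log (u - v) := by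
    rw [sub_nonneg]; exact Real.log_le_log huv (by linarith)
  have hν1 : R - 1 ≤ Real.log (θ2 / θ1) := by linarith
  have hν2 : Real.log (θ2 / θ1) ≤ R := by linarith
  have hθ12 : θ1 ≤ θ2 := by
    have : 0 < Real.log (θ2 / θ1) := by linarith
    have h := (Real.log_pos_iff (by positivity)).1 this
    rw [one_lt_div hθ1p] at h
    exact h.le
  set Q := u * Real.exp (-(u / 8)) *
          Real.sqrt (Real.pi / ((1 - 2 / u ^ 3) / 4)) +
          Real.sqrt (Real.pi / ((1 - 2 / u ^ 3) / 2)) / (u - v) with hQ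
  have hQ0 : 0 ≤ Q := by positivity
  set B := (Real.exp 2 + 1) * R + Real.exp (u ^ 2 / 2 + 2 * δ) * Q with hB
  have hB0 : 0 < B := by positivity
  set bad := 4 * Real.exp (1 - v / 2) + δ with hbad
  set U := ⋃ j ∈ Finset.Icc j1 j2, goodHit l u δ j1 j with hU
  have hUm : MeasurableSet U :=
    Finset.measurableSet_biUnion _ fun j _ => (dep_goodHit l u δ j1 j).meas
  -- upper bound of mixture
  have hmix : ∀ j ∈ Finset.Icc j1 j2, ∀ ω ∈ goodHit l u δ j1 j,
      mixL l (nu 1 θ1 θ2 + nu (-1) θ1 θ2) j ω ≤ ENNReal.ofReal B := by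
    intro j hjm ω hω
    have hj1 := Lam_mono l (Finset.mem_Icc.1 hjm).1
    have hGd : |S ω j - Lam l j| ≤ (u + δ / u) * Real.sqrt (Lam l j) := hω.2
    have key : ∀ s : ℝ, (s = 1 ∨ s = -1) → (-s) * (S ω j - Lam l j) ≤ 0 →
        mixL l (nu s θ1 θ2) j ω + mixL l (nu (-s) θ1 θ2) j ω ≤ ENNReal.ofReal B := by
      intro s hs hneg
      have hsW : s * (S ω j - Lam l j) ≤ (u + δ / u) * Real.sqrt (Lam l j) := by
        refine le_trans (le_abs_self _) (le_trans (le_of_eq ?_) hGd)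
        rw [abs_mul]
        rcases hs with h | h <;> simp [h]
      have h1 := mix_upper_same l s hs u δ θ1 (Lam l j1) hu64 hδ0 hδ1 hδu j ω hL0 hj1 hθ1p hθ12 hsW
      rw [← hv, ← hQ] at h1
      have h2 := mix_upper_opp l (-s) θ1 θ2 hθ1p hθ12 j ω hneg
      refine (add_le_add h1 h2).trans ?_
      have hl0 : 0 ≤ Real.log (θ2 / θ1) := by linarith
      rw [← ENNReal.ofReal_add (by positivity) (by positivity)]
      refine ENNReal.ofReal_le_ofReal ?_
      rw [hB]
      have : Real.exp 2 * Real.log (θ2 / θ1) ≤ Real.exp 2 * R := by gcongr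
      linarith
    have hadd : mixL l (nu 1 θ1 θ2 + nu (-1) θ1 θ2) j ω =
        mixL l (nu 1 θ1 θ2) j ω + mixL l (nu (-1) θ1 θ2) j ω := by
      unfold mixL; rw [lintegral_add_measure]
    rw [hadd]
    rcases le_total 0 (S ω j - Lam l j) with h | h
    · exact key 1 (Or.inl rfl) (by linarith)
    · have := key (-1) (Or.inr rfl) (by linarith)
      rw [neg_neg, add_comm] at this
      exact this
  have habs := lowerAbs l (nu 1 θ1 θ2 + nu (-1) θ1 θ2) (Finset.Icc j1 j2)
    (D := goodHit l u δ j1) (fun j _ => dep_goodHit l u δ j1 j)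
    (fun i hi j hj hij => (disj_firstHit _ j1 j2 hi hj hij).mono Set.inter_subset_left
      Set.inter_subset_left) (ENNReal.ofReal B) hmix
  rw [← hU, lintegral_add_measure] at habs
  have hlow : ∀ s : ℝ, (s = 1 ∨ s = -1) →
      ENNReal.ofReal ((1 - bad) * Real.log (θ2 / θ1)) ≤ ∫⁻ θ, IP (tl l θ) U ∂(nu s θ1 θ2) := by
    intro s hs
    rw [ENNReal.ofReal_mul' (by linarith), ← nu_univ (s := s) hθ1p hθ12, ← lintegral_const]
    refine lintegral_mono_ae ?_
    filter_upwards [nu_ae s θ1 θ2 hs] with θ hθ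
    have hg := tilt_good l u δ (s * θ) s hs hu64 j1 j2 hj hL0 hjump hθ.1 hθ.2
    have hss : s * (s * θ) = θ := by rcases hs with h | h <;> simp [h]
    rw [hss, ← hU] at hg
    have hg2 : IP (tl l θ) Uᶜ ≤ ENNReal.ofReal bad :=
      hg.trans (ENNReal.ofReal_le_ofReal (by rw [hbad]; linarith))
    have hcompl := prob_add_prob_compl (μ := IP (tl l θ)) hUm
    have hb0 : 0 ≤ bad := by positivity
    rw [ENNReal.ofReal_sub _ hb0, ENNReal.ofReal_one, tsub_le_iff_right, ← hcompl]
    gcongr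
  have hfin := (add_le_add (hlow 1 (Or.inl rfl)) (hlow (-1) (Or.inr rfl))).trans habs
  have hUE : IP l U ≤ IP l {ω | ∃ j ∈ Finset.Icc j1 j2, u * Real.sqrt (Lam l j) ≤ |S ω j - Lam l j|} := by
    refine measure_mono fun ω hω => ?_
    obtain ⟨j, hj, h⟩ := Set.mem_iUnion₂.1 hω
    exact ⟨j, hj, h.1.1⟩
  have hphB : (1 - ε) * (ph u * B) ≤ 1 - bad := by
    have e0 : Real.exp (-(u ^ 2 / 2)) * Real.exp (u ^ 2 / 2) = 1 := by
      rw [← Real.exp_add]; simp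
    have e1 : ph u * (Real.exp (u ^ 2 / 2 + 2 * δ) * Q) = Real.exp (2 * δ) * Tu u := by
      rw [Real.exp_add, ph, Tu, ← hv, ← hQ]
      calc _ = (Real.exp (-(u ^ 2 / 2)) * Real.exp (u ^ 2 / 2)) *
            (Real.exp (2 * δ) * (u * Q / Real.sqrt (2 * Real.pi))) := by ring
        _ = _ := by rw [e0, one_mul]
    have e2 : ph u * ((Real.exp 2 + 1) * R) ≤ (Real.exp 2 + 1) * δ / Real.sqrt (2 * Real.pi) := by
      calc ph u * ((Real.exp 2 + 1) * R) ≤ ph u * ((Real.exp 2 + 1) * (δ * (Real.exp (u ^ 2 / 2) / u))) := by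
            gcongr
        _ = (Real.exp (-(u ^ 2 / 2)) * Real.exp (u ^ 2 / 2)) *
            ((Real.exp 2 + 1) * δ / Real.sqrt (2 * Real.pi)) := by
            rw [ph]; field_simp
        _ = _ := by rw [e0, one_mul]
    have e3 : ph u * B ≤ (Real.exp 2 + 1) * δ / Real.sqrt (2 * Real.pi) + Real.exp (2 * δ) * Tu u := by
      rw [hB, mul_add, e1]; linarith
    have := mul_le_mul_of_nonneg_left e3 (show 0 ≤ 1 - ε by linarith)
    rw [hbad]; linarith
  have hbad1 : 0 ≤ 1 - bad := le_trans (by have := sub_pos.2 hε1; positivity) hphB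
  refine le_trans ?_ hUE
  have hl0 : 0 ≤ Real.log (θ2 / θ1) := by linarith
  rw [← ENNReal.ofReal_add (by positivity) (by positivity)] at hfin
  have h5 : ENNReal.ofReal ((1 - bad) * Real.log (θ2 / θ1) + (1 - bad) * Real.log (θ2 / θ1)) /
      ENNReal.ofReal B ≤ IP l U := by
    rw [ENNReal.div_le_iff_le_mul (by left; simpa using hB0) (by left; simp), mul_comm (IP l U)]
    exact hfin
  refine le_trans ?_ h5
  rw [← ENNReal.ofReal_div_of_pos hB0]
  refine ENNReal.ofReal_le_ofReal ?_
  rw [le_div_iff₀ hB0]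
  calc (1 - ε) * (2 * ph u * (R - 1)) * B = 2 * (((1 - ε) * (ph u * B)) * (R - 1)) := by ring
    _ ≤ 2 * ((1 - bad) * Real.log (θ2 / θ1)) := by gcongr
    _ = _ := by ring

end HC

namespace HC
open MeasureTheory Filter Topology ProbabilityTheory
open scoped ENNReal NNReal

section
variable {α : Type*} [MeasurableSpace α] {ι : Type*}

/-- cell counts -/
noncomputable def cnt (C : ι → Set α) {K : ℕ} (y : Fin K → α) (c : ι) : ℕ :=
  ∑ i, (C c).indicator (fun _ => 1) (y i)

lemma measurable_cnt (C : ι → Set α) (hC : ∀ c, MeasurableSet (C c)) (K : ℕ) :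
    Measurable (fun y : Fin K → α => cnt C y) := by
  refine measurable_pi_iff.2 fun c => ?_
  unfold cnt
  refine Finset.measurable_sum _ fun i _ => ?_
  exact (measurable_const.indicator (hC c)).comp (measurable_pi_apply i)

lemma pi_cons (ν : Measure α) [IsProbabilityMeasure ν] (K : ℕ) (B : Set α) (D : Set (Fin K → α)) :
    Measure.pi (fun _ : Fin (K + 1) => ν) {y | y 0 ∈ B ∧ (fun i : Fin K => y i.succ) ∈ D} =
      ν B * Measure.pi (fun _ : Fin K => ν) D := by
  have h := measurePreserving_piFinSuccAbove (fun _ : Fin (K + 1) => ν) 0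
  have := h.measure_preimage_equiv (B ×ˢ D)
  rw [Measure.prod_prod] at this
  rw [← this]
  congr 1

variable [Fintype ι] [DecidableEq ι]

lemma mult_step (ν : Measure α) [IsProbabilityMeasure ν] (C : ι → Set α)
    (hd : Pairwise (fun c d => Disjoint (C c) (C d))) (K : ℕ) (x : ι → ℕ) :
    Measure.pi (fun _ : Fin (K + 1) => ν) {y | cnt C y = x} ≤
      ν (⋃ c, C c)ᶜ * Measure.pi (fun _ : Fin K => ν) {y | cnt C y = x} +
      ∑ c, ν (C c) * Measure.pi (fun _ : Fin K => ν) {y | cnt C y + Pi.single c 1 = x} := by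
  simp_rw [← pi_cons]
  refine (measure_mono ?_).trans ((measure_union_le _ _).trans (add_le_add le_rfl
    (measure_biUnion_finset_le (Finset.univ : Finset ι) _)))
  intro y hy
  have hy' : cnt C y = x := hy
  have hsplit : ∀ c, cnt C y c = (C c).indicator (fun _ => 1) (y 0) +
      cnt C (fun i : Fin K => y i.succ) c := fun c => by
    unfold cnt; rw [Fin.sum_univ_succ]
  by_cases h : ∃ c, y 0 ∈ C c
  · obtain ⟨c, hc⟩ := h
    refine Or.inr (Set.mem_iUnion₂.2 ⟨c, Finset.mem_univ _, hc, ?_⟩)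
    rw [Set.mem_ofPred_eq, ← hy']
    ext d
    rw [hsplit d, Pi.add_apply, add_comm]
    congr 1
    by_cases hcd : d = c
    · subst hcd; simp [hc]
    · have : y 0 ∉ C d := fun h' => Set.disjoint_left.1 (hd hcd) h' hc
      simp [hcd, this]
  · push Not at h
    refine Or.inl ⟨by simpa using h, ?_⟩
    rw [Set.mem_ofPred_eq, ← hy']
    ext d
    rw [hsplit d]
    simp [h d]

lemma desc_rec (K m : ℕ) :
    (K + 1).descFactorial m = K.descFactorial m + m * K.descFactorial (m - 1) := by
  cases m with
  | zero => simp
  | succ m =>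
    rw [Nat.succ_descFactorial_succ, Nat.descFactorial_succ, Nat.add_sub_cancel]
    rcases le_or_gt m K with h | h
    · rw [← add_mul]; congr 1; omega
    · rw [Nat.descFactorial_eq_zero_iff_lt.2 h]; simp

lemma mult_bound (ν : Measure α) [IsProbabilityMeasure ν] (C : ι → Set α)
    (hd : Pairwise (fun c d => Disjoint (C c) (C d))) (K : ℕ) (x : ι → ℕ) :
    Measure.pi (fun _ : Fin K => ν) {y | cnt C y = x} * ∏ c, ((x c).factorial : ℝ≥0∞) ≤
      (K.descFactorial (∑ c, x c) : ℝ≥0∞) * (∏ c, ν (C c) ^ x c) *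
        ν (⋃ c, C c)ᶜ ^ (K - ∑ c, x c) := by
  induction K generalizing x with
  | zero =>
    by_cases hx : x = 0
    · subst hx
      simp only [Pi.zero_apply, Nat.factorial_zero, Nat.cast_one, Finset.prod_const_one, mul_one,
        Finset.sum_const_zero, Nat.descFactorial_zero, pow_zero]
      refine (prob_le_one (μ := Measure.pi (fun _ : Fin 0 => ν))).trans (le_of_eq (by simp))
    · have : {y : Fin 0 → α | cnt C y = x} = ∅ := by
        ext y
        simp only [Set.mem_ofPred_eq, Set.mem_empty_iff_false, iff_false]
        intro h; apply hx; rw [← h]; ext c; simp [cnt]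
      rw [this]; simp
  | succ K ih =>
    refine (mul_le_mul_left (mult_step ν C hd K x) _).trans ?_
    rw [add_mul, Finset.sum_mul]
    set r := ν (⋃ c, C c)ᶜ
    set m := ∑ c, x c with hm
    have h1 : r * Measure.pi (fun _ : Fin K => ν) {y | cnt C y = x} *
        ∏ c, ((x c).factorial : ℝ≥0∞) ≤
        (K.descFactorial m : ℝ≥0∞) * ((∏ c, ν (C c) ^ x c) * r ^ (K + 1 - m)) := by
      rw [mul_assoc]
      refine (mul_le_mul_right (ih x) _).trans ?_
      rcases le_or_gt m K with h | h
      · rw [Nat.succ_sub h, pow_succ]; exact le_of_eq (by ring)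
      · rw [← hm, Nat.descFactorial_eq_zero_iff_lt.2 h]; simp
    have h2 : ∀ c, ν (C c) * Measure.pi (fun _ : Fin K => ν) {y | cnt C y + Pi.single c 1 = x} *
        ∏ c, ((x c).factorial : ℝ≥0∞) ≤
        (x c : ℝ≥0∞) * ((K.descFactorial (m - 1) : ℝ≥0∞) *
          ((∏ c, ν (C c) ^ x c) * r ^ (K + 1 - m))) := by
      intro c
      rcases Nat.eq_zero_or_pos (x c) with h0 | h0
      · have : {y : Fin K → α | cnt C y + Pi.single c 1 = x} = ∅ := by
          ext y
          simp only [Set.mem_ofPred_eq, Set.mem_empty_iff_false, iff_false]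
          intro h; have := congrFun h c; simp [h0] at this
        rw [this]; simp
      · obtain ⟨x', rfl⟩ : ∃ x' : ι → ℕ, x = x' + Pi.single c 1 := by
          refine ⟨x - Pi.single c 1, ?_⟩
          ext d
          by_cases hcd : d = c
          · subst hcd; simp; omega
          · simp [hcd]
        have e1 : {y : Fin K → α | cnt C y + Pi.single c 1 = x' + Pi.single c 1} =
            {y | cnt C y = x'} := by ext y; simp
        have e2 : ∏ d, (((x' + Pi.single c 1 : ι → ℕ) d).factorial : ℝ≥0∞) =
            ((x' c : ℝ≥0∞) + 1) * ∏ d, ((x' d).factorial : ℝ≥0∞) := by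
          rw [← Finset.mul_prod_erase _ _ (Finset.mem_univ c),
            ← Finset.mul_prod_erase (a := c) Finset.univ (fun d => ((x' d).factorial : ℝ≥0∞))
              (Finset.mem_univ c)]
          rw [← mul_assoc]
          congr 1
          · simp [Nat.factorial_succ]
          · refine Finset.prod_congr rfl fun d hd => ?_
            simp [Finset.ne_of_mem_erase hd]
        have e3 : ∏ d, ν (C d) ^ ((x' + Pi.single c 1 : ι → ℕ) d) =
            ν (C c) * ∏ d, ν (C d) ^ (x' d) := by
          rw [← Finset.mul_prod_erase _ _ (Finset.mem_univ c),
            ← Finset.mul_prod_erase (a := c) Finset.univ (fun d => ν (C d) ^ (x' d))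
              (Finset.mem_univ c)]
          rw [← mul_assoc]
          congr 1
          · simp [pow_succ, mul_comm]
          · refine Finset.prod_congr rfl fun d hd => ?_
            simp [Finset.ne_of_mem_erase hd]
        have e4 : m = ∑ d, x' d + 1 := by
          rw [hm]; simp [Finset.sum_add_distrib]
        rw [e1, e2, e3]
        have hx := ih x'
        have e5 : K + 1 - m = K - ∑ d, x' d := by omega
        have e6 : m - 1 = ∑ d, x' d := by omega
        rw [e5, e6]
        have e7 : (((x' + Pi.single c 1 : ι → ℕ) c : ℕ) : ℝ≥0∞) = (x' c : ℝ≥0∞) + 1 := by simp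
        rw [e7]
        calc _ = ((x' c : ℝ≥0∞) + 1) * ν (C c) * (Measure.pi (fun _ : Fin K => ν) {y | cnt C y = x'} *
                ∏ d, ((x' d).factorial : ℝ≥0∞)) := by ring
          _ ≤ ((x' c : ℝ≥0∞) + 1) * ν (C c) * _ := mul_le_mul_right hx _
          _ = _ := by ring
    refine (add_le_add h1 (Finset.sum_le_sum fun c _ => h2 c)).trans (le_of_eq ?_)
    rw [← Finset.sum_mul, ← Nat.cast_sum, ← hm, desc_rec]
    push_cast
    ring

end

lemma D_bound (K m : ℕ) (hm : m < K) (p : ℝ) (hp : p ≤ 1) :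
    (K.descFactorial m : ℝ) * (1 - p) ^ (K - m) * Real.exp (K * p) ≤
      Real.sqrt (K / (K - m)) * (K:ℝ) ^ m := by
  obtain ⟨d, rfl⟩ : ∃ d, K = m + (d + 1) := ⟨K - m - 1, by omega⟩
  have hst : Stirling.stirlingSeq (m + (d + 1)) ≤ Stirling.stirlingSeq (d + 1) := by
    have := Stirling.stirlingSeq'_antitone (show d ≤ m + d by omega)
    exact this
  rw [show m + (d + 1) - m = d + 1 by omega]
  have hfac : ((m + (d + 1)).descFactorial m : ℝ) * ((d + 1).factorial : ℝ) =
      ((m + (d + 1)).factorial : ℝ) := by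
    have := Nat.factorial_mul_descFactorial (show m ≤ m + (d + 1) by omega)
    rw [show m + (d + 1) - m = d + 1 by omega] at this
    rw [← this]; push_cast; ring
  unfold Stirling.stirlingSeq at hst
  have hfd : (0:ℝ) < ((d + 1).factorial : ℝ) := by positivity
  set D : ℝ := ((d + 1 : ℕ) : ℝ) with hD
  set k : ℝ := ((m + (d + 1) : ℕ) : ℝ) with hk
  have hD0 : 0 < D := by rw [hD]; positivity
  have hk0 : 0 < k := by rw [hk]; positivity
  have hkD : k = m + D := by rw [hk, hD]; push_cast; ring
  have e0 : k - m = D := by rw [hkD]; ring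
  rw [e0, Real.sqrt_div hk0.le]
  have hsk : 0 < Real.sqrt k := Real.sqrt_pos.2 hk0
  have hsD : 0 < Real.sqrt D := Real.sqrt_pos.2 hD0
  have hs2 : 0 < Real.sqrt 2 := by positivity
  rw [div_le_div_iff₀ (by positivity) (by positivity), ← hfac, Real.sqrt_mul (by norm_num),
    Real.sqrt_mul (by norm_num)] at hst
  have h1 : ((m + (d + 1)).descFactorial m : ℝ) * (D / Real.exp 1) ^ (d + 1) * Real.sqrt D ≤
      Real.sqrt k * (k / Real.exp 1) ^ (m + (d + 1)) := by
    have hc : 0 < ((d + 1).factorial : ℝ) * Real.sqrt 2 := by positivity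
    refine le_of_mul_le_mul_left ?_ hc
    calc _ = _ := ?_
      _ ≤ _ := hst
      _ = _ := ?_
    · ring
    · ring
  have h2 : (k * (1 - p) / D) ^ (d + 1) ≤ Real.exp (m - k * p) := by
    have hy : k * (1 - p) / D ≤ Real.exp ((m - k * p) / D) := by
      have := Real.add_one_le_exp ((m - k * p) / D)
      refine le_trans (le_of_eq ?_) this
      rw [hkD]; field_simp; ring
    refine (pow_le_pow_left₀ (by have : 0 ≤ 1 - p := by linarith
                                 positivity) hy _).trans (le_of_eq ?_)
    rw [← Real.exp_nat_mul, ← hD]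
    congr 1; field_simp
  have hE : 0 < Real.exp 1 := Real.exp_pos 1
  rw [div_mul_eq_mul_div, le_div_iff₀ hsD]
  have hDp : 0 < (D / Real.exp 1) ^ (d + 1) := by positivity
  refine le_of_mul_le_mul_right ?_ hDp
  have h1p : 0 ≤ (1 - p) ^ (d + 1) := pow_nonneg (by linarith) _
  calc _ = (((m + (d + 1)).descFactorial m : ℝ) * (D / Real.exp 1) ^ (d + 1) * Real.sqrt D) *
        ((1 - p) ^ (d + 1) * Real.exp (k * p)) := by ring
    _ ≤ (Real.sqrt k * (k / Real.exp 1) ^ (m + (d + 1))) * ((1 - p) ^ (d + 1) * Real.exp (k * p)) := by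
        gcongr
    _ = (Real.sqrt k * k ^ m * (D / Real.exp 1) ^ (d + 1)) *
        ((k * (1 - p) / D) ^ (d + 1) * (Real.exp 1)⁻¹ ^ m * Real.exp (k * p)) := by
        rw [pow_add, div_pow, div_pow, div_pow, div_pow, mul_pow, inv_pow]
        field_simp
    _ ≤ (Real.sqrt k * k ^ m * (D / Real.exp 1) ^ (d + 1)) *
        (Real.exp (m - k * p) * (Real.exp 1)⁻¹ ^ m * Real.exp (k * p)) := by gcongr
    _ = _ := by
        have : Real.exp (m - k * p) * (Real.exp 1)⁻¹ ^ m * Real.exp (k * p) = 1 := by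
          rw [← Real.exp_neg, ← Real.exp_nat_mul, ← Real.exp_add, ← Real.exp_add]
          rw [Real.exp_eq_one_iff]; ring
        rw [this, mul_one]

section
variable {α : Type*} [MeasurableSpace α] {ι : Type*}

lemma tail_bound (ν : Measure α) [IsProbabilityMeasure ν] (B : Set α) (hB : MeasurableSet B)
    (K M : ℕ) :
    Measure.pi (fun _ : Fin K => ν) {y | M ≤ ∑ i, B.indicator (fun _ => 1) (y i)} * 2 ^ M ≤
      (1 + ν B) ^ K := by
  induction K generalizing M with
  | zero =>
    cases M with
    | zero => simp
    | succ M => simp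
  | succ K ih =>
    cases M with
    | zero =>
      rw [pow_zero, mul_one]
      exact prob_le_one.trans (one_le_pow₀ le_self_add)
    | succ M =>
      have hsub : {y : Fin (K + 1) → α | M + 1 ≤ ∑ i, B.indicator (fun _ => 1) (y i)} ⊆
          {y | y 0 ∈ Bᶜ ∧ (fun i : Fin K => y i.succ) ∈
            {y : Fin K → α | M + 1 ≤ ∑ i, B.indicator (fun _ => 1) (y i)}} ∪
          {y | y 0 ∈ B ∧ (fun i : Fin K => y i.succ) ∈
            {y : Fin K → α | M ≤ ∑ i, B.indicator (fun _ => 1) (y i)}} := by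
        intro y hy
        rw [Set.mem_ofPred_eq, Fin.sum_univ_succ] at hy
        by_cases h : y 0 ∈ B
        · right
          refine ⟨h, ?_⟩
          simp only [h, Set.indicator_of_mem] at hy
          rw [Set.mem_ofPred_eq]; beta_reduce; omega
        · left
          refine ⟨h, ?_⟩
          simp only [h, not_false_eq_true, Set.indicator_of_notMem] at hy
          rw [Set.mem_ofPred_eq]; beta_reduce; omega
      have h1 := (measure_mono (μ := Measure.pi (fun _ : Fin (K + 1) => ν)) hsub).trans
        (measure_union_le _ _)
      rw [pi_cons, pi_cons] at h1
      refine (mul_le_mul_left h1 _).trans ?_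
      have a1 := ih (M + 1)
      have a2 := ih M
      have h3 : ν Bᶜ + 2 * ν B = 1 + ν B := by
        rw [two_mul, ← add_assoc, add_comm (ν Bᶜ), prob_add_prob_compl hB]
      calc _ = ν Bᶜ * (Measure.pi (fun _ : Fin K => ν)
            {y | M + 1 ≤ ∑ i, B.indicator (fun _ => 1) (y i)} * 2 ^ (M + 1)) +
            2 * ν B * (Measure.pi (fun _ : Fin K => ν)
            {y | M ≤ ∑ i, B.indicator (fun _ => 1) (y i)} * 2 ^ M) := by ring
        _ ≤ ν Bᶜ * (1 + ν B) ^ K + 2 * ν B * (1 + ν B) ^ K := by gcongr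
        _ = (1 + ν B) ^ (K + 1) := by rw [← add_mul, h3, pow_succ, mul_comm]

lemma pois_point [Fintype ι] [DecidableEq ι] (ν : Measure α) [IsProbabilityMeasure ν] (C : ι → Set α)
    (hC : ∀ c, MeasurableSet (C c))
    (hd : Pairwise (fun c d => Disjoint (C c) (C d))) (K M : ℕ) (hM : M < K) (l : ι → ℝ≥0)
    (hl : ∀ c, (l c : ℝ) = K * ν.real (C c)) (x : ι → ℕ) (hx : ∑ c, x c ≤ M) :
    Measure.pi (fun _ : Fin K => ν) {y | cnt C y = x} ≤
      ENNReal.ofReal (Real.sqrt (K / (K - M))) * Measure.pi (fun c => poissonMeasure (l c)) {x} := by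
  have h := mult_bound ν C hd K x
  set P := Measure.pi (fun _ : Fin K => ν) {y | cnt C y = x} with hP
  set p := ∑ c, ν.real (C c) with hp
  set m := ∑ c, x c with hm
  have hU : ν.real (⋃ c, C c) = p := by
    rw [measureReal_iUnion_fintype (fun c d hcd => hd hcd) hC]
  have hr : ν (⋃ c, C c)ᶜ = ENNReal.ofReal (1 - p) := by
    rw [← hU, ← probReal_compl_eq_one_sub (MeasurableSet.iUnion hC), ofReal_measureReal]
  have hp1 : p ≤ 1 := by rw [← hU]; exact measureReal_le_one
  have hPr : P = ENNReal.ofReal P.toReal := (ENNReal.ofReal_toReal (measure_ne_top _ _)).symm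
  have hq : ∀ c, ν (C c) = ENNReal.ofReal (ν.real (C c)) := fun c => (ofReal_measureReal).symm
  have hreal : P.toReal * ∏ c, ((x c).factorial : ℝ) ≤
      (K.descFactorial m : ℝ) * (∏ c, ν.real (C c) ^ x c) * (1 - p) ^ (K - m) := by
    have := ENNReal.toReal_mono (by
      rw [hr]
      refine ENNReal.mul_ne_top (ENNReal.mul_ne_top (by simp) ?_) (by simp)
      exact ENNReal.prod_ne_top fun c _ => by simp) h
    rw [hr] at this
    simpa [ENNReal.toReal_prod, ENNReal.toReal_ofReal (sub_nonneg.2 hp1), Measure.real] using this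
  have hpoi : Measure.pi (fun c => poissonMeasure (l c)) {x} =
      ENNReal.ofReal (∏ c, (Real.exp (-(l c : ℝ)) * (l c : ℝ) ^ x c / (x c).factorial)) := by
    rw [Measure.pi_singleton, ENNReal.ofReal_prod_of_nonneg (fun c _ => by positivity)]
    exact Finset.prod_congr rfl fun c _ => poissonMeasure_singleton _ _
  have hK0 : (0:ℝ) < K := by exact_mod_cast (by omega : 0 < K)
  rw [hpoi, hPr, ← ENNReal.ofReal_mul (by positivity)]
  refine ENNReal.ofReal_le_ofReal ?_
  rw [Finset.prod_div_distrib, Finset.prod_mul_distrib, ← Real.exp_sum, Finset.sum_neg_distrib]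
  have e1 : ∑ c, (l c : ℝ) = K * p := by rw [hp, Finset.mul_sum]; simp_rw [hl]
  have e2 : ∏ c, (l c : ℝ) ^ x c = (K:ℝ) ^ m * ∏ c, ν.real (C c) ^ x c := by
    simp_rw [hl, mul_pow]
    rw [Finset.prod_mul_distrib, Finset.prod_pow_eq_pow_sum]
  rw [e1, e2, ← mul_div_assoc, le_div_iff₀ (Finset.prod_pos fun c _ => by positivity)]
  have hD := D_bound K m (lt_of_le_of_lt hx hM) p hp1
  have hPi : 0 ≤ ∏ c, ν.real (C c) ^ x c := Finset.prod_nonneg fun c _ => by positivity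
  have hsq : Real.sqrt (K / (K - m)) ≤ Real.sqrt (K / (K - M)) := by
    apply Real.sqrt_le_sqrt
    have h1 : (0:ℝ) < K - M := by
      rw [sub_pos]; exact_mod_cast hM
    have h2 : (m:ℝ) ≤ M := by exact_mod_cast hx
    gcongr
  refine hreal.trans ?_
  have hee : Real.exp (K * p) * Real.exp (-(K * p)) = 1 := by rw [← Real.exp_add]; simp
  calc (K.descFactorial m : ℝ) * (∏ c, ν.real (C c) ^ x c) * (1 - p) ^ (K - m)
      = ((K.descFactorial m : ℝ) * (1 - p) ^ (K - m) * Real.exp (K * p)) *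
          ((∏ c, ν.real (C c) ^ x c) * Real.exp (-(K * p))) := by
        linear_combination (-(K.descFactorial m : ℝ) * (∏ c, ν.real (C c) ^ x c) *
          (1 - p) ^ (K - m)) * hee
    _ ≤ (Real.sqrt (K / (K - m)) * (K:ℝ) ^ m) *
          ((∏ c, ν.real (C c) ^ x c) * Real.exp (-(K * p))) := by gcongr
    _ ≤ (Real.sqrt (K / (K - M)) * (K:ℝ) ^ m) *
          ((∏ c, ν.real (C c) ^ x c) * Real.exp (-(K * p))) := by gcongr
    _ = _ := by ring

lemma compare_fin [Fintype ι] [DecidableEq ι] (ν : Measure α) [IsProbabilityMeasure ν] (C : ι → Set α)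
    (hC : ∀ c, MeasurableSet (C c))
    (hd : Pairwise (fun c d => Disjoint (C c) (C d))) (K M : ℕ) (hM : M < K) (l : ι → ℝ≥0)
    (hl : ∀ c, (l c : ℝ) = K * ν.real (C c)) (p : ℝ) (hp : ∑ c, ν.real (C c) ≤ p)
    (A : Set (ι → ℕ)) :
    Measure.pi (fun _ : Fin K => ν) {y | cnt C y ∈ A} ≤
      ENNReal.ofReal (Real.sqrt (K / (K - M))) * Measure.pi (fun c => poissonMeasure (l c)) A +
      ENNReal.ofReal ((1 + p) ^ K / 2 ^ M) := by
  have hsub : {y : Fin K → α | cnt C y ∈ A} ⊆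
      (⋃ x : {x : ι → ℕ // x ∈ A ∧ ∑ c, x c ≤ M}, {y : Fin K → α | cnt C y = x.1}) ∪
      {y | M ≤ ∑ i, (⋃ c, C c).indicator (fun _ => 1) (y i)} := by
    intro y hy
    by_cases h : ∑ c, cnt C y c ≤ M
    · exact Or.inl (Set.mem_iUnion.2 ⟨⟨_, hy, h⟩, rfl⟩)
    · right
      push Not at h
      refine h.le.trans ?_
      unfold cnt
      rw [Finset.sum_comm]
      refine Finset.sum_le_sum fun i _ => ?_
      by_cases h0 : ∃ c, y i ∈ C c
      · obtain ⟨c, hc⟩ := h0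
        rw [Set.indicator_of_mem (Set.mem_iUnion.2 ⟨c, hc⟩), Finset.sum_eq_single c]
        · simp [hc]
        · intro d _ hdc
          have : y i ∉ C d := fun h' => Set.disjoint_left.1 (hd hdc) h' hc
          simp [this]
        · simp
      · push Not at h0
        simp [h0]
  refine (measure_mono hsub).trans ((measure_union_le _ _).trans (add_le_add ?_ ?_))
  · refine (measure_iUnion_le _).trans ?_
    refine (ENNReal.tsum_le_tsum fun x : {x : ι → ℕ // x ∈ A ∧ ∑ c, x c ≤ M} => pois_point ν C hC hd K M hM l hl x.1 x.2.2).trans ?_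
    rw [ENNReal.tsum_mul_left]
    refine mul_le_mul_right ?_ _
    rw [← measure_iUnion]
    · refine measure_mono (Set.iUnion_subset fun x => ?_)
      exact Set.singleton_subset_iff.2 x.2.1
    · intro x x' hxx
      exact Set.disjoint_singleton.2 fun h => hxx (Subtype.ext h)
    · intro x; exact MeasurableSet.of_discrete
  · have h := tail_bound ν (⋃ c, C c) (MeasurableSet.iUnion hC) K M
    have hU : ν (⋃ c, C c) ≤ ENNReal.ofReal p := by
      rw [← ofReal_measureReal (μ := ν) (s := ⋃ c, C c)]
      refine ENNReal.ofReal_le_ofReal (le_trans (le_of_eq ?_) hp)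
      rw [measureReal_iUnion_fintype (fun c d hcd => hd hcd) hC]
    have hp0 : 0 ≤ p := le_trans (Finset.sum_nonneg fun c _ => measureReal_nonneg) hp
    rw [ENNReal.ofReal_div_of_pos (by positivity), ENNReal.ofReal_pow (by positivity),
      ENNReal.ofReal_pow (by positivity), ENNReal.ofReal_add (by norm_num) hp0,
      ENNReal.ofReal_one, ENNReal.ofReal_ofNat]
    rw [ENNReal.le_div_iff_mul_le (by left; simp) (by left; simp)]
    exact h.trans (pow_le_pow_left' (add_le_add le_rfl hU) _)

/-- comparison of multinomial and Poisson counts -/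
theorem compare [DecidableEq ι] (ν : Measure α) [IsProbabilityMeasure ν] (C : ι → Set α)
    (I : Finset ι) (hC : ∀ c ∈ I, MeasurableSet (C c))
    (hd : ∀ c ∈ I, ∀ d ∈ I, c ≠ d → Disjoint (C c) (C d)) (K M : ℕ) (hM : M < K) (l : ι → ℝ≥0)
    (hl : ∀ c ∈ I, (l c : ℝ) = K * ν.real (C c)) (p : ℝ) (hp : ∑ c ∈ I, ν.real (C c) ≤ p)
    (A : Set (ι → ℕ)) (hA : DepOn I A) :
    Measure.pi (fun _ : Fin K => ν) {y | cnt C y ∈ A} ≤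
      ENNReal.ofReal (Real.sqrt (K / (K - M))) * IP l A +
      ENNReal.ofReal ((1 + p) ^ K / 2 ^ M) := by
  rw [IP_apply_dep I l hA]
  have h := compare_fin ν (fun c : I => C c) (fun c => hC c c.2)
    (fun c d hcd => hd c c.2 d d.2 (fun h => hcd (Subtype.ext h))) K M hM (fun c : I => l c)
    (fun c => hl c c.2) p (by rwa [Finset.sum_coe_sort I (fun c => ν.real (C c))]) (ext0 I ⁻¹' A)
  refine le_trans (measure_mono ?_) h
  intro y hy
  refine hA (cnt C y) _ (fun i hi => ?_) hy
  simp [ext0, hi, cnt]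

end

end HC

namespace HC
open MeasureTheory Filter Topology ProbabilityTheory
open scoped ENNReal NNReal

/-- threshold -/
noncomputable def Uu (K : ℕ) (x : ℝ) : ℝ := (bHC K + x) / aHC K

lemma tendsto_logK : Tendsto (fun K : ℕ => Real.log K) atTop atTop :=
  Real.tendsto_log_atTop.comp tendsto_natCast_atTop_atTop

lemma tendsto_LL : Tendsto (fun K : ℕ => Real.log (Real.log K)) atTop atTop :=
  Real.tendsto_log_atTop.comp tendsto_logK

lemma tendsto_aHC : Tendsto aHC atTop atTop :=
  Real.tendsto_sqrt_atTop.comp (tendsto_LL.const_mul_atTop (by norm_num))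

lemma plog (q : ℕ) (c A : ℝ) (hc : 0 < c) : ∀ᶠ K : ℕ in atTop,
    A * Real.log K ^ q ≤ (K:ℝ) ^ c := by
  have h := (isLittleO_log_rpow_rpow_atTop (q:ℝ) hc).const_mul_left A
  have h2 := h.def (show (0:ℝ) < 1 by norm_num)
  filter_upwards [tendsto_natCast_atTop_atTop.eventually h2] with K hK
  rw [Real.rpow_natCast, one_mul, Real.norm_of_nonneg (by positivity : (0:ℝ) ≤ (K:ℝ) ^ c)] at hK
  exact (le_abs_self _).trans hK

/-- the second order correction in `b` -/
noncomputable def cc (K : ℕ) : ℝ :=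
  (1 / 2) * Real.log (Real.log (Real.log K)) - (1 / 2) * Real.log Real.pi

lemma aHC_sq : ∀ᶠ K : ℕ in atTop, 0 < aHC K ∧ 0 < Real.log (Real.log K) ∧ 0 < Real.log K ∧
    aHC K ^ 2 = 2 * Real.log (Real.log K) := by
  filter_upwards [tendsto_aHC.eventually_gt_atTop 0, tendsto_LL.eventually_gt_atTop 0,
    tendsto_logK.eventually_gt_atTop 0] with K h1 h2 h3
  exact ⟨h1, h2, h3, Real.sq_sqrt (by linarith)⟩

lemma Uu_eq : ∀ᶠ K : ℕ in atTop, ∀ x, Uu K x = aHC K + (cc K + x) / aHC K := by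
  filter_upwards [aHC_sq] with K h x
  obtain ⟨h1, h2, h3, h4⟩ := h
  have : bHC K = aHC K ^ 2 + cc K := by rw [h4]; unfold bHC cc; ring
  unfold Uu
  rw [this]; field_simp; ring

lemma Uu_add : ∀ᶠ K : ℕ in atTop, ∀ x δ, Uu K (x + δ) = Uu K x + δ / aHC K := by
  filter_upwards with K x δ
  unfold Uu; ring

lemma tendsto_cc_div : Tendsto (fun K : ℕ => cc K / aHC K) atTop (𝓝 0) := by
  -- `log y / sqrt (2 y) → 0`
  have h1 : Tendsto (fun y : ℝ => Real.log y / Real.sqrt y) atTop (𝓝 0) := by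
    have := isLittleO_log_rpow_atTop (show (0:ℝ) < 1 / 2 by norm_num)
    have := this.tendsto_div_nhds_zero
    simpa [Real.sqrt_eq_rpow] using this
  have h2 : Tendsto (fun y : ℝ => (Real.sqrt y)⁻¹) atTop (𝓝 0) :=
    tendsto_inv_atTop_zero.comp Real.tendsto_sqrt_atTop
  have h3 := (((h1.const_mul (1/2)).sub (h2.const_mul ((1/2) * Real.log Real.pi))).div_const
    (Real.sqrt 2)).comp tendsto_LL
  simp only [mul_zero, sub_zero, zero_div] at h3
  refine h3.congr' ?_
  filter_upwards with K
  simp only [Function.comp]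
  unfold cc aHC
  rw [Real.sqrt_mul (by norm_num)]
  ring

lemma tendsto_ca (x : ℝ) : Tendsto (fun K : ℕ => (cc K + x) / aHC K) atTop (𝓝 0) := by
  have := tendsto_cc_div.add (tendsto_const_nhds.div_atTop tendsto_aHC : Tendsto (fun K => x / aHC K) atTop (𝓝 0))
  simp only [add_zero] at this
  refine this.congr fun K => by ring

lemma Uu_bounds (x : ℝ) : ∀ᶠ K : ℕ in atTop, aHC K / 2 ≤ Uu K x ∧ Uu K x ≤ 2 * aHC K := by
  filter_upwards [Uu_eq, (tendsto_ca x).eventually (Icc_mem_nhds (show (-1:ℝ) < 0 by norm_num)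
    (show (0:ℝ) < 1 by norm_num)), tendsto_aHC.eventually_ge_atTop 2] with K h1 h2 h3
  rw [h1]
  obtain ⟨h4, h5⟩ := h2
  constructor <;> linarith

lemma tendsto_Uu (x : ℝ) : Tendsto (fun K => Uu K x) atTop atTop := by
  refine tendsto_atTop_mono' _ ((Uu_bounds x).mono fun K h => h.1) ?_
  exact tendsto_aHC.atTop_div_const (by norm_num)

lemma aHC_pow (q : ℕ) (A : ℝ) : ∀ᶠ K : ℕ in atTop, A * aHC K ^ q ≤ Real.log K := by
  have h := (isLittleO_log_rpow_rpow_atTop (q:ℝ) (show (0:ℝ) < 1 by norm_num)).const_mul_left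
    (A ^ 2 * 2 ^ q)
  have h2 := h.def (show (0:ℝ) < 1 by norm_num)
  filter_upwards [tendsto_logK.eventually h2, aHC_sq, tendsto_logK.eventually_ge_atTop 1] with K hK h h1
  obtain ⟨a1, a2, a3, a4⟩ := h
  rw [Real.rpow_natCast, one_mul, Real.rpow_one, Real.norm_of_nonneg a3.le] at hK
  have h5 := (le_abs_self _).trans hK
  have h6 : (A * aHC K ^ q) ^ 2 ≤ Real.log K := by
    calc (A * aHC K ^ q) ^ 2 = A ^ 2 * (aHC K ^ 2) ^ q := by ring
      _ = A ^ 2 * 2 ^ q * Real.log (Real.log K) ^ q := by rw [a4, mul_pow]; ring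
      _ ≤ _ := h5
  have h7 : (A * aHC K ^ q) ^ 2 ≤ Real.log K ^ 2 := h6.trans (by nlinarith)
  exact (le_abs_self _).trans (abs_le_of_sq_le_sq h7 a3.le)

lemma Uu_pow (x : ℝ) (q : ℕ) (A : ℝ) (hA : 0 ≤ A) : ∀ᶠ K : ℕ in atTop, A * Uu K x ^ q ≤ Real.log K := by
  filter_upwards [aHC_pow q (A * 2 ^ q), Uu_bounds x, tendsto_aHC.eventually_gt_atTop 0] with K h1 h2 h3
  refine le_trans ?_ h1
  rw [mul_assoc, ← mul_pow]
  have : 0 ≤ Uu K x := by linarith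
  gcongr
  exact h2.2

lemma tendsto_ph (x : ℝ) : Tendsto (fun K : ℕ => Real.log K * ph (Uu K x)) atTop
    (𝓝 (Real.exp (-x))) := by
  have h1 := tendsto_ca x
  have hUa : Tendsto (fun K : ℕ => 1 + (cc K + x) / aHC K / aHC K) atTop (𝓝 (1 + 0)) :=
    tendsto_const_nhds.add (h1.div_atTop tendsto_aHC)
  have he : Tendsto (fun K : ℕ => Real.exp (-x) * Real.exp (-(((cc K + x) / aHC K) ^ 2 / 2))) atTop
      (𝓝 (Real.exp (-x) * Real.exp (-(0 ^ 2 / 2)))) :=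
    ((Real.continuous_exp.tendsto _).comp ((h1.pow 2).div_const 2).neg).const_mul _
  have h := hUa.mul he
  simp only [add_zero, one_mul, ne_eq, OfNat.ofNat_ne_zero, not_false_eq_true, zero_pow, zero_div,
    neg_zero, Real.exp_zero, mul_one] at h
  refine h.congr' ?_
  filter_upwards [Uu_eq, aHC_sq] with K h2 h3
  obtain ⟨a1, a2, a3, a4⟩ := h3
  rw [ph, h2]
  set d := (cc K + x) / aHC K with hd
  have had : aHC K * d = cc K + x := by rw [hd]; field_simp
  have e1 : -((aHC K + d) ^ 2 / 2) = -(Real.log (Real.log K)) + (-(Real.log (Real.log (Real.log K)) / 2)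
      + Real.log Real.pi / 2) + (-x) + (-(d ^ 2 / 2)) := by
    have : (aHC K + d) ^ 2 = aHC K ^ 2 + 2 * (aHC K * d) + d ^ 2 := by ring
    rw [this, a4, had]; unfold cc; ring
  rw [e1, Real.exp_add, Real.exp_add, Real.exp_add, Real.exp_neg (Real.log (Real.log K)),
    Real.exp_log a3, Real.exp_add, Real.exp_neg (Real.log (Real.log (Real.log K)) / 2)]
  have e2 : Real.exp (Real.log (Real.log (Real.log K)) / 2) = Real.sqrt (Real.log (Real.log K)) := by
    rw [← Real.log_sqrt a2.le, Real.exp_log (by positivity)]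
  have e3 : Real.exp (Real.log Real.pi / 2) = Real.sqrt Real.pi := by
    rw [← Real.log_sqrt Real.pi_pos.le, Real.exp_log (by positivity)]
  rw [e2, e3]
  have e4 : aHC K = Real.sqrt 2 * Real.sqrt (Real.log (Real.log K)) := by
    unfold aHC; rw [Real.sqrt_mul (by norm_num)]
  have e5 : 1 + d / aHC K = (aHC K + d) / aHC K := by field_simp
  rw [e5, Real.sqrt_mul (by norm_num) Real.pi]
  have hs : 0 < Real.sqrt (Real.log (Real.log K)) := Real.sqrt_pos.2 a2
  have hs2 : 0 < Real.sqrt 2 := by positivity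
  have hsp : 0 < Real.sqrt Real.pi := Real.sqrt_pos.2 Real.pi_pos
  have e6 : (aHC K + d) / aHC K = (aHC K + d) / (Real.sqrt 2 * Real.sqrt (Real.log (Real.log K))) := by
    rw [← e4]
  rw [e6]
  generalize Real.exp (-(d ^ 2 / 2)) = E
  generalize Real.exp (-x) = X
  field_simp

/-- block boundary index -/
noncomputable def J (f : ℝ) (K : ℕ) : ℕ := ⌈(K:ℝ) ^ f⌉₊

lemma J_lower (f : ℝ) (K : ℕ) : (K:ℝ) ^ f ≤ J f K := Nat.le_ceil _

lemma J_upper (f : ℝ) (K : ℕ) : (J f K : ℝ) ≤ (K:ℝ) ^ f + 1 := (Nat.ceil_lt_add_one (by positivity)).le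

lemma J_upper2 (f : ℝ) (hf : 0 ≤ f) (K : ℕ) (hK : 1 ≤ K) : (J f K : ℝ) ≤ 2 * (K:ℝ) ^ f := by
  have h := J_upper f K
  have : 1 ≤ (K:ℝ) ^ f := Real.one_le_rpow (by exact_mod_cast hK) hf
  linarith

/-- polynomial separation -/
lemma J_sep (f g : ℝ) (hf : 0 ≤ f) (hfg : f < g) (A : ℝ) (q : ℕ) (hA : 0 ≤ A) : ∀ᶠ K : ℕ in atTop,
    A * Real.log K ^ q * J f K ≤ J g K := by
  filter_upwards [plog q (g - f) (A * 2) (by linarith), eventually_ge_atTop 1] with K h1 h2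
  have hK : (0:ℝ) < K := by exact_mod_cast h2
  have hl : 0 ≤ Real.log K := Real.log_nonneg (by exact_mod_cast h2)
  calc A * Real.log K ^ q * J f K ≤ A * Real.log K ^ q * (2 * (K:ℝ) ^ f) := by
        gcongr; exact J_upper2 f hf K h2
    _ = (A * 2 * Real.log K ^ q) * (K:ℝ) ^ f := by ring
    _ ≤ (K:ℝ) ^ (g - f) * (K:ℝ) ^ f := by gcongr
    _ = (K:ℝ) ^ g := by rw [← Real.rpow_add hK]; ring_nf
    _ ≤ _ := J_lower g K

lemma J_large (f : ℝ) (hf : 0 < f) (A : ℝ) (q : ℕ) : ∀ᶠ K : ℕ in atTop,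
    A * Real.log K ^ q ≤ J f K := by
  filter_upwards [plog q f A hf] with K h1
  exact h1.trans (J_lower f K)

end HC

namespace HC
open MeasureTheory Filter Topology ProbabilityTheory
open scoped ENNReal NNReal

lemma S_shift (ω : ℕ → ℕ) (st j : ℕ) : S (fun i => ω (st + i)) j = S ω (st + j) - S ω st := by
  unfold S; rw [Finset.sum_range_add]; ring

lemma Lam_shift (l : ℕ → ℝ≥0) (st j : ℕ) :
    Lam (fun i => l (st + i)) j = Lam l (st + j) - Lam l st := by
  unfold Lam; rw [Finset.sum_range_add]; ring

/-- block exceedance event, from increments after `st` -/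
def Fb (l : ℕ → ℝ≥0) (st j1 j2 : ℕ) (V : ℝ) : Set (ℕ → ℕ) :=
  {ω | ∃ j ∈ Finset.Icc (j1 - st) (j2 - st), V * Real.sqrt (Lam (fun i => l (st + i)) j) ≤
    |S (fun i => ω (st + i)) j - Lam (fun i => l (st + i)) j|}

lemma dep_exc (l : ℕ → ℝ≥0) (V : ℝ) (j1 j2 : ℕ) : DepOn (Finset.range j2)
    {ω : ℕ → ℕ | ∃ j ∈ Finset.Icc j1 j2, V * Real.sqrt (Lam l j) ≤ |S ω j - Lam l j|} := by
  rintro ω ω' h ⟨j, hj, hE⟩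
  refine ⟨j, hj, ?_⟩
  rwa [← S_congr (fun i hi => h i ?_)]
  have := (Finset.mem_Icc.1 hj).2
  have := Finset.mem_range.1 hi
  exact Finset.mem_range.2 (by omega)

lemma dep_Fb (l : ℕ → ℝ≥0) (st j1 j2 : ℕ) (V : ℝ) : DepOn (Finset.Ico st j2) (Fb l st j1 j2 V) := by
  intro ω ω' h hω
  refine dep_exc (fun i => l (st + i)) V (j1 - st) (j2 - st) _ _ (fun i hi => ?_) hω
  have := Finset.mem_range.1 hi
  exact h _ (Finset.mem_Ico.2 (by omega))

lemma IP_Fb (l : ℕ → ℝ≥0) (st j1 j2 : ℕ) (V : ℝ) :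
    IP l (Fb l st j1 j2 V) = IP (fun i => l (st + i)) {ω : ℕ → ℕ | ∃ j ∈ Finset.Icc (j1 - st) (j2 - st),
      V * Real.sqrt (Lam (fun i => l (st + i)) j) ≤ |S ω j - Lam (fun i => l (st + i)) j|} := by
  rw [← IP_reindex l (fun i => st + i) (fun a b h => by simpa using h) (dep_exc _ _ _ _).meas]
  rfl

lemma EF (V θ η Sj Sst Lj Lst j : ℝ) (hj : 0 < j) (hV : 0 ≤ V) (hθ : 0 < θ)
    (hL : |Lj - j| ≤ η * Real.sqrt j) (hst : 0 ≤ Lst) (hη : η ≤ θ / 8)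
    (hVη : V * η ≤ θ / 8 * Real.sqrt j) (hVst : V * Lst ≤ θ / 8 * j)
    (hn : |Sst - Lst| ≤ θ / 8 * Real.sqrt j) (hL2 : 0 ≤ Lj - Lst) :
    (|(Sj - Sst) - (Lj - Lst)| < V * Real.sqrt (Lj - Lst) → |Sj - j| ≤ (V + θ) * Real.sqrt j) ∧
    (|Sj - j| ≤ (V - θ) * Real.sqrt j → |(Sj - Sst) - (Lj - Lst)| < V * Real.sqrt (Lj - Lst)) := by
  have hsj : 0 < Real.sqrt j := Real.sqrt_pos.2 hj
  have hjj : Real.sqrt j * Real.sqrt j = j := Real.mul_self_sqrt hj.le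
  have hs' : 0 ≤ Real.sqrt (Lj - Lst) := Real.sqrt_nonneg _
  have hss : Real.sqrt (Lj - Lst) * Real.sqrt (Lj - Lst) = Lj - Lst := Real.mul_self_sqrt hL2
  set s := Real.sqrt (Lj - Lst) with hs
  set q := Real.sqrt j with hq
  have hd : |s - q| * q ≤ η * q + Lst := by
    have h1 : |s - q| * (s + q) = |Lj - Lst - j| := by
      rw [← abs_of_nonneg (show 0 ≤ s + q by linarith), ← abs_mul]
      congr 1; linear_combination hss - hjj
    have h2 : |Lj - Lst - j| ≤ η * q + Lst := by
      rw [show Lj - Lst - j = (Lj - j) - Lst by ring]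
      refine (abs_sub _ _).trans ?_
      rw [abs_of_nonneg hst]; linarith
    have h3 : 0 ≤ |s - q| * s := by positivity
    linarith
  have hVd : V * |s - q| ≤ θ / 4 * q := by
    have h1 : V * |s - q| * q ≤ (θ / 4 * q) * q := by
      have h2 := mul_le_mul_of_nonneg_left hd hV
      have h3 : V * η * q ≤ θ / 8 * q * q := mul_le_mul_of_nonneg_right hVη hsj.le
      have h4 : θ / 8 * j = θ / 8 * q * q := by rw [mul_assoc, hjj]
      have h5 : V * (η * q + Lst) = V * η * q + V * Lst := by ring
      linarith
    exact le_of_mul_le_mul_right h1 hsj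
  have hVs1 : V * s ≤ V * q + θ / 4 * q := by
    have := mul_le_mul_of_nonneg_left (le_abs_self (s - q)) hV
    linarith
  have hVs2 : V * q - θ / 4 * q ≤ V * s := by
    have := mul_le_mul_of_nonneg_left (neg_abs_le (s - q)) hV
    linarith
  have hdiff : |(Sj - j) - ((Sj - Sst) - (Lj - Lst))| ≤ θ / 4 * q := by
    rw [show (Sj - j) - ((Sj - Sst) - (Lj - Lst)) = (Sst - Lst) + (Lj - j) by ring]
    refine (abs_add_le _ _).trans ?_
    have : η * q ≤ θ / 8 * q := mul_le_mul_of_nonneg_right hη hsj.le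
    linarith
  have hθq : 0 < θ * q := by positivity
  constructor
  · intro h
    have h1 : |Sj - j| ≤ |(Sj - Sst) - (Lj - Lst)| + |(Sj - j) - ((Sj - Sst) - (Lj - Lst))| := by
      have := abs_add_le ((Sj - Sst) - (Lj - Lst)) ((Sj - j) - ((Sj - Sst) - (Lj - Lst)))
      rwa [add_sub_cancel] at this
    linarith
  · intro h
    have h1 : |(Sj - Sst) - (Lj - Lst)| ≤ |Sj - j| + |(Sj - j) - ((Sj - Sst) - (Lj - Lst))| := by
      have := abs_sub (Sj - j) ((Sj - j) - ((Sj - Sst) - (Lj - Lst)))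
      rwa [sub_sub_cancel] at this
    linarith

/-- closeness of the rates to unit rates, on an exponent interval -/
def Close (k : ℕ → ℕ) (l : ℕ → ℕ → ℝ≥0) (f g : ℝ) : Prop :=
  ∃ η : ℕ → ℝ, (∀ n, 0 ≤ η n) ∧ Tendsto (fun n => η n * aHC (k n)) atTop (𝓝 0) ∧
    ∀ᶠ n in atTop, ∀ j : ℕ, J f (k n) ≤ j → j ≤ J g (k n) → |Lam (l n) j - j| ≤ η n * Real.sqrt j

lemma block_basic {k : ℕ → ℕ} (hk : Tendsto k atTop atTop) {l : ℕ → ℕ → ℝ≥0} {α0 α β : ℝ}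
    (h0 : 0 < α0) (h1 : α0 < α) (h2 : α ≤ β) (hc : Close k l α0 β) : ∃ η : ℕ → ℝ, (∀ n, 0 ≤ η n) ∧ Tendsto (fun n => η n * aHC (k n)) atTop (𝓝 0) ∧
    ∀ᶠ n in atTop, η n ≤ 1 / 8 ∧ 1 ≤ J α0 (k n) ∧ J α0 (k n) < J α (k n) ∧ J α (k n) ≤ J β (k n) ∧
    1 ≤ Lam (l n) (J α0 (k n)) ∧
    Lam (l n) (J α0 (k n)) ≤ 2 * J α0 (k n) ∧
    (∀ j : ℕ, J α0 (k n) ≤ j → j ≤ J β (k n) → |Lam (l n) j - j| ≤ η n * Real.sqrt j) ∧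
    (∀ j : ℕ, J α (k n) ≤ j → j ≤ J β (k n) →
      (j:ℝ) / 2 ≤ Lam (l n) j - Lam (l n) (J α0 (k n)) ∧ 
      Lam (l n) j - Lam (l n) (J α0 (k n)) ≤ 2 * j) := by
  obtain ⟨η, hη0, hηa, hcl⟩ := hc
  refine ⟨η, hη0, hηa, ?_⟩
  have hη1 : ∀ᶠ n in atTop, η n ≤ 1 / 8 := by
    filter_upwards [hηa.eventually (ge_mem_nhds (show (0:ℝ) < 1 / 8 by norm_num)),
      hk.eventually (tendsto_aHC.eventually_ge_atTop 1)] with n h3 h4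
    have := mul_le_mul_of_nonneg_left h4 (hη0 n)
    linarith
  filter_upwards [hη1, hcl, hk.eventually (J_large α0 h0 4 0),
    hk.eventually (J_sep α0 α h0.le h1 8 0 (by norm_num)), hk.eventually (eventually_ge_atTop 1)]
    with n a1 a2 a3 a4 a5
  simp only [pow_zero, mul_one] at a3 a4
  have hJ1 : 1 ≤ J α0 (k n) := by
    have : (1:ℝ) ≤ (J α0 (k n) : ℝ) := by linarith
    exact_mod_cast this
  have hJ2 : J α0 (k n) < J α (k n) := by
    have : (J α0 (k n) : ℝ) < (J α (k n) : ℝ) := by linarith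
    exact_mod_cast this
  have hJ3 : J α (k n) ≤ J β (k n) := by
    unfold J
    exact Nat.ceil_mono (Real.rpow_le_rpow_of_exponent_le (by exact_mod_cast a5) h2)
  have hsq : ∀ j : ℕ, J α0 (k n) ≤ j → η n * Real.sqrt j ≤ j / 8 := by
    intro j hj
    have hj1 : (1:ℝ) ≤ j := by exact_mod_cast hJ1.trans hj
    have h5 : Real.sqrt j ≤ j := by
      rw [Real.sqrt_le_left (by linarith)]; nlinarith
    calc η n * Real.sqrt j ≤ 1 / 8 * j := by gcongr
      _ = _ := by ring
  have hst := abs_le.1 (a2 _ le_rfl (hJ2.le.trans hJ3))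
  have hst' := hsq _ le_rfl
  refine ⟨a1, hJ1, hJ2, hJ3, by linarith [hst.1], by linarith [hst.2], a2, ?_⟩
  intro j hj hj'
  have h6 := abs_le.1 (a2 j (hJ2.le.trans hj) hj')
  have h7 := hsq j (hJ2.le.trans hj)
  have h8 : (J α (k n) : ℝ) ≤ j := by exact_mod_cast hj
  have h9 := Lam_nonneg (l n) (J α0 (k n))
  exact ⟨by linarith [h6.1, hst.2], by linarith [h6.2]⟩

lemma block_set {k : ℕ → ℕ} (hk : Tendsto k atTop atTop) {l : ℕ → ℕ → ℝ≥0} {α0 α β : ℝ}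
    (h0 : 0 < α0) (h1 : α0 < α) (h2 : α ≤ β) (hc : Close k l α0 β)
    (x δ : ℝ) (hδ : 0 < δ) : ∀ᶠ n in atTop, ∀ ω : ℕ → ℕ,
    |S ω (J α0 (k n)) - Lam (l n) (J α0 (k n))| ≤ δ / aHC (k n) / 8 * Real.sqrt (J α (k n)) →
    (ω ∉ Fb (l n) (J α0 (k n)) (J α (k n)) (J β (k n)) (Uu (k n) x) →
      ∀ j : ℕ, J α (k n) ≤ j → j ≤ J β (k n) → |S ω j - j| ≤ (Uu (k n) x + δ / aHC (k n)) * Real.sqrt j) ∧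
    ((∀ j : ℕ, J α (k n) ≤ j → j ≤ J β (k n) → |S ω j - j| ≤ (Uu (k n) x - δ / aHC (k n)) * Real.sqrt j) →
      ω ∉ Fb (l n) (J α0 (k n)) (J α (k n)) (J β (k n)) (Uu (k n) x)) := by
  obtain ⟨η, hη0, hηa, hb⟩ := block_basic hk h0 h1 h2 hc
  filter_upwards [hb, hηa.eventually (ge_mem_nhds (show (0:ℝ) < δ / 8 by positivity)),
    hk.eventually (tendsto_aHC.eventually_ge_atTop 1), hk.eventually (Uu_bounds x),
    hk.eventually (J_sep α0 α h0.le h1 (32 / δ) 1 (by positivity)),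
    hk.eventually (aHC_pow 2 1), hk.eventually (J_large α (h0.trans h1) 4 1)]
    with n hb a1 a2 a3 a4 a5 a6 ω hω
  obtain ⟨b1, b2, b3, b4, b5, b6, b7, b8⟩ := hb
  set a := aHC (k n)
  set U := Uu (k n) x
  set st := J α0 (k n)
  have hkey : ∀ j : ℕ, J α (k n) ≤ j → j ≤ J β (k n) →
      (|(S ω j - S ω st) - (Lam (l n) j - Lam (l n) st)| < U * Real.sqrt (Lam (l n) j - Lam (l n) st) →
        |S ω j - j| ≤ (U + δ / a) * Real.sqrt j) ∧
      (|S ω j - j| ≤ (U - δ / a) * Real.sqrt j →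
        |(S ω j - S ω st) - (Lam (l n) j - Lam (l n) st)| < U * Real.sqrt (Lam (l n) j - Lam (l n) st)) := by
    intro j hj hj'
    have hj0 : 0 < j := lt_of_le_of_lt (Nat.zero_le _) (lt_of_lt_of_le b3 hj)
    have hjJ : (J α (k n) : ℝ) ≤ j := by exact_mod_cast hj
    have ha0 : 0 < a := by linarith
    have hU0 : 0 ≤ U := by linarith [a3.1]
    have h9 := Lam_nonneg (l n) st
    have h10 := b8 j hj hj'
    have hlog : a ^ 2 ≤ Real.log (k n) := by linarith
    have hs2a : 2 * a ≤ Real.sqrt j := by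
      apply Real.le_sqrt_of_sq_le
      rw [pow_one] at a6
      nlinarith
    refine EF U (δ / a) (η n) (S ω j) (S ω st) (Lam (l n) j) (Lam (l n) st) j (by exact_mod_cast hj0)
      hU0 (by positivity) (b7 j (b3.le.trans hj) hj') h9 ?_ ?_ ?_ ?_ ?_
    · rw [div_div, le_div_iff₀ (by positivity)]; linarith
    · calc U * η n ≤ 2 * a * η n := by gcongr; exact hη0 n; exact a3.2
        _ = 2 * (η n * a) := by ring
        _ ≤ 2 * (δ / 8) := by gcongr
        _ = δ / a / 8 * (2 * a) := by field_simp
        _ ≤ _ := by gcongr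
    · rw [pow_one] at a4
      calc U * Lam (l n) st ≤ 2 * a * (2 * st) := by gcongr; exact a3.2
        _ = δ / a / 8 * (32 / δ * a ^ 2 * st) := by field_simp; ring
        _ ≤ δ / a / 8 * (32 / δ * Real.log (k n) * st) := by gcongr
        _ ≤ δ / a / 8 * j := by gcongr; exact a4.trans hjJ
    · refine hω.trans ?_
      gcongr
    · have : (0:ℝ) < j := by exact_mod_cast hj0
      linarith [h10.1]
  constructor
  · intro hF j hj hj'
    refine (hkey j hj hj').1 ?_
    by_contra hcon
    push Not at hcon
    apply hF
    refine ⟨j - st, Finset.mem_Icc.2 ⟨by omega, by omega⟩, ?_⟩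
    rw [S_shift, Lam_shift, show st + (j - st) = j by omega]
    exact hcon
  · rintro hE ⟨i, hi, hF⟩
    have hi' := Finset.mem_Icc.1 hi
    rw [S_shift, Lam_shift] at hF
    have := (hkey (st + i) (by omega) (by omega)).2 (hE (st + i) (by omega) (by omega))
    exact absurd hF (not_le.2 this)

lemma block_noise {k : ℕ → ℕ} (hk : Tendsto k atTop atTop) {l : ℕ → ℕ → ℝ≥0} {α0 α β : ℝ}
    (h0 : 0 < α0) (h1 : α0 < α) (h2 : α ≤ β) (hc : Close k l α0 β)
    (δ ρ : ℝ) (hδ : 0 < δ) (hρ : 0 < ρ) : ∀ᶠ n in atTop,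
    IP (l n) {ω | ¬ (|S ω (J α0 (k n)) - Lam (l n) (J α0 (k n))| ≤
      δ / aHC (k n) / 8 * Real.sqrt (J α (k n)))} ≤ ENNReal.ofReal ρ := by
  obtain ⟨η, hη0, hηa, hb⟩ := block_basic hk h0 h1 h2 hc
  have hlim : Tendsto (fun n => 2 * Real.exp (1 - Real.log (k n))) atTop (𝓝 (2 * 0)) := by
    refine (Real.tendsto_exp_atBot.comp ?_).const_mul 2
    exact tendsto_atBot_add_const_left _ _ (tendsto_neg_atTop_atBot.comp (tendsto_logK.comp hk))
  rw [mul_zero] at hlim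
  filter_upwards [hb, hlim.eventually (ge_mem_nhds hρ), hk.eventually (aHC_pow 2 1),
    hk.eventually (J_sep α0 α h0.le h1 (128 / δ ^ 2) 3 (by positivity)),
    hk.eventually (tendsto_aHC.eventually_ge_atTop 1)] with n hb a1 a2 a3 a4
  obtain ⟨b1, b2, b3, b4, b5, b6, b7, b8⟩ := hb
  refine le_trans (measure_mono ?_) ((chernoff_abs (l n) (J α0 (k n)) (Real.log (k n)) b5).trans
    (ENNReal.ofReal_le_ofReal a1))
  intro ω hω
  rw [Set.mem_ofPred_eq] at hω ⊢
  push Not at hω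
  refine le_trans ?_ hω.le
  set a := aHC (k n)
  have ha0 : 0 < a := by linarith
  have hl0 : 0 ≤ Real.log (k n) := by nlinarith
  rw [← Real.sqrt_sq hl0, ← Real.sqrt_mul (sq_nonneg _),
    ← Real.sqrt_sq (show 0 ≤ δ / a / 8 by positivity), ← Real.sqrt_mul (sq_nonneg _)]
  apply Real.sqrt_le_sqrt
  calc Real.log (k n) ^ 2 * Lam (l n) (J α0 (k n)) ≤ Real.log (k n) ^ 2 * (2 * J α0 (k n)) := by gcongr
    _ = (δ / a / 8) ^ 2 * (128 / δ ^ 2 * (Real.log (k n) ^ 2 * a ^ 2) * J α0 (k n)) := by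
        field_simp; ring
    _ ≤ (δ / a / 8) ^ 2 * (128 / δ ^ 2 * (Real.log (k n) ^ 2 * Real.log (k n)) * J α0 (k n)) := by
        gcongr; linarith
    _ = (δ / a / 8) ^ 2 * (128 / δ ^ 2 * Real.log (k n) ^ 3 * J α0 (k n)) := by ring
    _ ≤ _ := by gcongr

end HC

namespace HC
open MeasureTheory Filter Topology ProbabilityTheory
open scoped ENNReal NNReal

lemma log_ratio_bounds {K : ℕ} (hK : 2 ≤ K) {α β L1 L2 : ℝ} (hα : 0 ≤ α) (hβ : 0 ≤ β)
    (a1 : (J α K : ℝ) / 2 ≤ L1) (a2 : L1 ≤ 2 * J α K) (b1 : (J β K : ℝ) / 2 ≤ L2)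
    (b2 : L2 ≤ 2 * J β K) :
    Real.log (L2 / L1) ≤ (β - α) * Real.log K + 3 ∧ (β - α) * Real.log K - 3 ≤ Real.log (L2 / L1) := by
  have hK0 : (0:ℝ) < K := by positivity
  have l2 := Real.log_two_lt_d9
  have pα : 0 < (K:ℝ) ^ α := by positivity
  have pβ : 0 < (K:ℝ) ^ β := by positivity
  have u1 := J_upper2 α hα K (by omega)
  have u2 := J_upper2 β hβ K (by omega)
  have v1 := J_lower α K
  have v2 := J_lower β K
  have p1 : 0 < L1 := by linarith
  have p2 : 0 < L2 := by linarith
  rw [Real.log_div p2.ne' p1.ne']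
  have e4 : Real.log 4 = 2 * Real.log 2 := by
    rw [show (4:ℝ) = 2 ^ 2 by norm_num, Real.log_pow]; norm_num
  have i1 : Real.log L2 ≤ Real.log 4 + β * Real.log K := by
    rw [← Real.log_rpow hK0, ← Real.log_mul (by norm_num) pβ.ne']
    exact Real.log_le_log p2 (by linarith)
  have i2 : Real.log L1 ≤ Real.log 4 + α * Real.log K := by
    rw [← Real.log_rpow hK0, ← Real.log_mul (by norm_num) pα.ne']
    exact Real.log_le_log p1 (by linarith)
  have i3 : β * Real.log K - Real.log 2 ≤ Real.log L2 := by
    rw [← Real.log_rpow hK0, ← Real.log_div pβ.ne' (by norm_num)]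
    exact Real.log_le_log (by positivity) (by linarith)
  have i4 : α * Real.log K - Real.log 2 ≤ Real.log L1 := by
    rw [← Real.log_rpow hK0, ← Real.log_div pα.ne' (by norm_num)]
    exact Real.log_le_log (by positivity) (by linarith)
  rw [sub_mul]
  constructor <;> linarith

lemma tendsto_phw {k : ℕ → ℕ} (hk : Tendsto k atTop atTop) (x w c : ℝ) :
    Tendsto (fun n => ph (Uu (k n) x) * (w * Real.log (k n) + c)) atTop (𝓝 (Real.exp (-x) * w)) := by
  have h1 := (tendsto_ph x).comp hk
  have h2 : Tendsto (fun n => w + c / Real.log (k n)) atTop (𝓝 (w + 0)) :=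
    tendsto_const_nhds.add ((tendsto_logK.comp hk).const_div_atTop c)
  rw [add_zero] at h2
  refine (h1.mul h2).congr' ?_
  filter_upwards [(tendsto_logK.comp hk).eventually_gt_atTop 0] with n hn
  simp only [Function.comp] at hn ⊢
  field_simp

set_option maxHeartbeats 1000000 in
lemma block_upper {k : ℕ → ℕ} (hk : Tendsto k atTop atTop) {l : ℕ → ℕ → ℝ≥0} {α0 α β : ℝ}
    (h0 : 0 < α0) (h1 : α0 < α) (h2 : α ≤ β) (hc : Close k l α0 β) (x ε' : ℝ) (hε' : 0 < ε') :
    ∀ᶠ n in atTop, IP (l n) (Fb (l n) (J α0 (k n)) (J α (k n)) (J β (k n)) (Uu (k n) x)) ≤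
      ENNReal.ofReal (Real.exp (-x) * (β - α) + ε') := by
  set c := Real.exp (-x) * (β - α) with hcdef
  have hc0 : 0 ≤ c := mul_nonneg (Real.exp_pos _).le (by linarith)
  set ε := ε' / (2 * (c + 1)) with hεdef
  have hε : 0 < ε := by positivity
  have hεc : (1 + ε) * c < c + ε' := by
    have : ε * (c + 1) = ε' / 2 := by rw [hεdef]; field_simp
    nlinarith
  obtain ⟨u0, hu0, hW⟩ := windowU ε hε
  obtain ⟨η, hη0, hηa, hB⟩ := block_basic hk h0 h1 h2 hc
  have hlim := (tendsto_phw hk x (β - α) 5).const_mul (1 + ε)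
  filter_upwards [hB, hlim.eventually (gt_mem_nhds hεc), hk.eventually ((tendsto_Uu x).eventually_ge_atTop u0),
    hk.eventually (eventually_ge_atTop 2), hk.eventually (Uu_pow x 8 2 (by norm_num)),
    hk.eventually (J_large α (h0.trans h1) 1 1)] with n hb hl hu hK hp hJ
  obtain ⟨-, b1, b2, b3, b4, b5, -, b7⟩ := hb
  rw [IP_Fb]
  have c1 := b7 _ le_rfl b3
  have c2 := b7 _ b3 le_rfl
  have e1 : Lam (fun i => l n (J α0 (k n) + i)) (J α (k n) - J α0 (k n)) =
      Lam (l n) (J α (k n)) - Lam (l n) (J α0 (k n)) := by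
    rw [Lam_shift, Nat.add_sub_of_le b2.le]
  have e2 : Lam (fun i => l n (J α0 (k n) + i)) (J β (k n) - J α0 (k n)) =
      Lam (l n) (J β (k n)) - Lam (l n) (J α0 (k n)) := by
    rw [Lam_shift, Nat.add_sub_of_le (b2.le.trans b3)]
  refine (hW _ hu (fun i => l n (J α0 (k n) + i)) _ _ (Nat.sub_le_sub_right b3 _) ?_).trans ?_
  · rw [e1]; simp only [one_mul, pow_one] at hJ; linarith [c1.1]
  · rw [e1, e2]
    have hr := (log_ratio_bounds hK (h0.trans h1).le ((h0.trans h1).le.trans h2) c1.1 c1.2 c2.1 c2.2).1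
    refine ENNReal.ofReal_le_ofReal (le_trans ?_ hl.le)
    refine mul_le_mul_of_nonneg_left ?_ (by linarith)
    have hpos : 0 < ph (Uu (k n) x) := ph_pos (by linarith)
    have := mul_le_mul_of_nonneg_left (show Real.log ((Lam (l n) (J β (k n)) - Lam (l n) (J α0 (k n))) /
      (Lam (l n) (J α (k n)) - Lam (l n) (J α0 (k n)))) + 2 ≤ (β - α) * Real.log (k n) + 5 by linarith) hpos.le
    linarith

set_option maxHeartbeats 2000000 in
lemma block_lower (x ε : ℝ) (hε : 0 < ε) (hε1 : ε < 1) : ∃ w0 > 0, 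
    ∀ {k : ℕ → ℕ} (_ : Tendsto k atTop atTop) {l : ℕ → ℕ → ℝ≥0} {α0 α β : ℝ}
    (_ : 0 < α0) (_ : α0 < α) (_ : α ≤ β) (_ : β ≤ 1) (_ : β - α ≤ w0) (_ : Close k l α0 β) (ε' : ℝ) (_ : 0 < ε'),
    ∀ᶠ n in atTop, ENNReal.ofReal ((1 - ε) * (Real.exp (-x) * (β - α)) - ε') ≤
      IP (l n) (Fb (l n) (J α0 (k n)) (J α (k n)) (J β (k n)) (Uu (k n) x)) := by
  obtain ⟨δ, hδ, u0, hu0, hW⟩ := windowL ε hε hε1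
  set sp := Real.sqrt (2 * Real.pi) with hsp
  have hsp0 : 0 < sp := Real.sqrt_pos.2 (by positivity)
  refine ⟨δ / (sp * Real.exp (-x)), by positivity, ?_⟩
  intro k hk l α0 α β h0 h1 h2 h3 hw hc ε' hε'
  obtain ⟨η, hη0, hηa, hB⟩ := block_basic hk h0 h1 h2 hc
  have hlim := (tendsto_phw hk x (β - α) (-5)).const_mul (1 - ε)
  have hlim2 := (tendsto_phw hk x (β - α) 3).const_mul (1 / 2 * sp)
  have hlt2 : 1 / 2 * sp * (Real.exp (-x) * (β - α)) < δ := by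
    have h5 : (sp * Real.exp (-x)) * (β - α) ≤ (sp * Real.exp (-x)) * (δ / (sp * Real.exp (-x))) :=
      mul_le_mul_of_nonneg_left hw (by positivity)
    rw [mul_div_cancel₀ _ (by positivity)] at h5
    linarith
  have hlt1 : (1 - ε) * (Real.exp (-x) * (β - α)) - ε' < (1 - ε) * (Real.exp (-x) * (β - α)) := by linarith
  filter_upwards [hB, hlim.eventually (lt_mem_nhds hlt1), hlim2.eventually (gt_mem_nhds hlt2), 
    hk.eventually ((tendsto_Uu x).eventually_ge_atTop u0),
    hk.eventually (eventually_ge_atTop 2), hk.eventually (Uu_pow x 8 2 (by norm_num)),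
    hk.eventually (Uu_pow x 2 ((32 / δ) ^ 2) (by positivity)),
    hk.eventually (J_large α (h0.trans h1) 1 1), hk.eventually (J_large α (h0.trans h1) 1 3),
    hηa.eventually (gt_mem_nhds (show 0 < δ / 128 by positivity)), hk.eventually (Uu_bounds x),
    (tendsto_natCast_atTop_atTop.comp hk).eventually_ge_atTop (2 / δ),
    hk.eventually (tendsto_logK.eventually_ge_atTop 1)] with n hb hl hl2 hu hK hp hp2 hJ hJ3 hη hub hKδ hlog
  obtain ⟨-, b1, b2, b3, b4, b5, b6, b7⟩ := hb
  simp only [one_mul, pow_one] at hJ hJ3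
  rw [IP_Fb]
  have c1 := b7 _ le_rfl b3
  have c2 := b7 _ b3 le_rfl
  have eL : ∀ i, Lam (fun i => l n (J α0 (k n) + i)) i =
      Lam (l n) (J α0 (k n) + i) - Lam (l n) (J α0 (k n)) := fun i => Lam_shift _ _ _
  have e1 : Lam (fun i => l n (J α0 (k n) + i)) (J α (k n) - J α0 (k n)) =
      Lam (l n) (J α (k n)) - Lam (l n) (J α0 (k n)) := by
    rw [Lam_shift, Nat.add_sub_of_le b2.le]
  have e2 : Lam (fun i => l n (J α0 (k n) + i)) (J β (k n) - J α0 (k n)) =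
      Lam (l n) (J β (k n)) - Lam (l n) (J α0 (k n)) := by
    rw [Lam_shift, Nat.add_sub_of_le (b2.le.trans b3)]
  set U := Uu (k n) x with hU
  have hU0 : 0 < U := by linarith
  have hr := log_ratio_bounds hK (h0.trans h1).le ((h0.trans h1).le.trans h2) c1.1 c1.2 c2.1 c2.2
  have hpos : 0 < ph U := ph_pos (by linarith)
  -- sqrt facts
  have hsq : ∀ j : ℕ, J α (k n) ≤ j → 32 * U * Real.log (k n) ≤ δ * Real.sqrt j := by
    intro j hj
    have hj' : (J α (k n) : ℝ) ≤ j := by exact_mod_cast hj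
    have h5 : 32 / δ * U * Real.log (k n) ≤ Real.sqrt j := by
      apply Real.le_sqrt_of_sq_le
      calc (32 / δ * U * Real.log (k n)) ^ 2 = ((32 / δ) ^ 2 * U ^ 2) * Real.log (k n) ^ 2 := by ring
        _ ≤ Real.log (k n) * Real.log (k n) ^ 2 := mul_le_mul_of_nonneg_right hp2 (by positivity)
        _ = Real.log (k n) ^ 3 := by ring
        _ ≤ j := by linarith
    calc 32 * U * Real.log (k n) = δ * (32 / δ * U * Real.log (k n)) := by field_simp
      _ ≤ _ := mul_le_mul_of_nonneg_left h5 hδ.le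
  have hsq2 : ∀ j : ℕ, Real.sqrt j / 2 ≤ Real.sqrt ((j:ℝ) / 2) := by
    intro j
    apply Real.le_sqrt_of_sq_le
    rw [div_pow, Real.sq_sqrt (Nat.cast_nonneg _)]
    have : (0:ℝ) ≤ j := Nat.cast_nonneg _
    linarith
  refine le_trans ?_ (hW _ hu (fun i => l n (J α0 (k n) + i)) _ _ (Nat.sub_le_sub_right b3 _) ?_ ?_ ?_ ?_)
  · rw [e1, e2]
    refine ENNReal.ofReal_le_ofReal (hl.le.trans ?_)
    refine mul_le_mul_of_nonneg_left ?_ (by linarith)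
    have := mul_le_mul_of_nonneg_left (show (β - α) * Real.log (k n) + (-5) ≤ Real.log ((Lam (l n) (J β (k n)) - Lam (l n) (J α0 (k n))) /
      (Lam (l n) (J α (k n)) - Lam (l n) (J α0 (k n)))) - 2 by linarith [hr.2]) hpos.le
    linarith
  · rw [e1]; linarith [c1.1]
  · intro i hi
    obtain ⟨hi1, hi2⟩ := Finset.mem_Ico.1 hi
    rw [eL, ← add_assoc]
    have d1 := b7 (J α0 (k n) + i + 1) (by omega) (by omega)
    have d2 := abs_le.1 (b6 (J α0 (k n) + i + 1) (by omega) (by omega))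
    have d3 := abs_le.1 (b6 (J α0 (k n) + i) (by omega) (by omega))
    have d4 : Real.sqrt ((J α0 (k n) + i : ℕ):ℝ) ≤ Real.sqrt ((J α0 (k n) + i + 1 : ℕ):ℝ) :=
      Real.sqrt_le_sqrt (by push_cast; linarith)
    have d5 := mul_le_mul_of_nonneg_left d4 (hη0 n)
    have d6 : Lam (l n) (J α0 (k n) + i + 1) = Lam (l n) (J α0 (k n) + i) + l n (J α0 (k n) + i) := Lam_succ _ _
    have d7 := (hsq2 (J α0 (k n) + i + 1)).trans (Real.sqrt_le_sqrt d1.1)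
    have d8 := hsq (J α0 (k n) + i + 1) (by omega)
    have d9 : U * (η n) ≤ δ / 64 := by
      have := mul_le_mul_of_nonneg_right hub.2 (hη0 n)
      linarith
    rw [le_div_iff₀ hU0]
    have d10 := mul_le_mul_of_nonneg_left d7 hδ.le
    have d11 : 32 * U ≤ 32 * U * Real.log (k n) := le_mul_of_one_le_right (by linarith) hlog
    have d12 : ((J α0 (k n) + i + 1 : ℕ):ℝ) = ((J α0 (k n) + i : ℕ):ℝ) + 1 := by push_cast; ring
    have d13 : (l n (J α0 (k n) + i) : ℝ) ≤ 1 + 2 * (η n * Real.sqrt ((J α0 (k n) + i + 1 : ℕ):ℝ)) := by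
      linarith [d2.2, d3.1]
    have d14 := mul_le_mul_of_nonneg_right d9 (Real.sqrt_nonneg ((J α0 (k n) + i + 1 : ℕ):ℝ))
    have d15 := mul_le_mul_of_nonneg_right d13 hU0.le
    linarith
  · have hb : ∀ i ∈ Finset.Ico (J α (k n) - J α0 (k n)) (J β (k n) - J α0 (k n)),
        Real.exp (-(δ * Real.sqrt (Lam (fun i => l n (J α0 (k n) + i)) (i + 1)) / U / 2)) ≤ 1 / (k n : ℝ) ^ 2 := by
      intro i hi
      obtain ⟨hi1, hi2⟩ := Finset.mem_Ico.1 hi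
      rw [eL, ← add_assoc]
      have d1 := b7 (J α0 (k n) + i + 1) (by omega) (by omega)
      have d7 := (hsq2 (J α0 (k n) + i + 1)).trans (Real.sqrt_le_sqrt d1.1)
      have d8 := hsq (J α0 (k n) + i + 1) (by omega)
      have d10 := mul_le_mul_of_nonneg_left d7 hδ.le
      have hKp : (0:ℝ) < k n := by positivity
      have e3 : 1 / (k n : ℝ) ^ 2 = Real.exp (-(2 * Real.log (k n))) := by
        rw [Real.exp_neg, two_mul, Real.exp_add, Real.exp_log hKp, one_div, pow_two]
      rw [e3]
      apply Real.exp_le_exp.2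
      apply neg_le_neg
      rw [le_div_iff₀ (by norm_num), le_div_iff₀ hU0]
      have : 0 ≤ U * Real.log (k n) := by positivity
      linarith
    refine (Finset.sum_le_card_nsmul _ _ _ hb).trans ?_
    rw [Nat.card_Ico, nsmul_eq_mul]
    have hKp : (0:ℝ) < k n := by positivity
    have hK1 : (1:ℝ) ≤ k n := by exact_mod_cast (by omega : 1 ≤ k n)
    have f1 : ((J β (k n) - J α0 (k n) - (J α (k n) - J α0 (k n)) : ℕ) : ℝ) ≤ 2 * k n := by
      have f2 : ((J β (k n) - J α0 (k n) - (J α (k n) - J α0 (k n)) : ℕ) : ℝ) ≤ J β (k n) := by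
        exact_mod_cast (by omega)
      have f3 := J_upper2 β (by linarith) (k n) (by omega)
      have f4 : (k n : ℝ) ^ β ≤ (k n : ℝ) ^ (1:ℝ) := Real.rpow_le_rpow_of_exponent_le hK1 h3
      rw [Real.rpow_one] at f4
      linarith
    refine (mul_le_mul_of_nonneg_right f1 (by positivity)).trans ?_
    simp only [Function.comp] at hKδ
    rw [div_le_iff₀ hδ] at hKδ
    rw [mul_one_div, div_le_iff₀ (by positivity)]
    have := mul_le_mul_of_nonneg_right hKδ hKp.le
    linarith
  · rw [e1, e2]
    have hphe : ph U * (Real.exp (U ^ 2 / 2) / U) * sp = 1 := by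
      unfold ph
      rw [Real.exp_neg]
      rw [← hsp]
      field_simp
    have hE : 0 < Real.exp (U ^ 2 / 2) / U := by positivity
    have g1 := mul_le_mul_of_nonneg_right hl2.le hE.le
    have g2 : 1 / 2 * sp * (ph U * ((β - α) * Real.log (k n) + 3)) * (Real.exp (U ^ 2 / 2) / U) =
      1 / 2 * ((β - α) * Real.log (k n) + 3) := by
      linear_combination (1 / 2 * ((β - α) * Real.log (k n) + 3)) * hphe
    linarith [hr.1]

end HC

namespace HC
open MeasureTheory Filter Topology ProbabilityTheory
open scoped ENNReal NNReal

/-- admissible families of blocks -/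
def Blk (N : ℕ) (α0 α β : ℕ → ℝ) : Prop :=
  (∀ b < N, 0 < α0 b ∧ α0 b < α b ∧ α b ≤ β b ∧ β b ≤ 1) ∧ ∀ b c, b < c → c < N → β b ≤ α0 c

/-- one side of a two sided array -/
def sd {α : Type*} (σ : Bool) (ω : Bool × ℕ → α) : ℕ → α := fun i => ω (σ, i)

/-- all blocks are fine -/
def Ebl (K N : ℕ) (α β : ℕ → ℝ) (V : ℝ) : Set (Bool × ℕ → ℕ) :=
  {ω | ∀ σ, ∀ b < N, ∀ j : ℕ, J (α b) K ≤ j → j ≤ J (β b) K → |S (sd σ ω) j - j| ≤ V * Real.sqrt j}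

lemma J_mono {f g : ℝ} {K : ℕ} (hK : 1 ≤ K) (h : f ≤ g) : J f K ≤ J g K :=
  Nat.ceil_mono (Real.rpow_le_rpow_of_exponent_le (by exact_mod_cast hK) h)

lemma dep_Ebl (K N : ℕ) (α β : ℕ → ℝ) (V : ℝ) (M : ℕ) (hM : ∀ b < N, J (β b) K ≤ M) :
    DepOn ((Finset.univ : Finset Bool) ×ˢ Finset.range M) (Ebl K N α β V) := by
  intro ω ω' h hω σ b hb j hj hj'
  have := hω σ b hb j hj hj'
  rwa [S_congr (ω := sd σ ω) (ω' := sd σ ω')] at this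
  intro i hi
  have h1 := hM b hb
  have h2 := Finset.mem_range.1 hi
  exact h _ (by simp; omega)

lemma dep_sd {I : Finset ℕ} {A : Set (ℕ → ℕ)} (hA : DepOn I A) (σ : Bool) :
    DepOn (I.image (fun i => (σ, i))) {ω : Bool × ℕ → ℕ | sd σ ω ∈ A} := by
  intro ω ω' h hω
  exact hA _ _ (fun i hi => h _ (Finset.mem_image_of_mem _ hi)) hω

lemma IP_sd (l : Bool × ℕ → ℝ≥0) (σ : Bool) {A : Set (ℕ → ℕ)} (hA : MeasurableSet A) :
    IP l {ω | sd σ ω ∈ A} = IP (sd σ l) A :=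
  IP_reindex l (fun i => (σ, i)) (fun a b h => by simpa using h) hA

/-- no block exceedance -/
def NoF (K N : ℕ) (l : Bool × ℕ → ℝ≥0) (α0 α β : ℕ → ℝ) (V : ℝ) : Set (Bool × ℕ → ℕ) :=
  {ω | ∀ σ, ∀ b < N, sd σ ω ∉ Fb (sd σ l) (J (α0 b) K) (J (α b) K) (J (β b) K) V}

lemma prodF {K N : ℕ} (hK : 1 ≤ K) (l : Bool × ℕ → ℝ≥0) {α0 α β : ℕ → ℝ} (hB : Blk N α0 α β) (V : ℝ) :
    (IP l).real (NoF K N l α0 α β V) = ∏ p ∈ (Finset.univ : Finset Bool) ×ˢ Finset.range N,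
      (1 - (IP (sd p.1 l)).real (Fb (sd p.1 l) (J (α0 p.2) K) (J (α p.2) K) (J (β p.2) K) V)) := by
  have e : NoF K N l α0 α β V = ⋂ p ∈ (Finset.univ : Finset Bool) ×ˢ Finset.range N,
      {ω | sd p.1 ω ∈ (Fb (sd p.1 l) (J (α0 p.2) K) (J (α p.2) K) (J (β p.2) K) V)ᶜ} := by
    ext ω; simp [NoF]
  rw [e, Measure.real, IP_prod l _ (fun p _ => dep_sd (dep_Fb _ _ _ _ _).compl p.1), ENNReal.toReal_prod]
  · refine Finset.prod_congr rfl fun p _ => ?_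
    rw [IP_sd _ _ (dep_Fb _ _ _ _ _).compl.meas, ← Measure.real,
      probReal_compl_eq_one_sub (dep_Fb _ _ _ _ _).meas]
  · rintro ⟨σ, b⟩ hb ⟨τ, c⟩ hc hne
    simp only [Finset.mem_product, Finset.mem_univ, Finset.mem_range, true_and] at hb hc
    rw [Finset.disjoint_left]
    intro q h1 h2
    simp only [Finset.mem_image, Finset.mem_Ico] at h1 h2
    obtain ⟨i, hi, rfl⟩ := h1
    obtain ⟨i', hi', h3⟩ := h2
    obtain ⟨rfl, rfl⟩ := Prod.mk.inj h3
    rcases lt_trichotomy b c with h | h | h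
    · have := J_mono hK (hB.2 b c h hc); omega
    · exact hne (by rw [h])
    · have := J_mono hK (hB.2 c b h hb); omega

/-- noise is not small -/
def Nz (K N : ℕ) (l : Bool × ℕ → ℝ≥0) (α0 α : ℕ → ℝ) (δ : ℝ) : Set (Bool × ℕ → ℕ) :=
  {ω | ∃ σ, ∃ b < N, ¬ (|S (sd σ ω) (J (α0 b) K) - Lam (sd σ l) (J (α0 b) K)| ≤
      δ / aHC K / 8 * Real.sqrt (J (α b) K))}

lemma Nz_small {k : ℕ → ℕ} (hk : Tendsto k atTop atTop) {l : ℕ → Bool × ℕ → ℝ≥0} {N : ℕ} {α0 α β : ℕ → ℝ}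
    (hB : Blk N α0 α β) (hc : ∀ σ, ∀ b < N, Close k (fun n => sd σ (l n)) (α0 b) (β b))
    (δ ρ : ℝ) (hδ : 0 < δ) (hρ : 0 < ρ) :
    ∀ᶠ n in atTop, (IP (l n)).real (Nz (k n) N (l n) α0 α δ) ≤ ρ := by
  set P := (Finset.univ : Finset Bool) ×ˢ Finset.range N
  have h : ∀ᶠ n in atTop, ∀ p ∈ P, IP (sd p.1 (l n)) {ω | ¬ (|S ω (J (α0 p.2) (k n)) - Lam (sd p.1 (l n)) (J (α0 p.2) (k n))| ≤
      δ / aHC (k n) / 8 * Real.sqrt (J (α p.2) (k n)))} ≤ ENNReal.ofReal (ρ / (P.card + 1)) := by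
    rw [Filter.eventually_all_finset]
    rintro ⟨σ, b⟩ hb
    have hb' : b < N := by simpa [P] using hb
    obtain ⟨q1, q2, q3, q4⟩ := hB.1 b hb'
    exact block_noise hk q1 q2 q3 (hc σ b hb') δ _ hδ (by positivity)
  filter_upwards [h] with n hn
  have e : Nz (k n) N (l n) α0 α δ = ⋃ p ∈ P, {ω | sd p.1 ω ∈ {ω : ℕ → ℕ | ¬ (|S ω (J (α0 p.2) (k n)) - Lam (sd p.1 (l n)) (J (α0 p.2) (k n))| ≤
      δ / aHC (k n) / 8 * Real.sqrt (J (α p.2) (k n)))}} := by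
    ext ω; simp [Nz, P]
  rw [e]
  refine (measureReal_biUnion_finset_le _ _).trans ?_
  have hle : ∀ p ∈ P, (IP (l n)).real {ω | sd p.1 ω ∈ {ω : ℕ → ℕ | ¬ (|S ω (J (α0 p.2) (k n)) - Lam (sd p.1 (l n)) (J (α0 p.2) (k n))| ≤
      δ / aHC (k n) / 8 * Real.sqrt (J (α p.2) (k n)))}} ≤ ρ / (P.card + 1) := by
    intro p hp
    rw [Measure.real, IP_sd _ _ (depS _ (fun s => ¬ (|s - Lam (sd p.1 (l n)) (J (α0 p.2) (k n))| ≤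
      δ / aHC (k n) / 8 * Real.sqrt (J (α p.2) (k n))))).meas]
    exact ENNReal.toReal_le_of_le_ofReal (by positivity) (hn p hp)
  refine (Finset.sum_le_card_nsmul _ _ _ hle).trans ?_
  rw [nsmul_eq_mul, ← mul_div_assoc, div_le_iff₀ (by positivity)]
  nlinarith

lemma Ebl_set {k : ℕ → ℕ} (hk : Tendsto k atTop atTop) {l : ℕ → Bool × ℕ → ℝ≥0} {N : ℕ} {α0 α β : ℕ → ℝ}
    (hB : Blk N α0 α β) (hc : ∀ σ, ∀ b < N, Close k (fun n => sd σ (l n)) (α0 b) (β b))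
    (x δ : ℝ) (hδ : 0 < δ) :
    ∀ᶠ n in atTop, Ebl (k n) N α β (Uu (k n) (x - δ)) ⊆ NoF (k n) N (l n) α0 α β (Uu (k n) x) ∪ Nz (k n) N (l n) α0 α δ ∧
      NoF (k n) N (l n) α0 α β (Uu (k n) x) ⊆ Ebl (k n) N α β (Uu (k n) (x + δ)) ∪ Nz (k n) N (l n) α0 α δ := by
  set P := (Finset.univ : Finset Bool) ×ˢ Finset.range N
  have h := (Filter.eventually_all_finset (l := atTop (α := ℕ)) P (p := fun p n => ∀ ω : ℕ → ℕ,
    |S ω (J (α0 p.2) (k n)) - Lam (sd p.1 (l n)) (J (α0 p.2) (k n))| ≤ δ / aHC (k n) / 8 * Real.sqrt (J (α p.2) (k n)) →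
    (ω ∉ Fb (sd p.1 (l n)) (J (α0 p.2) (k n)) (J (α p.2) (k n)) (J (β p.2) (k n)) (Uu (k n) x) →
      ∀ j : ℕ, J (α p.2) (k n) ≤ j → j ≤ J (β p.2) (k n) → |S ω j - j| ≤ (Uu (k n) x + δ / aHC (k n)) * Real.sqrt j) ∧
    ((∀ j : ℕ, J (α p.2) (k n) ≤ j → j ≤ J (β p.2) (k n) → |S ω j - j| ≤ (Uu (k n) x - δ / aHC (k n)) * Real.sqrt j) →
      ω ∉ Fb (sd p.1 (l n)) (J (α0 p.2) (k n)) (J (α p.2) (k n)) (J (β p.2) (k n)) (Uu (k n) x)))).2 ?_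
  · filter_upwards [h, hk.eventually Uu_add] with n hn hU
    have e1 := hU x (-δ)
    have e2 := hU x δ
    rw [← sub_eq_add_neg, neg_div, ← sub_eq_add_neg] at e1
    rw [e1, e2]
    constructor
    · intro ω hω
      by_cases hN : ω ∈ Nz (k n) N (l n) α0 α δ
      · exact Or.inr hN
      left
      intro σ b hb
      have hN' : |S (sd σ ω) (J (α0 b) (k n)) - Lam (sd σ (l n)) (J (α0 b) (k n))| ≤
        δ / aHC (k n) / 8 * Real.sqrt (J (α b) (k n)) := by
        by_contra hh; exact hN ⟨σ, b, hb, hh⟩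
      exact (hn (σ, b) (by simp [P, hb]) (sd σ ω) hN').2 (hω σ b hb)
    · intro ω hω
      by_cases hN : ω ∈ Nz (k n) N (l n) α0 α δ
      · exact Or.inr hN
      left
      intro σ b hb
      have hN' : |S (sd σ ω) (J (α0 b) (k n)) - Lam (sd σ (l n)) (J (α0 b) (k n))| ≤
        δ / aHC (k n) / 8 * Real.sqrt (J (α b) (k n)) := by
        by_contra hh; exact hN ⟨σ, b, hb, hh⟩
      exact (hn (σ, b) (by simp [P, hb]) (sd σ ω) hN').1 (hω σ b hb)
  · rintro ⟨σ, b⟩ hb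
    have hb' : b < N := by simpa [P] using hb
    obtain ⟨q1, q2, q3, q4⟩ := hB.1 b hb'
    exact block_set hk q1 q2 q3 (hc σ b hb') x δ hδ

lemma exp_slack {a d : ℝ} (ha : 0 ≤ a) (hd : 0 ≤ d) : Real.exp (-a) - d ≤ Real.exp (-(a + d)) := by
  have h1 : Real.exp (-a) ≤ 1 := Real.exp_le_one_iff.2 (by linarith)
  have h2 := Real.add_one_le_exp (-d)
  rw [neg_add, Real.exp_add]
  have h3 := mul_le_mul_of_nonneg_left h2 (Real.exp_pos (-a)).le
  have h4 := mul_le_mul_of_nonneg_right h1 hd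
  linarith

lemma one_sub_ge {p e : ℝ} (hp : 0 ≤ p) (hpe : p ≤ e) (he : e < 1) : Real.exp (-(p / (1 - e))) ≤ 1 - p := by
  have h1 : 0 < 1 - p := by linarith
  have h2 : Real.exp (-(p / (1 - e))) ≤ Real.exp (-(p / (1 - p))) := by
    apply Real.exp_le_exp.2; apply neg_le_neg; gcongr
  refine h2.trans ?_
  rw [Real.exp_neg]
  have h3 := Real.add_one_le_exp (p / (1 - p))
  have h4 : p / (1 - p) + 1 = (1 - p)⁻¹ := by field_simp; ring
  rw [h4] at h3
  have := inv_anti₀ (by positivity) h3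
  rwa [inv_inv] at this

lemma core_upper (x δ ε : ℝ) (hδ : 0 < δ) (hε : 0 < ε) (hε1 : ε < 1) : ∃ w0 > 0,
    ∀ {k : ℕ → ℕ} (_ : Tendsto k atTop atTop) {l : ℕ → Bool × ℕ → ℝ≥0} {N : ℕ} {α0 α β : ℕ → ℝ}
    (_ : Blk N α0 α β) (_ : ∀ σ, ∀ b < N, Close k (fun n => sd σ (l n)) (α0 b) (β b))
    (_ : ∀ b < N, β b - α b ≤ w0) (ρ : ℝ) (_ : 0 < ρ),
    ∀ᶠ n in atTop, (IP (l n)).real (Ebl (k n) N α β (Uu (k n) x)) ≤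
      Real.exp (-(2 * ((1 - ε) * (Real.exp (-(x + δ)) * ∑ b ∈ Finset.range N, (β b - α b))))) + ρ := by
  obtain ⟨w0, hw0, hL⟩ := block_lower (x + δ) ε hε hε1
  refine ⟨w0, hw0, ?_⟩
  intro k hk l N α0 α β hB hc hw ρ hρ
  set P := (Finset.univ : Finset Bool) ×ˢ Finset.range N with hP
  set Tt := 2 * ((1 - ε) * (Real.exp (-(x + δ)) * ∑ b ∈ Finset.range N, (β b - α b))) with hT
  have hcont : ∃ ε' > 0, Real.exp (-Tt + P.card * ε') ≤ Real.exp (-Tt) + ρ / 2 := by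
    have hc : Tendsto (fun e : ℝ => Real.exp (-Tt + P.card * e)) (𝓝[>] 0) (𝓝 (Real.exp (-Tt + P.card * 0))) := by
      apply Tendsto.mono_left _ nhdsWithin_le_nhds
      exact (by fun_prop : Continuous (fun e : ℝ => Real.exp (-Tt + P.card * e))).tendsto 0
    rw [mul_zero, add_zero] at hc
    have := (hc.eventually (ge_mem_nhds (show Real.exp (-Tt) < Real.exp (-Tt) + ρ / 2 by linarith))).and self_mem_nhdsWithin
    obtain ⟨e, h1, h2⟩ := this.exists
    exact ⟨e, h2, h1⟩
  obtain ⟨ε', hε', hexp⟩ := hcont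
  have h : ∀ᶠ n in atTop, ∀ p ∈ P, ENNReal.ofReal ((1 - ε) * (Real.exp (-(x + δ)) * (β p.2 - α p.2)) - ε') ≤
      IP (sd p.1 (l n)) (Fb (sd p.1 (l n)) (J (α0 p.2) (k n)) (J (α p.2) (k n)) (J (β p.2) (k n)) (Uu (k n) (x + δ))) := by
    rw [Filter.eventually_all_finset]
    rintro ⟨σ, b⟩ hb
    have hb' : b < N := by simpa [P] using hb
    obtain ⟨q1, q2, q3, q4⟩ := hB.1 b hb'
    exact hL hk q1 q2 q3 q4 (hw b hb') (hc σ b hb') ε' hε'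
  filter_upwards [h, Ebl_set hk hB hc (x + δ) δ hδ, Nz_small hk hB hc δ (ρ / 2) hδ (by positivity),
    hk.eventually (eventually_ge_atTop 1)] with n hn hs hz hK
  rw [add_sub_cancel_right] at hs
  refine (measureReal_mono hs.1).trans ((measureReal_union_le _ _).trans ?_)
  have h2 : (IP (l n)).real (NoF (k n) N (l n) α0 α β (Uu (k n) (x + δ))) ≤ Real.exp (-Tt + P.card * ε') := by
    rw [prodF hK _ hB]
    calc _ ≤ ∏ p ∈ P, Real.exp (-((1 - ε) * (Real.exp (-(x + δ)) * (β p.2 - α p.2))) + ε') := by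
          refine Finset.prod_le_prod (fun p hp => ?_) (fun p hp => ?_)
          · linarith [measureReal_le_one (μ := IP (sd p.1 (l n))) (s := Fb (sd p.1 (l n)) (J (α0 p.2) (k n)) (J (α p.2) (k n)) (J (β p.2) (k n)) (Uu (k n) (x + δ)))]
          · have h3 := (ENNReal.ofReal_le_iff_le_toReal (measure_ne_top _ _)).1 (hn p hp)
            rw [← Measure.real] at h3
            have h4 := Real.add_one_le_exp (-((1 - ε) * (Real.exp (-(x + δ)) * (β p.2 - α p.2))) + ε')
            linarith
      _ = Real.exp (-Tt + P.card * ε') := by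
          rw [← Real.exp_sum, Finset.sum_add_distrib, Finset.sum_const, nsmul_eq_mul, Finset.sum_neg_distrib]
          congr 3
          rw [hP, Finset.sum_product]
          simp only [Finset.sum_const, Finset.card_univ, Fintype.card_bool, nsmul_eq_mul, ← Finset.mul_sum]
          rw [hT]; norm_num
  linarith

lemma core_lower (x δ ε : ℝ) (hδ : 0 < δ) (hε : 0 < ε) (hε1 : ε < 1)
    {k : ℕ → ℕ} (hk : Tendsto k atTop atTop) {l : ℕ → Bool × ℕ → ℝ≥0} {N : ℕ} {α0 α β : ℕ → ℝ}
    (hB : Blk N α0 α β) (hc : ∀ σ, ∀ b < N, Close k (fun n => sd σ (l n)) (α0 b) (β b))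
    (hw : ∀ b < N, Real.exp (-(x - δ)) * (β b - α b) < ε) (hW : ∑ b ∈ Finset.range N, (β b - α b) ≤ 1)
    (ρ : ℝ) (hρ : 0 < ρ) :
    ∀ᶠ n in atTop, Real.exp (-(2 * Real.exp (-(x - δ)) / (1 - ε))) - ρ ≤
      (IP (l n)).real (Ebl (k n) N α β (Uu (k n) x)) := by
  set P := (Finset.univ : Finset Bool) ×ˢ Finset.range N with hP
  have h1e : 0 < 1 - ε := by linarith
  obtain ⟨ε', hε', hε1', hε2'⟩ : ∃ ε' > 0, P.card * ε' / (1 - ε) ≤ ρ / 2 ∧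
      ∀ b < N, Real.exp (-(x - δ)) * (β b - α b) + ε' ≤ ε := by
    have h1 : ∀ᶠ e : ℝ in 𝓝[>] 0, P.card * e / (1 - ε) ≤ ρ / 2 := by
      have : Tendsto (fun e : ℝ => P.card * e / (1 - ε)) (𝓝[>] 0) (𝓝 (P.card * 0 / (1 - ε))) :=
        Tendsto.mono_left ((by fun_prop : Continuous (fun e : ℝ => P.card * e / (1 - ε))).tendsto 0) nhdsWithin_le_nhds
      rw [mul_zero, zero_div] at this
      exact this.eventually (ge_mem_nhds (by positivity))
    have h2 : ∀ᶠ e : ℝ in 𝓝[>] 0, ∀ b ∈ Finset.range N, Real.exp (-(x - δ)) * (β b - α b) + e ≤ ε := by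
      rw [Filter.eventually_all_finset]
      intro b hb
      have : Tendsto (fun e : ℝ => Real.exp (-(x - δ)) * (β b - α b) + e) (𝓝[>] 0) (𝓝 (Real.exp (-(x - δ)) * (β b - α b) + 0)) :=
        Tendsto.mono_left ((by fun_prop : Continuous (fun e : ℝ => Real.exp (-(x - δ)) * (β b - α b) + e)).tendsto 0) nhdsWithin_le_nhds
      rw [add_zero] at this
      exact this.eventually (ge_mem_nhds (hw b (Finset.mem_range.1 hb)))
    obtain ⟨e, ⟨q1, q2⟩, q3⟩ := ((h1.and h2).and self_mem_nhdsWithin).exists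
    exact ⟨e, q3, q1, fun b hb => q2 b (Finset.mem_range.2 hb)⟩
  have h : ∀ᶠ n in atTop, ∀ p ∈ P, 
      IP (sd p.1 (l n)) (Fb (sd p.1 (l n)) (J (α0 p.2) (k n)) (J (α p.2) (k n)) (J (β p.2) (k n)) (Uu (k n) (x - δ))) ≤
      ENNReal.ofReal (Real.exp (-(x - δ)) * (β p.2 - α p.2) + ε') := by
    rw [Filter.eventually_all_finset]
    rintro ⟨σ, b⟩ hb
    have hb' : b < N := by simpa [P] using hb
    obtain ⟨q1, q2, q3, q4⟩ := hB.1 b hb'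
    exact block_upper hk q1 q2 q3 (hc σ b hb') _ ε' hε'
  filter_upwards [h, Ebl_set hk hB hc (x - δ) δ hδ, Nz_small hk hB hc δ (ρ / 2) hδ (by positivity),
    hk.eventually (eventually_ge_atTop 1)] with n hn hs hz hK
  rw [sub_add_cancel] at hs
  have h0 := (measureReal_mono hs.2 (μ := IP (l n))).trans (measureReal_union_le _ _)
  have h2 : Real.exp (-(2 * Real.exp (-(x - δ)) / (1 - ε) + P.card * ε' / (1 - ε))) ≤ 
      (IP (l n)).real (NoF (k n) N (l n) α0 α β (Uu (k n) (x - δ))) := by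
    rw [prodF hK _ hB]
    calc _ ≤ ∏ p ∈ P, Real.exp (-((Real.exp (-(x - δ)) * (β p.2 - α p.2) + ε') / (1 - ε))) := by
          rw [← Real.exp_sum, Finset.sum_neg_distrib, ← Finset.sum_div, ← add_div]
          apply Real.exp_le_exp.2; apply neg_le_neg
          gcongr
          rw [Finset.sum_add_distrib, Finset.sum_const, nsmul_eq_mul]
          gcongr
          rw [hP, Finset.sum_product]
          simp only [Finset.sum_const, Finset.card_univ, Fintype.card_bool, nsmul_eq_mul, ← Finset.mul_sum]
          push_cast
          refine mul_le_mul_of_nonneg_left ?_ (by norm_num)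
          exact mul_le_of_le_one_right (Real.exp_pos _).le hW
      _ ≤ _ := by
          refine Finset.prod_le_prod (fun p hp => (Real.exp_pos _).le) (fun p hp => ?_)
          have hb' : p.2 < N := by
            have := (Finset.mem_product.1 hp).2
            exact Finset.mem_range.1 this
          have hpos : 0 ≤ Real.exp (-(x - δ)) * (β p.2 - α p.2) + ε' := by
            have := hB.1 _ hb'
            have := mul_nonneg (Real.exp_pos (-(x - δ))).le (show 0 ≤ β p.2 - α p.2 by linarith)
            linarith
          refine (one_sub_ge hpos (hε2' _ hb') hε1).trans ?_
          have h3 := ENNReal.toReal_le_of_le_ofReal hpos (hn p hp)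
          rw [← Measure.real] at h3
          linarith
  have h3 := exp_slack (a := 2 * Real.exp (-(x - δ)) / (1 - ε)) (d := P.card * ε' / (1 - ε)) (by positivity) (by positivity)
  linarith

end HC

namespace HC
open MeasureTheory Filter Topology ProbabilityTheory
open scoped ENNReal NNReal

/-- cells -/
def cell (K : ℕ) (c : Bool × ℕ) : Set ℝ :=
  if c.1 then Set.Ioc (1 - ((c.2 : ℝ) + 1) / K) (1 - (c.2 : ℝ) / K)
  else Set.Ioc ((c.2 : ℝ) / K) (((c.2 : ℝ) + 1) / K)

/-- tail intervals -/
def Iv (σ : Bool) (s : ℝ) : Set ℝ := if σ then Set.Ioc (1 - s) 1 else Set.Ioc 0 s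

lemma meas_cell (K : ℕ) (c : Bool × ℕ) : MeasurableSet (cell K c) := by
  unfold cell; split_ifs <;> exact measurableSet_Ioc

lemma meas_Iv (σ : Bool) (s : ℝ) : MeasurableSet (Iv σ s) := by
  unfold Iv; split_ifs <;> exact measurableSet_Ioc

lemma Iv_zero (σ : Bool) : Iv σ 0 = ∅ := by
  unfold Iv; split_ifs <;> simp

lemma Iv_succ (K : ℕ) (hK : 1 ≤ K) (σ : Bool) (j : ℕ) :
    Iv σ (((j + 1 : ℕ) : ℝ) / K) = Iv σ ((j : ℝ) / K) ∪ cell K (σ, j) := by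
  have hK' : (0:ℝ) < K := by exact_mod_cast hK
  have h1 : (j:ℝ) / K ≤ ((j:ℝ) + 1) / K := by gcongr; linarith
  have h2 : 0 ≤ (j:ℝ) / K := by positivity
  unfold Iv cell
  cases σ
  · simp only [Bool.false_eq_true, if_false]
    rw [Set.Ioc_union_Ioc_eq_Ioc h2 h1]; push_cast; rfl
  · simp only [if_true]
    rw [Set.union_comm, Set.Ioc_union_Ioc_eq_Ioc (by linarith) (by linarith)]; push_cast; rfl

lemma Iv_disj (K : ℕ) (σ : Bool) (j : ℕ) :
    Disjoint (Iv σ ((j : ℝ) / K)) (cell K (σ, j)) := by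
  unfold Iv cell
  rw [Set.disjoint_left]
  cases σ
  · simp only [Bool.false_eq_true, if_false, Set.mem_Ioc]
    intro a h1 h2; linarith
  · simp only [if_true, Set.mem_Ioc]
    intro a h1 h2; linarith

lemma Iv_mono (σ : Bool) {s t : ℝ} (h : s ≤ t) : Iv σ s ⊆ Iv σ t := by
  unfold Iv; split_ifs
  · exact Set.Ioc_subset_Ioc_left (by linarith)
  · exact Set.Ioc_subset_Ioc_right h

lemma cell_sub (K : ℕ) (hK : 1 ≤ K) (σ : Bool) {i j : ℕ} (h : i < j) : cell K (σ, i) ⊆ Iv σ ((j:ℝ) / K) := by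
  have h1 : cell K (σ, i) ⊆ Iv σ (((i + 1 : ℕ) : ℝ) / K) := by
    rw [Iv_succ K hK]; exact Set.subset_union_right
  refine h1.trans (Iv_mono σ ?_)
  have : ((i + 1 : ℕ) : ℝ) ≤ j := by exact_mod_cast h
  gcongr

/-- number of points in the tail interval -/
noncomputable def Gc {K : ℕ} (σ : Bool) (y : Fin K → ℝ) (s : ℝ) : ℝ :=
  ∑ i, (Iv σ s).indicator (fun _ => (1:ℝ)) (y i)

lemma Gc_mono {K : ℕ} (σ : Bool) (y : Fin K → ℝ) {s t : ℝ} (h : s ≤ t) : Gc σ y s ≤ Gc σ y t := by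
  unfold Gc
  refine Finset.sum_le_sum fun i _ => ?_
  exact Set.indicator_le_indicator_of_subset (Iv_mono σ h) (fun _ => zero_le_one) _

lemma Gc_nonneg {K : ℕ} (σ : Bool) (y : Fin K → ℝ) (s : ℝ) : 0 ≤ Gc σ y s :=
  Finset.sum_nonneg fun i _ => Set.indicator_nonneg (fun _ _ => zero_le_one) _

lemma S_cnt {K : ℕ} (hK : 1 ≤ K) (σ : Bool) (y : Fin K → ℝ) (j : ℕ) :
    S (sd σ (cnt (cell K) y)) j = Gc σ y ((j:ℝ) / K) := by
  induction j with
  | zero => simp [S, Gc, Iv_zero]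
  | succ j ih =>
    rw [S_succ, ih]
    unfold Gc sd cnt
    rw [Iv_succ K hK]
    push_cast
    rw [← Finset.sum_add_distrib]
    refine Finset.sum_congr rfl fun i _ => ?_
    rw [Set.indicator_union_of_disjoint (Iv_disj K σ j)]
    congr 1
    by_cases h : y i ∈ cell K (σ, j) <;> simp [h]

/-- rates -/
noncomputable def rate (K : ℕ) (ν : Measure ℝ) (c : Bool × ℕ) : ℝ≥0 := Real.toNNReal (K * ν.real (cell K c))

lemma coe_rate (K : ℕ) (ν : Measure ℝ) (c : Bool × ℕ) : (rate K ν c : ℝ) = K * ν.real (cell K c) :=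
  Real.coe_toNNReal _ (by positivity)

lemma sum_cells {K : ℕ} (hK : 1 ≤ K) (ν : Measure ℝ) [IsFiniteMeasure ν] (σ : Bool) (j : ℕ) :
    ∑ i ∈ Finset.range j, ν.real (cell K (σ, i)) = ν.real (Iv σ ((j:ℝ) / K)) := by
  induction j with
  | zero => simp [Iv_zero]
  | succ j ih =>
    rw [Finset.sum_range_succ, ih, Iv_succ K hK, measureReal_union (Iv_disj K σ j) (meas_cell _ _)]

lemma Lam_rate {K : ℕ} (hK : 1 ≤ K) (ν : Measure ℝ) [IsFiniteMeasure ν] (σ : Bool) (j : ℕ) :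
    Lam (sd σ (rate K ν)) j = K * ν.real (Iv σ ((j:ℝ) / K)) := by
  unfold Lam sd
  simp only [coe_rate]
  rw [← Finset.mul_sum, sum_cells hK]

lemma cell_disj_same {K : ℕ} (hK : 1 ≤ K) (σ : Bool) {i j : ℕ} (h : i ≠ j) :
    Disjoint (cell K (σ, i)) (cell K (σ, j)) := by
  rcases lt_or_gt_of_ne h with h | h
  · exact (Iv_disj K σ j).mono_left (cell_sub K hK σ h)
  · exact ((Iv_disj K σ i).mono_left (cell_sub K hK σ h)).symm

lemma cell_disj {K M : ℕ} (hK : 1 ≤ K) (hM : 2 * M ≤ K) {c d : Bool × ℕ}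
    (hc : c.2 < M) (hd : d.2 < M) (h : c ≠ d) : Disjoint (cell K c) (cell K d) := by
  obtain ⟨σ, i⟩ := c
  obtain ⟨τ, j⟩ := d
  have hK' : (0:ℝ) < K := by exact_mod_cast hK
  have hm : (M:ℝ) / K ≤ 1 / 2 := by
    rw [div_le_iff₀ hK']
    have : (2 * M : ℝ) ≤ K := by exact_mod_cast hM
    linarith
  have hdd : Disjoint (Iv false ((M:ℝ) / K)) (Iv true ((M:ℝ) / K)) := by
    rw [Set.disjoint_left]; unfold Iv; simp only [Bool.false_eq_true, if_false, if_true, Set.mem_Ioc]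
    intro a h1 h2; linarith
  have s1 := cell_sub K hK σ hc
  have s2 := cell_sub K hK τ hd
  cases σ <;> cases τ
  · exact cell_disj_same hK _ (fun h' => h (by rw [show i = j from h']))
  · exact hdd.mono s1 s2
  · exact hdd.symm.mono s1 s2
  · exact cell_disj_same hK _ (fun h' => h (by rw [show i = j from h']))

lemma compare_gen (η p0 : ℝ) (hη : 0 < η) (hη1 : η < 1) (hp0 : 0 ≤ p0) (hlt : 1 + p0 < (2:ℝ) ^ η) (ρ : ℝ) (hρ : 0 < ρ) :
    ∀ᶠ K : ℕ in atTop, ∀ (ν : Measure ℝ) [IsProbabilityMeasure ν] (I : Finset (Bool × ℕ))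
      (_ : ∀ c ∈ I, ∀ d ∈ I, c ≠ d → Disjoint (cell K c) (cell K d))
      (_ : ∑ c ∈ I, ν.real (cell K c) ≤ p0) (A : Set (Bool × ℕ → ℕ)) (_ : DepOn I A),
      (Measure.pi (fun _ : Fin K => ν)).real {y | cnt (cell K) y ∈ A} ≤
        Real.sqrt (1 / (1 - η)) * (IP (rate K ν)).real A + ρ := by
  have h2 : (0:ℝ) < 2 ^ η := by positivity
  have hq : Tendsto (fun K : ℕ => 2 * ((1 + p0) / 2 ^ η) ^ K) atTop (𝓝 (2 * 0)) :=
    (tendsto_pow_atTop_nhds_zero_of_lt_one (by positivity) ((div_lt_one h2).2 hlt)).const_mul 2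
  rw [mul_zero] at hq
  filter_upwards [hq.eventually (ge_mem_nhds hρ), eventually_ge_atTop 1] with K hK1 hK ν _ I hd hp A hA
  have hK' : (0:ℝ) < K := by exact_mod_cast hK
  set M := ⌊η * K⌋₊ with hM
  have hMle : (M:ℝ) ≤ η * K := Nat.floor_le (by positivity)
  have hMge : η * K ≤ M + 1 := (Nat.lt_floor_add_one _).le
  have hMK : M < K := by
    have : (M:ℝ) < K := by nlinarith
    exact_mod_cast this
  have := compare ν (cell K) I (fun c _ => meas_cell K c) hd K M hMK (rate K ν) (fun c _ => coe_rate K ν c) p0 hp A hA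
  have hfin : ENNReal.ofReal (Real.sqrt (K / (K - M))) * IP (rate K ν) A + ENNReal.ofReal ((1 + p0) ^ K / 2 ^ M) ≠ ⊤ :=
    ENNReal.add_ne_top.2 ⟨ENNReal.mul_ne_top ENNReal.ofReal_ne_top (measure_ne_top _ _), ENNReal.ofReal_ne_top⟩
  have h3 := ENNReal.toReal_mono hfin this
  rw [ENNReal.toReal_add (ENNReal.mul_ne_top ENNReal.ofReal_ne_top (measure_ne_top _ _)) ENNReal.ofReal_ne_top,
    ENNReal.toReal_mul, ENNReal.toReal_ofReal (Real.sqrt_nonneg _), ENNReal.toReal_ofReal (by positivity)] at h3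
  refine h3.trans (add_le_add ?_ ?_)
  · refine mul_le_mul_of_nonneg_right (Real.sqrt_le_sqrt ?_) measureReal_nonneg
    have : (0:ℝ) < K - M := by
      have : (M:ℝ) < K := by exact_mod_cast hMK
      linarith
    rw [div_le_div_iff₀ this (by linarith)]
    linarith
  · refine le_trans ?_ hK1
    have h4 : ((2:ℝ) ^ η) ^ K ≤ 2 * 2 ^ M := by
      rw [← Real.rpow_mul_natCast (by norm_num), ← Real.rpow_natCast 2 M]
      calc (2:ℝ) ^ (η * K) ≤ 2 ^ ((M:ℝ) + 1) := Real.rpow_le_rpow_of_exponent_le (by norm_num) hMge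
        _ = _ := by rw [Real.rpow_add (by norm_num), Real.rpow_one]; ring
    rw [div_pow, mul_div_assoc', div_le_div_iff₀ (by positivity) (by positivity)]
    have := mul_le_mul_of_nonneg_left h4 (show 0 ≤ (1 + p0) ^ K by positivity)
    linarith

lemma compareQ {k : ℕ → ℕ} (hk : Tendsto k atTop atTop) (ν : ℕ → Measure ℝ) (hν : ∀ n, IsProbabilityMeasure (ν n))
    (M : ℕ → ℕ) (hM : ∀ᶠ n in atTop, 2 * M n ≤ k n)
    (hp : ∀ σ, Tendsto (fun n => (ν n).real (Iv σ ((M n : ℝ) / k n))) atTop (𝓝 0)) (ρ : ℝ) (hρ : 0 < ρ) :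
    ∀ᶠ n in atTop, ∀ A : Set (Bool × ℕ → ℕ), DepOn ((Finset.univ : Finset Bool) ×ˢ Finset.range (M n)) A →
      |(Measure.pi (fun _ : Fin (k n) => ν n)).real {y | cnt (cell (k n)) y ∈ A} - (IP (rate (k n) (ν n))).real A| ≤ ρ := by
  obtain ⟨η, hη, hη1, hηs⟩ : ∃ η : ℝ, 0 < η ∧ η < 1 ∧ Real.sqrt (1 / (1 - η)) ≤ 1 + ρ / 2 := by
    have hc : Tendsto (fun η : ℝ => Real.sqrt (1 / (1 - η))) (𝓝[>] 0) (𝓝 (Real.sqrt (1 / (1 - 0)))) := by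
      apply Tendsto.mono_left _ nhdsWithin_le_nhds
      have : ContinuousAt (fun η : ℝ => Real.sqrt (1 / (1 - η))) 0 := by
        apply ContinuousAt.sqrt
        apply ContinuousAt.div (by fun_prop) (by fun_prop); norm_num
      exact this
    rw [show Real.sqrt (1 / (1 - 0)) = 1 by simp] at hc
    obtain ⟨η, ⟨h1, h2⟩, h3⟩ := (((hc.eventually (ge_mem_nhds (show (1:ℝ) < 1 + ρ / 2 by linarith))).and
      (Tendsto.mono_left tendsto_id nhdsWithin_le_nhds |>.eventually (gt_mem_nhds (show (0:ℝ) < 1 by norm_num)))).and self_mem_nhdsWithin).exists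
    exact ⟨η, h3, h2, h1⟩
  set p0 := ((2:ℝ) ^ η - 1) / 2 with hp0
  have h21 : (1:ℝ) < 2 ^ η := Real.one_lt_rpow (by norm_num) hη
  have hp00 : 0 < p0 := by rw [hp0]; linarith
  filter_upwards [hk.eventually (compare_gen η p0 hη hη1 hp00.le (by rw [hp0]; linarith) (ρ / 2) (by positivity)), hM,
    (hp true).eventually (ge_mem_nhds (show 0 < p0 / 2 by positivity)),
    (hp false).eventually (ge_mem_nhds (show 0 < p0 / 2 by positivity)), hk.eventually (eventually_ge_atTop 1)]
    with n hcm hM1 ht hf hK A hA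
  haveI := hν n
  have key : ∀ B : Set (Bool × ℕ → ℕ), DepOn ((Finset.univ : Finset Bool) ×ˢ Finset.range (M n)) B →
      (Measure.pi (fun _ : Fin (k n) => ν n)).real {y | cnt (cell (k n)) y ∈ B} ≤ (IP (rate (k n) (ν n))).real B + ρ := by
    intro B hB
    have := hcm (ν n) ((Finset.univ : Finset Bool) ×ˢ Finset.range (M n)) ?_ ?_ B hB
    · refine this.trans ?_
      have h5 := mul_le_mul_of_nonneg_right hηs (measureReal_nonneg (μ := IP (rate (k n) (ν n))) (s := B))
      have h6 := measureReal_le_one (μ := IP (rate (k n) (ν n))) (s := B)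
      nlinarith
    · intro c hc d hd hne
      simp only [Finset.mem_product, Finset.mem_univ, Finset.mem_range, true_and] at hc hd
      exact cell_disj hK hM1 hc hd hne
    · rw [Finset.sum_product, Fintype.sum_bool, sum_cells hK, sum_cells hK]; linarith
  have hmeas : MeasurableSet {y : Fin (k n) → ℝ | cnt (cell (k n)) y ∈ A} :=
    (measurable_cnt (cell (k n)) (fun c => meas_cell _ c) (k n)) hA.meas
  have k1 := key A hA
  have k2 := key Aᶜ hA.compl
  rw [show {y : Fin (k n) → ℝ | cnt (cell (k n)) y ∈ Aᶜ} = {y | cnt (cell (k n)) y ∈ A}ᶜ from rfl,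
    probReal_compl_eq_one_sub hmeas, probReal_compl_eq_one_sub hA.meas] at k2
  rw [abs_le]; constructor <;> linarith

lemma compareP (ρ : ℝ) (hρ : 0 < ρ) :
    ∀ᶠ K : ℕ in atTop, ∀ (ν : Measure ℝ) [IsProbabilityMeasure ν] (σ : Bool) (M : ℕ)
      (_ : ν.real (Iv σ ((M:ℝ) / K)) ≤ 2 / 3) (A : Set (ℕ → ℕ)) (_ : DepOn (Finset.range M) A),
      (Measure.pi (fun _ : Fin K => ν)).real {y | sd σ (cnt (cell K) y) ∈ A} ≤
        3 * (IP (sd σ (rate K ν))).real A + ρ := by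
  have hlt : 1 + (2/3:ℝ) < (2:ℝ) ^ (4/5:ℝ) := by
    have h1 : ((5/3:ℝ)) ^ 5 < ((2:ℝ) ^ (4/5:ℝ)) ^ 5 := by
      rw [← Real.rpow_mul_natCast (by norm_num)]; norm_num
    have := lt_of_pow_lt_pow_left₀ 5 (by positivity) h1
    linarith
  filter_upwards [compare_gen (4/5) (2/3) (by norm_num) (by norm_num) (by norm_num) hlt ρ hρ, eventually_ge_atTop 1]
    with K hK hK1 ν _ σ M hm A hA
  have := hK ν ((Finset.range M).image (fun i => (σ, i))) ?_ ?_ _ (dep_sd hA σ)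
  · refine this.trans ?_
    rw [Measure.real, Measure.real, IP_sd _ _ hA.meas]
    have h3 : Real.sqrt (1 / (1 - 4/5)) ≤ 3 := by
      rw [Real.sqrt_le_left (by norm_num)]; norm_num
    gcongr
  · intro c hc d hd hne
    simp only [Finset.mem_image] at hc hd
    obtain ⟨i, -, rfl⟩ := hc
    obtain ⟨j, -, rfl⟩ := hd
    exact cell_disj_same hK1 σ (fun h => hne (by rw [h]))
  · rw [Finset.sum_image (by intro a _ b _ h; simpa using h), sum_cells hK1]; exact hm

end HC

namespace HC
open MeasureTheory Filter Topology ProbabilityTheory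
open scoped ENNReal NNReal

lemma unif_eq : unif = volume.restrict (Set.Ioc (0:ℝ) 1) := by
  unfold unif; exact Measure.restrict_congr_set Ioo_ae_eq_Ioc

instance : IsProbabilityMeasure unif := ⟨by rw [unif_eq]; simp⟩

lemma unif_Iv (σ : Bool) {s : ℝ} (h0 : 0 ≤ s) (h1 : s ≤ 1) : unif.real (Iv σ s) = s := by
  rw [unif_eq, Measure.real, Measure.restrict_apply (meas_Iv σ s)]
  unfold Iv
  cases σ
  · simp only [Bool.false_eq_true, if_false]
    rw [Set.Ioc_inter_Ioc, Real.volume_Ioc]; simp [h0, h1]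
  · simp only [if_true]
    rw [Set.Ioc_inter_Ioc, Real.volume_Ioc]; simp [h0, h1]

lemma unif_01 : unif (Set.Ioo (0:ℝ) 1) = 1 := by
  unfold unif; simp

lemma Qmix_real (μ : Measure ℝ) [IsProbabilityMeasure μ] {e : ℝ} (he : e ∈ Set.Icc (0:ℝ) 1) (A : Set ℝ) :
    (Qmix unif μ e).real A = (1 - e) * unif.real A + e * μ.real A := by
  unfold Qmix Measure.real
  rw [Measure.add_apply, Measure.smul_apply, Measure.smul_apply, smul_eq_mul, smul_eq_mul,
    ENNReal.toReal_add (ENNReal.mul_ne_top ENNReal.ofReal_ne_top (measure_ne_top _ _))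
      (ENNReal.mul_ne_top ENNReal.ofReal_ne_top (measure_ne_top _ _)), ENNReal.toReal_mul, ENNReal.toReal_mul,
    ENNReal.toReal_ofReal (by linarith [he.2]), ENNReal.toReal_ofReal he.1]

lemma Qmix_apply (μ : Measure ℝ) {e : ℝ} (he : e ∈ Set.Icc (0:ℝ) 1) (A : Set ℝ)
    (h1 : unif A = 1) (h2 : μ A = 1) : Qmix unif μ e A = 1 := by
  unfold Qmix
  rw [Measure.add_apply, Measure.smul_apply, Measure.smul_apply, smul_eq_mul, smul_eq_mul, h1, h2, mul_one, mul_one,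
    ← ENNReal.ofReal_add (by linarith [he.2]) he.1]
  simp

lemma Qmix_prob (μ : Measure ℝ) [IsProbabilityMeasure μ] {e : ℝ} (he : e ∈ Set.Icc (0:ℝ) 1) :
    IsProbabilityMeasure (Qmix unif μ e) := ⟨Qmix_apply μ he _ measure_univ measure_univ⟩

lemma Qmix_Iv_le (μ : Measure ℝ) [IsProbabilityMeasure μ] {e : ℝ} (he : e ∈ Set.Icc (0:ℝ) 1) (σ : Bool) {s : ℝ}
    (h0 : 0 ≤ s) (h1 : s ≤ 1) : (Qmix unif μ e).real (Iv σ s) ≤ s + e := by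
  rw [Qmix_real μ he, unif_Iv σ h0 h1]
  have h2 := mul_le_mul_of_nonneg_left (measureReal_le_one (μ := μ) (s := Iv σ s)) he.1
  have h3 := mul_nonneg he.1 h0
  linarith

/-- the quantity bounded by the sup -/
noncomputable def Hs (K : ℕ) (μ : Measure ℝ) (e v : ℝ) : ℝ :=
  (|K * (e * ((μ (Set.Ioc 0 v)).toReal - v))| + |K * (e * ((μ (Set.Ioo (1 - v) 1)).toReal - v))|) / Real.sqrt (K * v)

lemma Hfun_eq (k : ℕ → ℕ) (μn : ℕ → Measure ℝ) (εn : ℕ → ℝ) (n : ℕ) (v : ℝ) :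
    Hfun (fun n _ => μn n) (fun n _ => εn n) k n v = Hs (k n) (μn n) (εn n) v := by
  simp [Hfun, Hs]

lemma Hs_nonneg (K : ℕ) (μ : Measure ℝ) (e v : ℝ) : 0 ≤ Hs K μ e v := by
  unfold Hs; positivity

lemma Hs_le {K : ℕ} (hK : 1 ≤ K) (μ : Measure ℝ) [IsProbabilityMeasure μ] {e : ℝ} (he : e ∈ Set.Icc (0:ℝ) 1)
    {v w : ℝ} (hw : 0 < w) (hv : w ≤ v) (hv1 : v ≤ 1) : Hs K μ e v ≤ 2 * K / Real.sqrt (K * w) := by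
  have hK' : (0:ℝ) < K := by exact_mod_cast hK
  have key : ∀ A : Set ℝ, |K * (e * ((μ A).toReal - v))| ≤ K := by
    intro A
    have h1 : (μ A).toReal ≤ 1 := measureReal_le_one (μ := μ) (s := A)
    have h2 : 0 ≤ (μ A).toReal := ENNReal.toReal_nonneg
    rw [abs_mul, abs_mul, abs_of_pos hK', abs_of_nonneg he.1]
    have h3 : |(μ A).toReal - v| ≤ 1 := abs_le.2 ⟨by linarith, by linarith⟩
    have h4 : e * |(μ A).toReal - v| ≤ 1 := mul_le_one₀ he.2 (abs_nonneg _) h3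
    exact mul_le_of_le_one_right hK'.le h4
  unfold Hs
  have h5 : 0 < Real.sqrt (K * w) := Real.sqrt_pos.2 (by positivity)
  apply div_le_div₀ (by positivity) _ h5 (Real.sqrt_le_sqrt (by gcongr))
  linarith [key (Set.Ioc 0 v), key (Set.Ioo (1 - v) 1)]

lemma mu_Iv_true (μ : Measure ℝ) [IsProbabilityMeasure μ] (h01 : μ (Set.Ioo (0:ℝ) 1) = 1) (s : ℝ) :
    μ (Set.Ioo (1 - s) 1) = μ (Iv true s) := by
  have h1 : μ {1} = 0 := by
    refine measure_mono_null (t := (Set.Ioo (0:ℝ) 1)ᶜ) (by simp) ?_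
    rw [prob_compl_eq_zero_iff measurableSet_Ioo]; exact h01
  unfold Iv; simp only [if_true]
  exact measure_congr (Ioo_ae_eq_Ioc' h1)

lemma Lam_close {K : ℕ} (hK : 1 ≤ K) (μ : Measure ℝ) [IsProbabilityMeasure μ] (h01 : μ (Set.Ioo (0:ℝ) 1) = 1)
    {e : ℝ} (he : e ∈ Set.Icc (0:ℝ) 1) (σ : Bool) (j : ℕ) (hj1 : 1 ≤ j) (hj : j ≤ K) :
    |Lam (sd σ (rate K (Qmix unif μ e))) j - j| ≤ Hs K μ e ((j:ℝ) / K) * Real.sqrt j := by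
  have := Qmix_prob μ he
  have hK' : (0:ℝ) < K := by exact_mod_cast hK
  have hj0 : (0:ℝ) < j := by exact_mod_cast hj1
  have hs1 : (j:ℝ) / K ≤ 1 := by rw [div_le_one hK']; exact_mod_cast hj
  rw [Lam_rate hK, Qmix_real μ he, unif_Iv σ (by positivity) hs1]
  have e1 : (K:ℝ) * ((1 - e) * (j / K) + e * μ.real (Iv σ (j / K))) - j = K * (e * (μ.real (Iv σ (j / K)) - j / K)) := by
    field_simp; ring
  rw [e1]
  unfold Hs
  rw [mul_div_cancel₀ (j:ℝ) hK'.ne', div_mul_cancel₀ _ (Real.sqrt_pos.2 hj0).ne', mu_Iv_true μ h01]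
  cases σ
  · have : Iv false ((j:ℝ) / K) = Set.Ioc 0 ((j:ℝ) / K) := by simp [Iv]
    rw [this]
    exact le_add_of_nonneg_right (abs_nonneg _)
  · exact le_add_of_nonneg_left (abs_nonneg _)

/-- powers versus sequences with given log rate -/
lemma pow_ge_of_log {k : ℕ → ℕ} (hk : Tendsto k atTop atTop) {r : ℕ → ℝ} (hr : ∀ n, 0 < r n) {A g : ℝ}
    (h : Tendsto (fun n => Real.log (r n) / Real.log (k n)) atTop (𝓝 A)) (hg : A < g) :
    ∀ᶠ n in atTop, r n ≤ (k n : ℝ) ^ g := by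
  filter_upwards [h.eventually (gt_mem_nhds hg), (tendsto_logK.comp hk).eventually_gt_atTop 0,
    hk.eventually (eventually_ge_atTop 1)] with n h1 h2 h3
  simp only [Function.comp] at h2
  rw [div_lt_iff₀ h2] at h1
  have hk0 : (0:ℝ) < k n := by exact_mod_cast h3
  rw [← Real.log_le_log_iff (hr n) (by positivity), Real.log_rpow hk0]
  exact h1.le

lemma pow_le_of_log {k : ℕ → ℕ} (hk : Tendsto k atTop atTop) {r : ℕ → ℝ} (hr : ∀ n, 0 < r n) {A g : ℝ}
    (h : Tendsto (fun n => Real.log (r n) / Real.log (k n)) atTop (𝓝 A)) (hg : g < A) :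
    ∀ᶠ n in atTop, (k n : ℝ) ^ g ≤ r n := by
  filter_upwards [h.eventually (lt_mem_nhds hg), (tendsto_logK.comp hk).eventually_gt_atTop 0,
    hk.eventually (eventually_ge_atTop 1)] with n h1 h2 h3
  simp only [Function.comp] at h2
  rw [lt_div_iff₀ h2] at h1
  have hk0 : (0:ℝ) < k n := by exact_mod_cast h3
  rw [← Real.log_le_log_iff (by positivity) (hr n), Real.log_rpow hk0]
  exact h1.le

lemma close_of {k : ℕ → ℕ} (hk : Tendsto k atTop atTop) {μn : ℕ → Measure ℝ} {εn : ℕ → ℝ}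
    (hμ : ∀ n, IsProbabilityMeasure (μn n))
    (hμ01 : ∀ n, (μn n) (Set.Ioo (0 : ℝ) 1) = 1)
    (hε : ∀ n, εn n ∈ Set.Icc (0 : ℝ) 1) {r s : ℕ → ℝ} {A B : ℝ}
    (hr : ∀ n, 0 < r n) (hs : ∀ n, 0 < s n) {f g : ℝ} (hf : A < f - 1) (hg : g - 1 < B) (hfg : f ≤ g) (hf0 : 0 < f) (hg1 : g < 1)
    (hrlog : Tendsto (fun n => Real.log (r n) / Real.log (k n)) atTop (𝓝 A))
    (hslog : Tendsto (fun n => Real.log (s n) / Real.log (k n)) atTop (𝓝 B))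
    {η : ℕ → ℝ} (hη0 : ∀ n, 0 ≤ η n) (hη : Tendsto (fun n => η n * aHC (k n)) atTop (𝓝 0))
    (hH : ∀ᶠ n in atTop, ∀ v ∈ Set.Icc (r n) (s n), Hs (k n) (μn n) (εn n) v ≤ η n) (σ : Bool) :
    Close k (fun n => sd σ (rate (k n) (Qmix unif (μn n) (εn n)))) f g := by
  refine ⟨η, hη0, hη, ?_⟩
  obtain ⟨g', hg1', hg2'⟩ := exists_between hg
  filter_upwards [hH, pow_ge_of_log hk hr hrlog hf, pow_le_of_log hk hs hslog hg2', hk.eventually (eventually_ge_atTop 1),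
    hk.eventually (J_large f hf0 1 0), hk.eventually (plog 0 (g' - (g - 1)) 2 (by linarith)),
    hk.eventually (plog 0 (1 - g) 2 (by linarith))] with n h1 h2 h3 h4 h5 h6 h7 j hj1 hj2
  have hk0 : (0:ℝ) < k n := by exact_mod_cast h4
  have := hμ n
  simp only [pow_zero, mul_one] at h5 h6 h7
  have hj1' : (J f (k n) : ℝ) ≤ j := by exact_mod_cast hj1
  have hj2' : (j:ℝ) ≤ J g (k n) := by exact_mod_cast hj2
  have hjl := (J_lower f (k n)).trans hj1'
  have hju := hj2'.trans (J_upper2 g (by linarith) (k n) h4)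
  have hjK : (j:ℝ) ≤ k n := by
    refine hju.trans ?_
    calc 2 * (k n : ℝ) ^ g ≤ (k n : ℝ) ^ (1 - g) * (k n : ℝ) ^ g := by gcongr
      _ = k n := by rw [← Real.rpow_add hk0]; simp
  refine (Lam_close h4 (μn n) (hμ01 n) (hε n) σ j ?_ (by exact_mod_cast hjK)).trans ?_
  · have : (1:ℝ) ≤ j := by linarith
    exact_mod_cast this
  · refine mul_le_mul_of_nonneg_right (h1 _ ⟨h2.trans ?_, le_trans ?_ h3⟩) (Real.sqrt_nonneg _)
    · rw [le_div_iff₀ hk0]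
      refine le_trans (le_of_eq ?_) hjl
      rw [← Real.rpow_add_one hk0.ne']; simp
    · rw [div_le_iff₀ hk0]
      refine hju.trans ?_
      rw [← Real.rpow_add_one hk0.ne']
      calc 2 * (k n : ℝ) ^ g ≤ (k n : ℝ) ^ (g' - (g - 1)) * (k n : ℝ) ^ g := by gcongr
        _ = _ := by rw [← Real.rpow_add hk0]; congr 1; ring

end HC

namespace HC
open MeasureTheory Filter Topology ProbabilityTheory
open scoped ENNReal NNReal

/-- exceedance on the integer grid, for unit rates -/
def Agrid (j1 j2 : ℕ) (V : ℝ) : Set (ℕ → ℕ) :=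
  {ω | ∃ j ∈ Finset.Icc j1 j2, V * Real.sqrt j ≤ |S ω j - j|}

lemma dep_Agrid (j1 j2 : ℕ) (V : ℝ) : DepOn (Finset.range j2) (Agrid j1 j2 V) := by
  rintro ω ω' h ⟨j, hj, hE⟩
  refine ⟨j, hj, ?_⟩
  rwa [← S_congr (fun i hi => h i ?_)]
  have := (Finset.mem_Icc.1 hj).2
  have := Finset.mem_range.1 hi
  exact Finset.mem_range.2 (by omega)

/-- bad window for the sample -/
def BadW (K : ℕ) (σ : Bool) (j1 j2 : ℕ) (V : ℝ) : Set (Fin K → ℝ) :=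
  {y | sd σ (cnt (cell K) y) ∈ Agrid j1 j2 V}

lemma meas_BadW (K : ℕ) (σ : Bool) (j1 j2 : ℕ) (V : ℝ) : MeasurableSet (BadW K σ j1 j2 V) :=
  (measurable_cnt (cell K) (fun c => meas_cell _ c) K) ((dep_sd (dep_Agrid j1 j2 V) σ).meas)

/-- the uniform product measure -/
noncomputable def PK (K : ℕ) : Measure (Fin K → ℝ) := Measure.pi (fun _ => unif)

instance (K : ℕ) : IsProbabilityMeasure (PK K) := by unfold PK; infer_instance

lemma Lam_unit {K : ℕ} (hK : 1 ≤ K) (σ : Bool) {j : ℕ} (hj : j ≤ K) : Lam (sd σ (rate K unif)) j = j := by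
  have hK' : (0:ℝ) < K := by exact_mod_cast hK
  rw [Lam_rate hK, unif_Iv σ (by positivity) (by rw [div_le_one hK']; exact_mod_cast hj)]
  field_simp

lemma Agrid_eq {K : ℕ} (hK : 1 ≤ K) (σ : Bool) {j1 j2 : ℕ} (hj : j2 ≤ K) (V : ℝ) :
    Agrid j1 j2 V = {ω | ∃ j ∈ Finset.Icc j1 j2, V * Real.sqrt (Lam (sd σ (rate K unif)) j) ≤
      |S ω j - Lam (sd σ (rate K unif)) j|} := by
  ext ω
  constructor
  · rintro ⟨j, hj', h⟩
    exact ⟨j, hj', by rwa [Lam_unit hK σ ((Finset.mem_Icc.1 hj').2.trans hj)]⟩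
  · rintro ⟨j, hj', h⟩
    exact ⟨j, hj', by rwa [Lam_unit hK σ ((Finset.mem_Icc.1 hj').2.trans hj)] at h⟩

lemma bad_le (ρ : ℝ) (hρ : 0 < ρ) : ∀ᶠ K : ℕ in atTop, ∀ (σ : Bool) (j1 j2 : ℕ) (V : ℝ), 3 * j2 ≤ 2 * K →
    (PK K).real (BadW K σ j1 j2 V) ≤ 3 * (IP (sd σ (rate K unif))).real (Agrid j1 j2 V) + ρ := by
  filter_upwards [compareP ρ hρ, eventually_ge_atTop 1] with K hK hK1 σ j1 j2 V hj
  have hK' : (0:ℝ) < K := by exact_mod_cast hK1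
  refine hK unif σ j2 ?_ _ (dep_Agrid j1 j2 V)
  have : (3 * j2 : ℝ) ≤ 2 * K := by exact_mod_cast hj
  rw [unif_Iv σ (by positivity) (by rw [div_le_one hK']; linarith)]
  rw [div_le_div_iff₀ hK' (by norm_num)]; linarith

/-- lower cut-off -/
noncomputable def J0 (K : ℕ) : ℕ := ⌈aHC K ^ 9⌉₊

lemma J0_le : ∀ᶠ K : ℕ in atTop, (J0 K : ℝ) ≤ 2 * aHC K ^ 9 := by
  filter_upwards [tendsto_aHC.eventually_ge_atTop 1] with K hK
  have h1 : (1:ℝ) ≤ aHC K ^ 9 := one_le_pow₀ hK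
  have := (Nat.ceil_lt_add_one (show 0 ≤ aHC K ^ 9 by positivity)).le
  unfold J0; linarith

lemma chern_cor (l : ℕ → ℝ≥0) (j : ℕ) (c : ℝ) (hL : 1 ≤ Lam l j) :
    (IP l).real {ω | c * Real.sqrt (Lam l j) ≤ |S ω j - Lam l j|} ≤ 2 * Real.exp (1 - c) :=
  ENNReal.toReal_le_of_le_ofReal (by positivity) (chernoff_abs l j c hL)

lemma small_window {K : ℕ} (hK : 1 ≤ K) (σ : Bool) {j1 j2 : ℕ} (h1 : 1 ≤ j1) (hj : j2 ≤ K) (V : ℝ) :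
    (IP (sd σ (rate K unif))).real (Agrid j1 j2 V) ≤ j2 * (2 * Real.exp (1 - V)) := by
  rw [Agrid_eq hK σ hj]
  have e : {ω : ℕ → ℕ | ∃ j ∈ Finset.Icc j1 j2, V * Real.sqrt (Lam (sd σ (rate K unif)) j) ≤
      |S ω j - Lam (sd σ (rate K unif)) j|} = ⋃ j ∈ Finset.Icc j1 j2, {ω : ℕ → ℕ | V * Real.sqrt (Lam (sd σ (rate K unif)) j) ≤
      |S ω j - Lam (sd σ (rate K unif)) j|} := by ext ω; simp
  rw [e]
  refine (measureReal_biUnion_finset_le _ _).trans ?_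
  refine (Finset.sum_le_card_nsmul _ _ (2 * Real.exp (1 - V)) ?_).trans ?_
  · intro j hj'
    obtain ⟨q1, q2⟩ := Finset.mem_Icc.1 hj'
    refine chern_cor _ _ _ ?_
    rw [Lam_unit hK σ (q2.trans hj)]
    exact_mod_cast h1.trans q1
  · rw [nsmul_eq_mul, Nat.card_Icc]
    refine mul_le_mul_of_nonneg_right ?_ (by positivity)
    exact_mod_cast (by omega)

lemma gap_one (ρ : ℝ) (hρ : 0 < ρ) : ∃ c : ℝ, 0 < c ∧ ∀ᶠ K : ℕ in atTop, ∀ σ, (PK K).real (BadW K σ 1 1 c) ≤ ρ := by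
  have ht : Tendsto (fun c : ℝ => 3 * (2 * Real.exp (1 - c))) atTop (𝓝 (3 * (2 * 0))) := by
    refine Tendsto.const_mul _ (Tendsto.const_mul _ (Real.tendsto_exp_atBot.comp ?_))
    exact tendsto_atBot_add_const_left _ _ tendsto_neg_atTop_atBot
  rw [mul_zero, mul_zero] at ht
  obtain ⟨c, h1, h2⟩ := ((ht.eventually (ge_mem_nhds (show 0 < ρ / 2 by positivity))).and (eventually_gt_atTop 0)).exists
  refine ⟨c, h2, ?_⟩
  filter_upwards [bad_le (ρ / 2) (by positivity), eventually_ge_atTop 2] with K hK hK2 σ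
  have := hK σ 1 1 c (by omega)
  have h3 := small_window (by omega : 1 ≤ K) σ (le_refl 1) (by omega : 1 ≤ K) c
  norm_num at h3
  linarith

lemma tendsto_a_exp (q : ℕ) (C c : ℝ) (hc : 0 < c) :
    Tendsto (fun K : ℕ => C * (aHC K ^ q * Real.exp (-(c * aHC K)))) atTop (𝓝 0) := by
  have h1 := (Real.tendsto_pow_mul_exp_neg_atTop_nhds_zero q).comp (tendsto_aHC.const_mul_atTop hc)
  have h2 := h1.const_mul (C / c ^ q)
  rw [mul_zero] at h2
  refine h2.congr fun K => ?_
  simp only [Function.comp, mul_pow]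
  field_simp

lemma gap_small (x ρ : ℝ) (hρ : 0 < ρ) : ∀ᶠ K : ℕ in atTop, ∀ σ,
    (PK K).real (BadW K σ 1 (J0 K) (Uu K x / 4)) ≤ ρ := by
  filter_upwards [bad_le (ρ / 2) (by positivity), J0_le, Uu_bounds x, plog 1 1 8 (by norm_num),
    aHC_pow 9 1, eventually_ge_atTop 1, tendsto_aHC.eventually_ge_atTop 1,
    (tendsto_a_exp 9 (12 * Real.exp 1) (1/8) (by norm_num)).eventually (ge_mem_nhds (show 0 < ρ / 2 by positivity))]
    with K h1 h2 h3 h4 h5 h6 ha h7 σ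
  rw [pow_one, Real.rpow_one] at h4
  have hJ : (4 * J0 K : ℝ) ≤ K := by linarith
  have hJ' : 4 * J0 K ≤ K := by exact_mod_cast hJ
  have h8 := h1 σ 1 (J0 K) (Uu K x / 4) (by omega)
  have h9 := small_window h6 σ (le_refl 1) (by omega : J0 K ≤ K) (Uu K x / 4)
  have h10 : (J0 K : ℝ) * (2 * Real.exp (1 - Uu K x / 4)) ≤ (2 * aHC K ^ 9) * (2 * (Real.exp 1 * Real.exp (-(1/8 * aHC K)))) := by
    have : Real.exp (1 - Uu K x / 4) ≤ Real.exp 1 * Real.exp (-(1/8 * aHC K)) := by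
      rw [← Real.exp_add]; apply Real.exp_le_exp.2; linarith [h3.1]
    gcongr
  linarith

lemma gap_mid (x c ρ : ℝ) (hc : 0 ≤ c) (hρ : 0 < ρ) : ∀ᶠ K : ℕ in atTop, ∀ (σ : Bool) (j1 j2 : ℕ), j1 ≤ j2 → J0 K ≤ j1 →
    3 * j2 ≤ 2 * K → Real.log ((j2:ℝ) / j1) ≤ c * Real.log K + 3 →
    (PK K).real (BadW K σ j1 j2 (Uu K x)) ≤ 6 * (Real.exp (-x) * c) + ρ := by
  obtain ⟨u0, hu0, hW⟩ := windowU 1 one_pos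
  have hlim := (tendsto_phw tendsto_id x c 5).const_mul (2 * 3)
  filter_upwards [bad_le (ρ / 2) (by positivity), (tendsto_Uu x).eventually_ge_atTop u0, Uu_bounds x, 
    tendsto_aHC.eventually_ge_atTop 256, eventually_ge_atTop 1,
    hlim.eventually (ge_mem_nhds (show 2 * 3 * (Real.exp (-x) * c) < 6 * (Real.exp (-x) * c) + ρ / 2 by linarith))]
    with K h1 h2 h3 ha hK h4 σ j1 j2 hj hj0 hj2 hlog
  have h8 := h1 σ j1 j2 (Uu K x) hj2
  have hjK : j2 ≤ K := by omega
  have hu : 0 < Uu K x := by linarith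
  have hph := ph_pos hu
  have h9 : (IP (sd σ (rate K unif))).real (Agrid j1 j2 (Uu K x)) ≤ 2 * (ph (Uu K x) * (c * Real.log K + 5)) := by
    rw [Agrid_eq hK σ hjK]
    have h10 := hW _ h2 (sd σ (rate K unif)) j1 j2 hj ?_
    · rw [Lam_unit hK σ hjK, Lam_unit hK σ (hj.trans hjK)] at h10
      have hlogK : 0 ≤ Real.log K := Real.log_nonneg (by exact_mod_cast hK)
      refine ENNReal.toReal_le_of_le_ofReal (by positivity) (h10.trans (ENNReal.ofReal_le_ofReal ?_))
      have := mul_le_mul_of_nonneg_left hlog hph.le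
      linarith
    · rw [Lam_unit hK σ (hj.trans hjK)]
      have h11 : (J0 K : ℝ) ≤ j1 := by exact_mod_cast hj0
      have h12 : aHC K ^ 9 ≤ J0 K := Nat.le_ceil _
      calc Uu K x ^ 8 ≤ (2 * aHC K) ^ 8 := pow_le_pow_left₀ hu.le h3.2 8
        _ = 256 * aHC K ^ 8 := by ring
        _ ≤ aHC K * aHC K ^ 8 := by gcongr
        _ = aHC K ^ 9 := by ring
        _ ≤ _ := h12.trans h11
  simp only [id] at h4
  linarith

/-- upper cut-offs -/
noncomputable def J1 (K : ℕ) : ℕ := ⌈(K:ℝ) / Real.log K⌉₊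

/-- the last grid index -/
def J2 (K : ℕ) : ℕ := K / 2 + 1

lemma gap_top (x ρ : ℝ) (hρ : 0 < ρ) : ∀ᶠ K : ℕ in atTop, ∀ σ,
    (PK K).real (BadW K σ (J1 K) (J2 K) (Uu K x / 4)) ≤ ρ := by
  obtain ⟨u0, hu0, hW⟩ := windowU 1 one_pos
  filter_upwards [bad_le (ρ / 2) (by positivity), (tendsto_Uu x).eventually_ge_atTop (4 * u0), Uu_bounds x, 
    tendsto_aHC.eventually_ge_atTop 4, eventually_ge_atTop 12, aHC_sq, Uu_pow x 8 1 (by norm_num),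
    plog 2 1 1 (by norm_num), tendsto_logK.eventually_ge_atTop 4,
    (tendsto_a_exp 3 6 (1/128) (by norm_num)).eventually (ge_mem_nhds (show 0 < ρ / 2 by positivity))]
    with K h1 h2 h3 ha hK hsq hp hpl hl4 h4 σ
  obtain ⟨-, -, hl, hsq⟩ := hsq
  rw [Real.rpow_one] at hpl
  have h8 := h1 σ (J1 K) (J2 K) (Uu K x / 4) (by unfold J2; omega)
  have hK1 : 1 ≤ K := by omega
  have hK' : (0:ℝ) < K := by exact_mod_cast hK1
  have hjK : J2 K ≤ K := by unfold J2; omega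
  have hJ1 : (K:ℝ) / Real.log K ≤ J1 K := Nat.le_ceil _
  have hj : J1 K ≤ J2 K := by
    unfold J1; rw [Nat.ceil_le]
    have : (K:ℝ) ≤ 2 * (J2 K) := by unfold J2; exact_mod_cast (by omega)
    rw [div_le_iff₀ hl]
    nlinarith
  have hu : 0 < Uu K x := by linarith
  have hu4 : 0 < Uu K x / 4 := by linarith
  have hph := ph_pos hu4
  have hphle : ph (Uu K x / 4) ≤ aHC K / 2 * Real.exp (-(1/128 * aHC K)) := by
    unfold ph
    have s1 : (1:ℝ) ≤ Real.sqrt (2 * Real.pi) := by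
      apply Real.le_sqrt_of_sq_le; nlinarith [Real.pi_gt_three]
    refine (div_le_self (by positivity) s1).trans ?_
    have : Real.exp (-((Uu K x / 4) ^ 2 / 2)) ≤ Real.exp (-(1/128 * aHC K)) := by
      apply Real.exp_le_exp.2; apply neg_le_neg
      have q1 : aHC K / 8 ≤ Uu K x / 4 := by linarith [h3.1]
      have q2 : (aHC K / 8) ^ 2 ≤ (Uu K x / 4) ^ 2 := pow_le_pow_left₀ (by linarith) q1 2
      nlinarith
    have q3 : Uu K x / 4 ≤ aHC K / 2 := by linarith [h3.2]
    gcongr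
  have h9 : (IP (sd σ (rate K unif))).real (Agrid (J1 K) (J2 K) (Uu K x / 4)) ≤ 2 * (ph (Uu K x / 4) * aHC K ^ 2) := by
    rw [Agrid_eq hK1 σ hjK]
    have h10 := hW (Uu K x / 4) (by linarith) (sd σ (rate K unif)) (J1 K) (J2 K) hj ?_
    · rw [Lam_unit hK1 σ hjK, Lam_unit hK1 σ (hj.trans hjK)] at h10
      refine ENNReal.toReal_le_of_le_ofReal (by positivity) (h10.trans (ENNReal.ofReal_le_ofReal ?_))
      have hJ1p : 0 < (J1 K : ℝ) := lt_of_lt_of_le (by positivity) hJ1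
      have hr : Real.log ((J2 K : ℝ) / J1 K) ≤ Real.log (Real.log K) := by
        apply Real.log_le_log
        · have : 0 < (J2 K : ℝ) := by unfold J2; positivity
          positivity
        · rw [div_le_iff₀ hJ1p]
          have q1 : (J2 K : ℝ) ≤ K := by exact_mod_cast hjK
          rw [div_le_iff₀ hl] at hJ1
          linarith
      have hq : Real.log ((J2 K : ℝ) / J1 K) + 2 ≤ aHC K ^ 2 := by
        have : 16 ≤ aHC K ^ 2 := by nlinarith
        linarith
      have := mul_le_mul_of_nonneg_left hq hph.le
      linarith
    · rw [Lam_unit hK1 σ (hj.trans hjK)]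
      calc (Uu K x / 4) ^ 8 ≤ (Uu K x) ^ 8 := pow_le_pow_left₀ hu4.le (by linarith) 8
        _ ≤ Real.log K := by linarith
        _ ≤ K / Real.log K := by rw [le_div_iff₀ hl]; linarith
        _ ≤ _ := hJ1
  have h11 := mul_le_mul_of_nonneg_right hphle (show 0 ≤ aHC K ^ 2 by positivity)
  have h12 : aHC K / 2 * Real.exp (-(1/128 * aHC K)) * aHC K ^ 2 = 1 / 2 * (aHC K ^ 3 * Real.exp (-(1/128 * aHC K))) := by ring
  have h13 : 0 ≤ aHC K ^ 3 * Real.exp (-(1/128 * aHC K)) := by positivity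
  linarith

/-- a point very close to the boundary -/
def Near (K : ℕ) (σ : Bool) (s : ℝ) : Set (Fin K → ℝ) := {y | ∃ i, y i ∈ Iv σ s}

lemma meas_Near (K : ℕ) (σ : Bool) (s : ℝ) : MeasurableSet (Near K σ s) := by
  have : Near K σ s = ⋃ i, {y : Fin K → ℝ | y i ∈ Iv σ s} := by ext; simp [Near]
  rw [this]
  exact MeasurableSet.iUnion fun i => (measurable_pi_apply i) (meas_Iv σ s)

lemma near_le {K : ℕ} (hK : 1 ≤ K) (σ : Bool) {η : ℝ} (h0 : 0 ≤ η) (h1 : η ≤ 1) :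
    (PK K).real (Near K σ (η / K)) ≤ η := by
  have hK' : (1:ℝ) ≤ K := by exact_mod_cast hK
  have e : Near K σ (η / K) = ⋃ i ∈ (Finset.univ : Finset (Fin K)), {y : Fin K → ℝ | y i ∈ Iv σ (η / K)} := by
    ext; simp [Near]
  rw [e]
  refine (measureReal_biUnion_finset_le _ _).trans ?_
  have : ∀ i ∈ (Finset.univ : Finset (Fin K)), (PK K).real {y : Fin K → ℝ | y i ∈ Iv σ (η / K)} ≤ η / K := by
    intro i _
    have h := (measurePreserving_eval (fun _ : Fin K => unif) i).measureReal_preimage (meas_Iv σ (η / K)).nullMeasurableSet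
    have h' : (PK K).real {y : Fin K → ℝ | y i ∈ Iv σ (η / K)} = unif.real (Iv σ (η / K)) := h
    rw [h', unif_Iv σ (by positivity) (by rw [div_le_one (by linarith)]; linarith)]
  refine (Finset.sum_le_card_nsmul _ _ _ this).trans ?_
  rw [nsmul_eq_mul, Finset.card_univ, Fintype.card_fin, mul_div_cancel₀]
  linarith

end HC

namespace HC
open MeasureTheory Filter Topology ProbabilityTheory
open scoped ENNReal NNReal

lemma not_BadW {K : ℕ} {σ : Bool} {j1 j2 : ℕ} {V : ℝ} {y : Fin K → ℝ} (h : y ∉ BadW K σ j1 j2 V) {j : ℕ}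
    (h1 : j1 ≤ j) (h2 : j ≤ j2) : |S (sd σ (cnt (cell K) y)) j - j| ≤ V * Real.sqrt j := by
  by_contra hh
  push Not at hh
  exact h ⟨j, Finset.mem_Icc.2 ⟨h1, h2⟩, hh.le⟩

lemma sandwich {G S1 S2 T j B : ℝ} (h1 : S1 ≤ G) (h2 : G ≤ S2) (t1 : j ≤ T) (t2 : T ≤ j + 1)
    (b1 : |S1 - j| ≤ B) (b2 : |S2 - (j + 1)| ≤ B) : |G - T| ≤ B + 1 := by
  rw [abs_le] at *; constructor <;> linarith [b1.1, b1.2, b2.1, b2.2]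

lemma lev_quarter {U T j s : ℝ} (hU : 4 ≤ U) (hj : 1 ≤ j) (hT : j ≤ T) (hs : s ≤ 1 / 2) :
    U / 4 * Real.sqrt (j + 1) + 1 ≤ U * Real.sqrt (T * (1 - s)) := by
  have h1 : Real.sqrt (j / 2) ≤ Real.sqrt (T * (1 - s)) := by
    apply Real.sqrt_le_sqrt; nlinarith
  have h2 : Real.sqrt (j + 1) ≤ 2 * Real.sqrt (j / 2) := by
    rw [Real.sqrt_le_left (by positivity), mul_pow, Real.sq_sqrt (by linarith)]; linarith
  have h3 : 1 / 2 ≤ Real.sqrt (j / 2) := by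
    apply Real.le_sqrt_of_sq_le; linarith
  nlinarith

lemma lev_mid {U V T j s θ L : ℝ} (hV0 : 0 ≤ V) (hVU : V = U - θ) (hθ : 0 ≤ θ) (hj : 1 ≤ j) (hT : j ≤ T) (hs0 : 0 ≤ s) (hs : s ≤ 1 / 2)
    (hsL : s ≤ L) (hL : U * L ≤ θ / 2) (hq : U + 1 ≤ θ / 2 * Real.sqrt j) :
    V * Real.sqrt (j + 1) + 1 ≤ U * Real.sqrt (T * (1 - s)) := by
  have hU : 0 ≤ U := by linarith
  have q1 : 1 ≤ Real.sqrt j := Real.one_le_sqrt.2 hj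
  have h1 : Real.sqrt j * (1 - s) ≤ Real.sqrt (T * (1 - s)) := by
    apply Real.le_sqrt_of_sq_le
    rw [mul_pow, Real.sq_sqrt (by linarith)]
    have : (1 - s) ^ 2 ≤ 1 - s := by nlinarith
    calc j * (1 - s) ^ 2 ≤ j * (1 - s) := by gcongr
      _ ≤ T * (1 - s) := mul_le_mul_of_nonneg_right hT (by linarith)
  have h2 : Real.sqrt (j + 1) ≤ Real.sqrt j + 1 := by
    rw [Real.sqrt_le_left (by positivity), add_sq, Real.sq_sqrt (by linarith)]; linarith
  have h3 := mul_le_mul_of_nonneg_left h1 hU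
  have h4 := mul_le_mul_of_nonneg_left h2 hV0
  have h5 : U * s ≤ θ / 2 := (mul_le_mul_of_nonneg_left hsL hU).trans hL
  have h6 := mul_le_mul_of_nonneg_right h5 (Real.sqrt_nonneg j)
  have h7 : V * (Real.sqrt j + 1) = U * Real.sqrt j - θ * Real.sqrt j + V := by rw [hVU]; ring
  linarith

set_option maxHeartbeats 1000000 in
lemma grid_real (x δ c η : ℝ) (hδ : 0 < δ) (hη : 0 < η) : ∀ᶠ K : ℕ in atTop,
    ∀ (σ : Bool) (y : Fin K → ℝ), y ∉ Near K σ (η / K) → y ∉ BadW K σ 1 1 c → y ∉ BadW K σ 1 (J0 K) (Uu K x / 4) →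
    (∀ j : ℕ, J0 K ≤ j → j ≤ J1 K → |S (sd σ (cnt (cell K) y)) j - j| ≤ Uu K (x - δ) * Real.sqrt j) →
    y ∉ BadW K σ (J1 K) (J2 K) (Uu K x / 4) → ∀ s, 0 < s → s ≤ 1 / 2 →
    |Gc σ y s - K * s| ≤ Uu K x * Real.sqrt (K * s * (1 - s)) := by
  have hs2 : 0 < Real.sqrt (η / 2) := Real.sqrt_pos.2 (by positivity)
  filter_upwards [(tendsto_Uu x).eventually_ge_atTop 4, (tendsto_Uu x).eventually_ge_atTop ((1 + c) / Real.sqrt (η / 2)),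
    (tendsto_Uu (x - δ)).eventually_ge_atTop 0, Uu_add, Uu_bounds x, eventually_ge_atTop 1,
    tendsto_aHC.eventually_ge_atTop 1, tendsto_aHC.eventually_ge_atTop (6 / δ), aHC_pow 2 (8 / δ),
    tendsto_logK.eventually_ge_atTop 1, plog 1 1 1 (by norm_num)]
    with K hU hUc hV hadd hUb hK ha ha3 hap hlog hpl σ y hN h1 hlow hmid hhigh s hs0 hs1
  have hK' : (0:ℝ) < K := by exact_mod_cast hK
  rw [div_le_iff₀ hs2] at hUc
  rw [pow_one, Real.rpow_one, one_mul] at hpl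
  set U := Uu K x with hUdef
  set T := (K:ℝ) * s with hT
  have hT0 : 0 < T := by positivity
  set j := ⌊T⌋₊ with hj
  have t1 : (j:ℝ) ≤ T := Nat.floor_le hT0.le
  have t2 : T ≤ j + 1 := (Nat.lt_floor_add_one T).le
  have hsT : s = T / K := by rw [hT]; field_simp
  rcases Nat.eq_zero_or_pos j with hj0 | hjp
  · have hT1 : T ≤ 1 := by rw [hj0] at t2; simpa using t2
    by_cases hTη : T ≤ η
    · have hG : Gc σ y s = 0 := by
        unfold Gc
        refine Finset.sum_eq_zero fun i _ => Set.indicator_of_notMem (fun hi => hN ⟨i, Iv_mono σ ?_ hi⟩) _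
        rw [hsT]; gcongr
      rw [hG, zero_sub, abs_neg, abs_of_pos hT0]
      have : T / 2 ≤ Real.sqrt (T * (1 - s)) := by
        apply Real.le_sqrt_of_sq_le; nlinarith
      nlinarith
    · push Not at hTη
      have b1 := not_BadW h1 (le_refl 1) (le_refl 1)
      rw [S_cnt hK] at b1
      simp only [Nat.cast_one, Real.sqrt_one, mul_one] at b1
      have hG1 : Gc σ y s ≤ Gc σ y (1 / K) := Gc_mono σ y (by rw [hsT]; gcongr)
      have hG0 := Gc_nonneg σ y s
      have b2 := (abs_le.1 b1).2
      have hs3 : Real.sqrt (η / 2) ≤ Real.sqrt (T * (1 - s)) := by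
        apply Real.sqrt_le_sqrt; nlinarith
      have h5 : |Gc σ y s - T| ≤ 1 + c := by
        have := (abs_nonneg _).trans b1
        rw [abs_le]; constructor <;> linarith
      have := mul_le_mul_of_nonneg_left hs3 (show 0 ≤ U by linarith)
      linarith
  · have hj1 : (1:ℝ) ≤ j := by exact_mod_cast hjp
    have g1 : S (sd σ (cnt (cell K) y)) j ≤ Gc σ y s := by
      rw [S_cnt hK]; apply Gc_mono; rw [hsT]; gcongr
    have g2 : Gc σ y s ≤ S (sd σ (cnt (cell K) y)) (j + 1) := by
      rw [S_cnt hK]; apply Gc_mono; rw [hsT]; push_cast; gcongr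
    have hj2 : j + 1 ≤ J2 K := by
      unfold J2
      have : (2 * j : ℝ) ≤ K := by nlinarith
      have : 2 * j ≤ K := by exact_mod_cast this
      omega
    have hsq : Real.sqrt (j:ℝ) ≤ Real.sqrt ((j:ℝ) + 1) := Real.sqrt_le_sqrt (by linarith)
    have fin : ∀ W : ℝ, 0 ≤ W → |S (sd σ (cnt (cell K) y)) j - j| ≤ W * Real.sqrt j →
        |S (sd σ (cnt (cell K) y)) (j + 1) - (j + 1 : ℕ)| ≤ W * Real.sqrt ((j + 1 : ℕ):ℝ) → 
        |Gc σ y s - T| ≤ W * Real.sqrt ((j:ℝ) + 1) + 1 := by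
      intro W hW b1 b2
      push_cast at b2
      exact sandwich g1 g2 t1 t2 (b1.trans (mul_le_mul_of_nonneg_left hsq hW)) b2
    by_cases c1 : j + 1 ≤ J0 K
    · exact (fin (U / 4) (by linarith) (not_BadW hlow hjp (by omega)) (not_BadW hlow (by omega) c1)).trans
        (lev_quarter hU hj1 t1 hs1)
    by_cases c2 : J1 K ≤ j
    · exact (fin (U / 4) (by linarith) (not_BadW hhigh c2 (by omega)) (not_BadW hhigh (by omega) hj2)).trans
        (lev_quarter hU hj1 t1 hs1)
    · have m1 := hmid j (by omega) (by omega)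
      have m2 := hmid (j + 1) (by omega) (by omega)
      have hadd' := hadd x (-δ)
      rw [← sub_eq_add_neg, neg_div, ← sub_eq_add_neg] at hadd'
      have ha0 : 0 < aHC K := by linarith
      have hθ : 0 < δ / aHC K := by positivity
      refine (fin _ hV m1 m2).trans (lev_mid (θ := δ / aHC K) (L := 2 / Real.log K) hV hadd' hθ.le hj1 t1 hs0.le hs1 ?_ ?_ ?_)
      · have e1 : (j:ℝ) + 1 ≤ J1 K := by exact_mod_cast (by omega : j + 1 ≤ J1 K)
        have e2 : (J1 K : ℝ) ≤ K / Real.log K + 1 := (Nat.ceil_lt_add_one (by positivity)).le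
        have hl0 : 0 < Real.log K := by linarith
        have e3 : (1:ℝ) ≤ K / Real.log K := by rw [le_div_iff₀ hl0]; linarith
        rw [hsT, div_le_div_iff₀ hK' hl0]
        have e4 : T ≤ 2 * (K / Real.log K) := by linarith
        calc T * Real.log K ≤ 2 * (K / Real.log K) * Real.log K := by gcongr
          _ = 2 * K := by field_simp
      · have hl0 : 0 < Real.log K := by linarith
        rw [mul_div_assoc', div_div, div_le_div_iff₀ hl0 (by positivity)]
        have e5 : 8 / δ * aHC K ^ 2 * δ = 8 * aHC K ^ 2 := by field_simp
        have e6 := mul_le_mul_of_nonneg_right hap hδ.le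
        have e7 := mul_le_mul_of_nonneg_right hUb.2 ha0.le
        nlinarith
      · have e1 : (J0 K : ℝ) ≤ j := by exact_mod_cast (by omega : J0 K ≤ j)
        have e2 : aHC K ^ 9 ≤ J0 K := Nat.le_ceil _
        have e3 : aHC K ^ 4 ≤ Real.sqrt j := by
          apply Real.le_sqrt_of_sq_le
          calc (aHC K ^ 4) ^ 2 = aHC K ^ 8 := by ring
            _ ≤ aHC K ^ 9 := pow_le_pow_right₀ ha (by norm_num)
            _ ≤ _ := e2.trans e1
        have e4 : δ / aHC K / 2 * aHC K ^ 4 ≤ δ / aHC K / 2 * Real.sqrt j := by gcongr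
        have e5 : δ / aHC K / 2 * aHC K ^ 4 = (δ * aHC K) / 2 * aHC K ^ 2 := by field_simp
        rw [div_le_iff₀ hδ] at ha3
        have e6 : 3 * aHC K ^ 2 ≤ (δ * aHC K) / 2 * aHC K ^ 2 := by
          apply mul_le_mul_of_nonneg_right _ (by positivity); linarith
        have e7 : aHC K ≤ aHC K ^ 2 := by nlinarith
        linarith [hUb.2]

/-! relation with the higher criticism statistic -/

/-- the standardised deviation -/
noncomputable def dev (K : ℕ) (y : Fin K → ℝ) (t : ℝ) : ℝ :=
  |Real.sqrt K * (empCdf K y t - t) / Real.sqrt (t * (1 - t))|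

lemma emp_false {K : ℕ} (hK : 1 ≤ K) {y : Fin K → ℝ} (hy : ∀ i, y i ∈ Set.Ioo (0:ℝ) 1) (t : ℝ) :
    K * empCdf K y t = Gc false y t := by
  have hK' : (0:ℝ) < K := by exact_mod_cast hK
  unfold empCdf Gc
  rw [mul_div_cancel₀ _ hK'.ne']
  refine Finset.sum_congr rfl fun i _ => ?_
  have := (hy i).1
  by_cases h : y i ≤ t <;> simp [Iv, Set.indicator, h, this]

lemma emp_true {K : ℕ} (hK : 1 ≤ K) {y : Fin K → ℝ} (hy : ∀ i, y i ∈ Set.Ioo (0:ℝ) 1) (t : ℝ) :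
    K * empCdf K y t = K - Gc true y (1 - t) := by
  have hK' : (0:ℝ) < K := by exact_mod_cast hK
  unfold empCdf Gc
  rw [mul_div_cancel₀ _ hK'.ne']
  have e : (K:ℝ) = ∑ i : Fin K, (1:ℝ) := by simp
  refine Eq.trans ?_ (congrArg (fun z => z - ∑ i : Fin K, (Iv true (1 - t)).indicator (fun _ => (1:ℝ)) (y i)) e).symm
  rw [← Finset.sum_sub_distrib]
  refine Finset.sum_congr rfl fun i _ => ?_
  have := (hy i).2.le
  by_cases h : y i ≤ t
  · simp [Iv, Set.indicator, h, this, not_lt.2 h]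
  · have h' := h; push Not at h'
    simp [Iv, Set.indicator, h, this, h']

lemma dev_eq {K : ℕ} (hK : 1 ≤ K) (y : Fin K → ℝ) {t : ℝ} (ht : t ∈ Set.Ioo (0:ℝ) 1) (U : ℝ) :
    dev K y t ≤ U ↔ |K * empCdf K y t - K * t| ≤ U * Real.sqrt (K * t * (1 - t)) := by
  have hK' : (0:ℝ) < K := by exact_mod_cast hK
  have hp : 0 < t * (1 - t) := mul_pos ht.1 (by linarith [ht.2])
  have hs := Real.sqrt_pos.2 hp
  have hsK := Real.sqrt_pos.2 hK'
  unfold dev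
  rw [abs_div, abs_of_pos hs, div_le_iff₀ hs, abs_mul, abs_of_pos hsK, ← mul_sub, abs_mul, abs_of_pos hK',
    mul_assoc (K:ℝ), Real.sqrt_mul hK'.le]
  have : (K:ℝ) = Real.sqrt K * Real.sqrt K := (Real.mul_self_sqrt hK'.le).symm
  constructor
  · intro h
    have := mul_le_mul_of_nonneg_left h hsK.le
    calc (K:ℝ) * |empCdf K y t - t| = Real.sqrt K * (Real.sqrt K * |empCdf K y t - t|) := by
          rw [← mul_assoc, Real.mul_self_sqrt hK'.le]
      _ ≤ _ := by linarith
  · intro h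
    apply le_of_mul_le_mul_left _ hsK
    calc Real.sqrt K * (Real.sqrt K * |empCdf K y t - t|) = (K:ℝ) * |empCdf K y t - t| := by
          rw [← mul_assoc, Real.mul_self_sqrt hK'.le]
      _ ≤ _ := by linarith

lemma HC_le_of {K : ℕ} (hK : 1 ≤ K) {y : Fin K → ℝ} (hy : ∀ i, y i ∈ Set.Ioo (0:ℝ) 1) {U : ℝ} 
    (h : ∀ σ s, 0 < s → s ≤ 1 / 2 → |Gc σ y s - K * s| ≤ U * Real.sqrt (K * s * (1 - s))) : HCstat K y ≤ U := by
  unfold HCstat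
  have : Nonempty (Set.Ioo (0:ℝ) 1) := ⟨⟨1/2, by norm_num, by norm_num⟩⟩
  refine ciSup_le fun t => ?_
  change dev K y t.1 ≤ U
  rw [dev_eq hK y t.2]
  rcases le_total t.1 (1/2) with ht | ht
  · rw [emp_false hK hy]; exact h false _ t.2.1 ht
  · rw [emp_true hK hy]
    have := h true (1 - t.1) (by linarith [t.2.2]) (by linarith)
    rw [abs_sub_comm] at this
    convert this using 2
    · ring
    · congr 1; ring

lemma emp_bounds {K : ℕ} (hK : 1 ≤ K) (y : Fin K → ℝ) (t : ℝ) : 0 ≤ empCdf K y t ∧ empCdf K y t ≤ 1 := by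
  have hK' : (0:ℝ) < K := by exact_mod_cast hK
  unfold empCdf
  constructor
  · apply div_nonneg _ hK'.le
    exact Finset.sum_nonneg fun i _ => by split_ifs <;> norm_num
  · rw [div_le_one hK']
    calc _ ≤ ∑ i : Fin K, (1:ℝ) := Finset.sum_le_sum fun i _ => by split_ifs <;> norm_num
      _ = K := by simp

lemma bdd_dev {K : ℕ} (hK : 1 ≤ K) {y : Fin K → ℝ} (hy : ∀ i, y i ∈ Set.Ioo (0:ℝ) 1) :
    BddAbove (Set.range fun t : Set.Ioo (0:ℝ) 1 => dev K y t.1) := by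
  have hK' : (0:ℝ) < K := by exact_mod_cast hK
  obtain ⟨m, hm0, hm2, hm⟩ : ∃ m : ℝ, 0 < m ∧ m ≤ 1 / 2 ∧ ∀ i, m ≤ y i ∧ m ≤ 1 - y i := by
    have h1 : ∀ᶠ m : ℝ in 𝓝[>] 0, ∀ i, m ≤ y i ∧ m ≤ 1 - y i := by
      rw [eventually_all]
      intro i
      have a1 : ∀ᶠ m : ℝ in 𝓝[>] 0, m ≤ y i := (tendsto_nhdsWithin_of_tendsto_nhds tendsto_id).eventually (ge_mem_nhds (hy i).1)
      have a2 : ∀ᶠ m : ℝ in 𝓝[>] 0, m ≤ 1 - y i := (tendsto_nhdsWithin_of_tendsto_nhds tendsto_id).eventually (ge_mem_nhds (by linarith [(hy i).2]))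
      exact a1.and a2
    have h2 : ∀ᶠ m : ℝ in 𝓝[>] 0, m ≤ 1 / 2 := (tendsto_nhdsWithin_of_tendsto_nhds tendsto_id).eventually (ge_mem_nhds (by norm_num))
    obtain ⟨m, ⟨q1, q2⟩, q3⟩ := ((h1.and h2).and self_mem_nhdsWithin).exists
    exact ⟨m, q3, q2, q1⟩
  refine ⟨Real.sqrt K / m, ?_⟩
  rintro _ ⟨t, rfl⟩
  have ht := t.2
  have hsK := Real.sqrt_pos.2 hK'
  simp only
  rw [dev_eq hK y ht, mul_assoc, Real.sqrt_mul hK'.le, ← mul_sub, abs_mul, abs_of_pos hK']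
  have e : Real.sqrt K / m * (Real.sqrt K * Real.sqrt (t.1 * (1 - t.1))) = K * (Real.sqrt (t.1 * (1 - t.1)) / m) := by
    rw [show Real.sqrt K / m * (Real.sqrt K * Real.sqrt (t.1 * (1 - t.1))) = (Real.sqrt K * Real.sqrt K) * (Real.sqrt (t.1 * (1 - t.1)) / m) by ring,
      Real.mul_self_sqrt hK'.le]
  rw [e]
  refine mul_le_mul_of_nonneg_left ?_ hK'.le
  rw [le_div_iff₀ hm0]
  apply Real.le_sqrt_of_sq_le
  obtain ⟨f0, f1⟩ := emp_bounds hK y t.1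
  have h01 : 0 < 1 - t.1 := by linarith [ht.2]
  by_cases c1 : t.1 < m
  · have hF : empCdf K y t.1 = 0 := by
      unfold empCdf
      rw [Finset.sum_eq_zero, zero_div]
      intro i _; rw [if_neg]; linarith [(hm i).1]
    rw [hF, zero_sub, abs_neg, abs_of_pos ht.1]
    have : t.1 * m ≤ 1 - t.1 := by nlinarith [ht.1]
    have h3 : t.1 * m * m ≤ 1 - t.1 := by nlinarith [mul_pos ht.1 hm0]
    have := mul_le_mul_of_nonneg_left h3 ht.1.le
    linarith
  by_cases c2 : 1 - t.1 < m
  · have hF : empCdf K y t.1 = 1 := by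
      unfold empCdf
      rw [Finset.sum_congr rfl (g := fun _ => (1:ℝ)), Finset.sum_const, Finset.card_univ, Fintype.card_fin, nsmul_eq_mul, mul_one, div_self hK'.ne']
      intro i _; rw [if_pos]; linarith [(hm i).2]
    rw [hF, abs_of_pos h01]
    have h3 : (1 - t.1) * m * m ≤ t.1 := by
      have : (1 - t.1) * m * m ≤ 1 * m * m := by gcongr; linarith
      nlinarith
    have := mul_le_mul_of_nonneg_left h3 h01.le
    linarith
  · push Not at c1 c2
    have h3 : |empCdf K y t.1 - t.1| ≤ 1 := abs_le.2 ⟨by linarith [ht.1, ht.2], by linarith [ht.1]⟩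
    calc (|empCdf K y t.1 - t.1| * m) ^ 2 ≤ (1 * m) ^ 2 := by gcongr
      _ = m * m := by ring
      _ ≤ _ := mul_le_mul c1 c2 hm0.le ht.1.le

lemma grid_of_HC {K : ℕ} (hK : 1 ≤ K) {y : Fin K → ℝ} (hy : ∀ i, y i ∈ Set.Ioo (0:ℝ) 1) {U : ℝ} (hU : 0 ≤ U)
    (h : HCstat K y ≤ U) (σ : Bool) (j : ℕ) (hj1 : 1 ≤ j) (hj : j < K) :
    |S (sd σ (cnt (cell K) y)) j - j| ≤ U * Real.sqrt j := by
  have hK' : (0:ℝ) < K := by exact_mod_cast hK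
  have hj0 : (0:ℝ) < j := by exact_mod_cast hj1
  have hjK : (j:ℝ) < K := by exact_mod_cast hj
  have hs0 : 0 < (j:ℝ) / K := by positivity
  have hs1 : (j:ℝ) / K < 1 := by rwa [div_lt_one hK']
  have hall : ∀ t : Set.Ioo (0:ℝ) 1, dev K y t.1 ≤ U := fun t => (le_ciSup (bdd_dev hK hy) t).trans h
  rw [S_cnt hK]
  have hKs : (K:ℝ) * (j / K) = j := by field_simp
  have fin : |Gc σ y ((j:ℝ) / K) - j| ≤ U * Real.sqrt (j * (1 - j / K)) := by
    cases σ
    · have := hall ⟨(j:ℝ) / K, hs0, hs1⟩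
      rw [dev_eq hK y ⟨hs0, hs1⟩, emp_false hK hy] at this
      simp only [hKs] at this
      exact this
    · have ht : 1 - (j:ℝ) / K ∈ Set.Ioo (0:ℝ) 1 := ⟨by linarith, by linarith⟩
      have := hall ⟨1 - (j:ℝ) / K, ht⟩
      rw [dev_eq hK y ht, emp_true hK hy] at this
      simp only [sub_sub_cancel] at this
      rw [abs_sub_comm] at this
      have e1 : (K:ℝ) * (1 - j / K) - (K - Gc true y (j / K)) = Gc true y (j / K) - j := by
        rw [mul_sub, hKs]; ring
      have e2 : (K:ℝ) * (1 - j / K) * (j / K) = j * (1 - j / K) := by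
        calc (K:ℝ) * (1 - j / K) * (j / K) = (K * (j / K)) * (1 - j / K) := by ring
          _ = _ := by rw [hKs]
      rwa [e1, e2] at this
  refine fin.trans (mul_le_mul_of_nonneg_left (Real.sqrt_le_sqrt ?_) hU)
  nlinarith

end HC

namespace HC
open MeasureTheory Filter Topology ProbabilityTheory
open scoped ENNReal NNReal

lemma J_one (K : ℕ) : J 1 K = K := by unfold J; rw [Real.rpow_one, Nat.ceil_natCast]

lemma J_frac (f : ℝ) (hf : 0 < f) (hf1 : f < 1) (A : ℝ) (hA : 0 < A) : ∀ᶠ K : ℕ in atTop, A * Real.log K * J f K ≤ K := by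
  filter_upwards [J_sep f 1 hf.le hf1 A 1 hA.le] with K h
  rwa [pow_one, J_one] at h

lemma J0_le_J (f : ℝ) (hf : 0 < f) : ∀ᶠ K : ℕ in atTop, J0 K ≤ J f K := by
  filter_upwards [J0_le, aHC_pow 9 2, J_large f hf 1 1] with K h1 h2 h3
  rw [pow_one, one_mul] at h3
  exact_mod_cast (h1.trans h2).trans h3

lemma J0_pos : ∀ᶠ K : ℕ in atTop, 1 ≤ J0 K := by
  filter_upwards [tendsto_aHC.eventually_ge_atTop 1] with K h
  exact Nat.ceil_pos.2 (by positivity)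

lemma three_J (f : ℝ) (hf : 0 < f) (hf1 : f < 1) : ∀ᶠ K : ℕ in atTop, 3 * J f K ≤ 2 * K := by
  filter_upwards [J_frac f hf hf1 3 (by norm_num), tendsto_logK.eventually_ge_atTop 1] with K h1 h2
  have h3 : (0:ℝ) ≤ J f K := by positivity
  have h4 : (3 * J f K : ℝ) ≤ 2 * K := by
    have h5 : 3 * 1 * (J f K : ℝ) ≤ 3 * Real.log K * J f K := by gcongr
    have : (0:ℝ) ≤ K := by positivity
    linarith
  exact_mod_cast h4

lemma gapA (x h ρ : ℝ) (h0 : 0 < h) (h1 : h < 1) (hρ : 0 < ρ) : ∀ᶠ K : ℕ in atTop, ∀ σ,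
    (PK K).real (BadW K σ (J0 K) (J h K) (Uu K x)) ≤ 6 * (Real.exp (-x) * (2 * h)) + ρ := by
  filter_upwards [gap_mid x (2 * h) ρ (by positivity) hρ, J0_le_J h h0, three_J h h0 h1, J0_pos,
    eventually_ge_atTop 2, tendsto_logK.eventually_ge_atTop 1] with K g1 g2 g3 g4 g5 g6 σ
  refine g1 σ _ _ g2 le_rfl g3 ?_
  have hK : (0:ℝ) < K := by exact_mod_cast (by omega : 0 < K)
  have a1 : (1:ℝ) ≤ J0 K := by exact_mod_cast g4
  have a2 : (1:ℝ) ≤ J h K := by exact_mod_cast g4.trans g2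
  have a3 := J_upper2 h h0.le K (by omega)
  have hp : 0 < (K:ℝ) ^ h := Real.rpow_pos_of_pos hK h
  calc Real.log ((J h K : ℝ) / J0 K) ≤ Real.log (2 * (K:ℝ) ^ h) := by
        apply Real.log_le_log (by positivity)
        exact (div_le_self (by positivity) a1).trans a3
    _ = Real.log 2 + h * Real.log K := by rw [Real.log_mul (by norm_num) hp.ne', Real.log_rpow hK]
    _ ≤ _ := by
        have := Real.log_two_lt_d9
        have : 0 ≤ h * Real.log K := by positivity
        linarith

lemma gapB (x f h ρ : ℝ) (h0 : 0 < h) (h1 : 0 < f - h) (h2 : f + h < 1) (hρ : 0 < ρ) : ∀ᶠ K : ℕ in atTop, ∀ σ,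
    (PK K).real (BadW K σ (J (f - h) K) (J (f + h) K) (Uu K x)) ≤ 6 * (Real.exp (-x) * (2 * h)) + ρ := by
  filter_upwards [gap_mid x (2 * h) ρ (by positivity) hρ, J0_le_J (f - h) h1, three_J (f + h) (by linarith) h2,
    eventually_ge_atTop 2] with K g1 g2 g3 g5 σ
  refine g1 σ _ _ (J_mono (by omega) (by linarith)) g2 g3 ?_
  have a1 : (0:ℝ) ≤ J (f - h) K := by positivity
  have a2 : (0:ℝ) ≤ J (f + h) K := by positivity
  have := (log_ratio_bounds g5 h1.le (by linarith : 0 ≤ f + h) (by linarith) (by linarith) (by linarith) (by linarith) :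
    Real.log ((J (f + h) K : ℝ) / J (f - h) K) ≤ _ ∧ _).1
  linarith [this, (by ring : (f + h - (f - h)) * Real.log K = 2 * h * Real.log K)]

lemma gapC (x h ρ : ℝ) (h0 : 0 < h) (h1 : h < 1) (hρ : 0 < ρ) : ∀ᶠ K : ℕ in atTop, ∀ σ,
    (PK K).real (BadW K σ (J (1 - h) K) (J1 K) (Uu K x)) ≤ 6 * (Real.exp (-x) * (2 * h)) + ρ := by
  filter_upwards [gap_mid x (2 * h) ρ (by positivity) hρ, J0_le_J (1 - h) (by linarith), 
    J_frac (1 - h) (by linarith) (by linarith) 1 one_pos, J0_pos,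
    eventually_ge_atTop 4, tendsto_logK.eventually_ge_atTop 4] with K g1 g2 g3 g4 g5 g6 σ
  have hK : (4:ℝ) ≤ K := by exact_mod_cast g5
  have hK0 : (0:ℝ) < K := by linarith
  have a1 : (J1 K : ℝ) ≤ K / Real.log K + 1 := (Nat.ceil_lt_add_one (by positivity)).le
  have a2 : (K:ℝ) / Real.log K ≤ K / 4 := by gcongr
  have a3 : (J (1 - h) K : ℝ) ≤ J1 K := by
    refine le_trans ?_ (Nat.le_ceil _)
    rw [le_div_iff₀ (by linarith)]; linarith
  have a4 : (3 * J1 K : ℝ) ≤ 2 * K := by linarith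
  have a5 : (1:ℝ) ≤ J (1 - h) K := by exact_mod_cast g4.trans g2
  refine g1 σ _ _ (by exact_mod_cast a3) g2 (by exact_mod_cast a4) ?_
  have a6 := J_lower (1 - h) K
  have hp : 0 < (K:ℝ) ^ (1 - h) := Real.rpow_pos_of_pos hK0 _
  have a7 : (J1 K : ℝ) ≤ K := by linarith
  calc Real.log ((J1 K : ℝ) / J (1 - h) K) ≤ Real.log ((K:ℝ) / (K:ℝ) ^ (1 - h)) := by
        apply Real.log_le_log (div_pos (by linarith) (by linarith))
        gcongr
    _ = h * Real.log K := by 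
        rw [Real.log_div hK0.ne' hp.ne', Real.log_rpow hK0]; ring
    _ ≤ _ := by
        have : 0 ≤ h * Real.log K := by positivity
        linarith

/-- partition of the exponent range -/
noncomputable def ee (κ : ℝ) (m b : ℕ) : ℝ := if b ≤ m then (1 - κ) * b / m else (1 - κ) + κ * (b - m) / m

lemma ee_zero (κ : ℝ) (m : ℕ) : ee κ m 0 = 0 := by simp [ee]

lemma ee_mid (κ : ℝ) {m : ℕ} (hm : 0 < m) : ee κ m m = 1 - κ := by
  have : (m:ℝ) ≠ 0 := by exact_mod_cast hm.ne'
  simp [ee, this]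

lemma ee_last (κ : ℝ) {m : ℕ} (hm : 0 < m) : ee κ m (2 * m) = 1 := by
  have h0 : (m:ℝ) ≠ 0 := by exact_mod_cast hm.ne'
  have : ¬ 2 * m ≤ m := by omega
  simp only [ee, this, if_false]; push_cast; field_simp; ring

lemma ee_step (κ : ℝ) {m : ℕ} (hm : 0 < m) (b : ℕ) :
    ee κ m (b + 1) - ee κ m b = (1 - κ) / m ∨ ee κ m (b + 1) - ee κ m b = κ / m := by
  have h0 : (m:ℝ) ≠ 0 := by exact_mod_cast hm.ne'
  rcases lt_trichotomy b m with h | h | h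
  · left
    have h1 : b + 1 ≤ m := h
    simp only [ee, h1, h.le, if_true]; push_cast; field_simp; ring
  · right
    subst h
    rw [ee_mid κ hm]
    have : ¬ b + 1 ≤ b := by omega
    simp only [ee, this, if_false]; push_cast; field_simp; ring
  · right
    have h1 : ¬ b + 1 ≤ m := by omega
    have h2 : ¬ b ≤ m := by omega
    simp only [ee, h1, h2, if_false]; push_cast; field_simp; ring

lemma ee_step_bd {κ : ℝ} (hκ : κ ∈ Set.Ioo (0:ℝ) 1) {m : ℕ} (hm : 0 < m) (b : ℕ) :
    min κ (1 - κ) / m ≤ ee κ m (b + 1) - ee κ m b ∧ ee κ m (b + 1) - ee κ m b ≤ 1 / m := by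
  have h0 : (0:ℝ) < m := by exact_mod_cast hm
  rcases ee_step κ hm b with h | h <;> rw [h]
  · exact ⟨by gcongr; exact min_le_right _ _, by gcongr; linarith [hκ.1]⟩
  · exact ⟨by gcongr; exact min_le_left _ _, by gcongr; exact hκ.2.le⟩

lemma ee_mono {κ : ℝ} (hκ : κ ∈ Set.Ioo (0:ℝ) 1) {m : ℕ} (hm : 0 < m) : Monotone (ee κ m) := by
  refine monotone_nat_of_le_succ fun b => ?_
  have h := (ee_step_bd hκ hm b).1
  have h0 : (0:ℝ) < m := by exact_mod_cast hm
  have : 0 < min κ (1 - κ) := lt_min hκ.1 (by linarith [hκ.2])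
  have : 0 < min κ (1 - κ) / m := by positivity
  linarith

/-- good ranges for the rates -/
def Good (k : ℕ → ℕ) (ν : ℕ → Measure ℝ) (κ : ℝ) : Prop :=
  ∀ f g : ℝ, 0 < f → f ≤ g → g < 1 → (g < 1 - κ ∨ 1 - κ < f) → ∀ σ, 
    Close k (fun n => sd σ (rate (k n) (ν n))) f g

section blocks
variable {κ : ℝ} {m : ℕ} {h : ℝ}

lemma blk_ee (hκ : κ ∈ Set.Ioo (0:ℝ) 1) (hm : 0 < m) (h0 : 0 < h) (h4 : 4 * h < min κ (1 - κ) / m) :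
    Blk (2 * m) (fun b => ee κ m b + h / 2) (fun b => ee κ m b + h) (fun b => ee κ m (b + 1) - h) := by
  have hmono := ee_mono hκ hm
  refine ⟨fun b hb => ⟨?_, by linarith, ?_, ?_⟩, fun b c hbc hc => ?_⟩
  · have := hmono (Nat.zero_le b); rw [ee_zero] at this; linarith
  · have := (ee_step_bd hκ hm b).1; linarith
  · have : ee κ m (b + 1) ≤ ee κ m (2 * m) := hmono hb
    rw [ee_last κ hm] at this; linarith
  · have := hmono (show b + 1 ≤ c from hbc); simp only; linarith

lemma close_ee {k : ℕ → ℕ} {ν : ℕ → Measure ℝ} (hG : Good k ν κ)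
    (hκ : κ ∈ Set.Ioo (0:ℝ) 1) (hm : 0 < m) (h0 : 0 < h) (h4 : 4 * h < min κ (1 - κ) / m) (σ : Bool) (b : ℕ) (hb : b < 2 * m) :
    Close k (fun n => sd σ (rate (k n) (ν n))) (ee κ m b + h / 2) (ee κ m (b + 1) - h) := by
  have hmono := ee_mono hκ hm
  have hB := (blk_ee hκ hm h0 h4).1 b hb
  simp only at hB
  have e1 : ee κ m (b + 1) ≤ ee κ m (2 * m) := hmono hb
  rw [ee_last κ hm] at e1
  refine hG _ _ hB.1 (by linarith [hB.2.1, hB.2.2.1]) (by linarith) ?_ σ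
  rcases lt_or_ge b m with hbm | hbm
  · left
    have := hmono (show b + 1 ≤ m from hbm)
    rw [ee_mid κ hm] at this; linarith
  · right
    have := hmono hbm
    rw [ee_mid κ hm] at this; linarith

lemma sum_ee (hm : 0 < m) : ∑ b ∈ Finset.range (2 * m), ((ee κ m (b + 1) - h) - (ee κ m b + h)) = 1 - 4 * m * h := by
  have : ∀ b ∈ Finset.range (2 * m), ((ee κ m (b + 1) - h) - (ee κ m b + h)) = (ee κ m (b + 1) - ee κ m b) - 2 * h :=
    fun b _ => by ring
  rw [Finset.sum_congr rfl this, Finset.sum_sub_distrib, Finset.sum_range_sub, ee_last κ hm, ee_zero]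
  simp; ring

lemma width_ee (hκ : κ ∈ Set.Ioo (0:ℝ) 1) (hm : 0 < m) (h0 : 0 < h) (b : ℕ) :
    (ee κ m (b + 1) - h) - (ee κ m b + h) ≤ 1 / m := by
  have := (ee_step_bd hκ hm b).2; linarith

/-- lower end of gap -/
noncomputable def lo (κ : ℝ) (m : ℕ) (h : ℝ) (K b : ℕ) : ℕ := if b = 0 then J0 K else J (ee κ m b - h) K
/-- upper end of gap -/
noncomputable def hi (κ : ℝ) (m : ℕ) (h : ℝ) (K b : ℕ) : ℕ := if b = 2 * m then J1 K else J (ee κ m b + h) K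

lemma cover {K j : ℕ} (hj : J0 K ≤ j) : ∀ b, b ≤ 2 * m → j ≤ hi κ m h K b →
    (∃ c, c ≤ 2 * m ∧ lo κ m h K c ≤ j ∧ j ≤ hi κ m h K c) ∨
    (∃ c, c < 2 * m ∧ J (ee κ m c + h) K ≤ j ∧ j ≤ J (ee κ m (c + 1) - h) K) := by
  intro b
  induction b with
  | zero => intro _ h2; exact Or.inl ⟨0, by omega, by simpa [lo] using hj, h2⟩
  | succ b ih =>
    intro h1 h2
    by_cases h3 : j ≤ hi κ m h K b
    · exact ih (by omega) h3
    · push Not at h3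
      have e : hi κ m h K b = J (ee κ m b + h) K := by simp [hi, show b ≠ 2 * m by omega]
      rw [e] at h3
      by_cases h4 : j ≤ J (ee κ m (b + 1) - h) K
      · exact Or.inr ⟨b, by omega, h3.le, h4⟩
      · push Not at h4
        refine Or.inl ⟨b + 1, h1, ?_, h2⟩
        simpa [lo] using h4.le

lemma gap_all (x ρ : ℝ) (hρ : 0 < ρ) (hκ : κ ∈ Set.Ioo (0:ℝ) 1) (hm : 0 < m) (h0 : 0 < h) 
    (h4 : 4 * h < min κ (1 - κ) / m) : ∀ᶠ K : ℕ in atTop, ∀ b ∈ Finset.range (2 * m + 1), ∀ σ,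
    (PK K).real (BadW K σ (lo κ m h K b) (hi κ m h K b) (Uu K x)) ≤ 6 * (Real.exp (-x) * (2 * h)) + ρ := by
  rw [Filter.eventually_all_finset]
  intro b hb
  have hb := Finset.mem_range.1 hb
  have hmono := ee_mono hκ hm
  have hB0 := (blk_ee hκ hm h0 h4).1 0 (by omega)
  simp only [ee_zero, zero_add] at hB0
  have hh1 : h < 1 := by
    have e1 : ee κ m 1 ≤ ee κ m (2 * m) := hmono (by omega)
    rw [ee_last κ hm] at e1; linarith [hB0.2.2.1]
  rcases Nat.eq_zero_or_pos b with rfl | hpos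
  · have e1 : ∀ K, lo κ m h K 0 = J0 K := fun K => by simp [lo]
    have e2 : ∀ K, hi κ m h K 0 = J h K := fun K => by simp [hi, ee_zero, show m ≠ 0 by omega]
    simp only [e1, e2]
    exact gapA x h ρ h0 hh1 hρ
  · rcases Nat.lt_or_ge b (2 * m) with hlt | hge
    · have e1 : ∀ K, lo κ m h K b = J (ee κ m b - h) K := fun K => by simp [lo, show b ≠ 0 by omega]
      have e2 : ∀ K, hi κ m h K b = J (ee κ m b + h) K := fun K => by simp [hi, show b ≠ 2 * m by omega]
      simp only [e1, e2]
      refine gapB x _ h ρ h0 ?_ ?_ hρ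
      · have := hmono (show 1 ≤ b from hpos); linarith [hB0.2.2.1, hB0.1]
      · have a1 := ((blk_ee hκ hm h0 h4).1 b hlt).2.2.1
        have e1 : ee κ m (b + 1) ≤ ee κ m (2 * m) := hmono hlt
        rw [ee_last κ hm] at e1; simp only at a1; linarith
    · have hb2 : b = 2 * m := by omega
      have e1 : ∀ K, lo κ m h K b = J (1 - h) K := fun K => by 
        simp only [lo, show b ≠ 0 by omega, if_false]; rw [hb2, ee_last κ hm]
      have e2 : ∀ K, hi κ m h K b = J1 K := fun K => by simp [hi, hb2]
      simp only [e1, e2]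
      exact gapC x h ρ h0 hh1 hρ

end blocks

end HC

namespace HC
open MeasureTheory Filter Topology ProbabilityTheory
open scoped ENNReal NNReal

/-- everything the final argument needs -/
structure Setup (k : ℕ → ℕ) (ν : ℕ → Measure ℝ) (κ : ℝ) : Prop where
  hk : Tendsto k atTop atTop
  hν : ∀ n, IsProbabilityMeasure (ν n)
  hκ : κ ∈ Set.Ioo (0:ℝ) 1
  good : Good k ν κ
  mass : ∀ h : ℝ, 0 < h → h < 1 → ∀ σ, Tendsto (fun n => (ν n).real (Iv σ ((J (1 - h) (k n) : ℝ) / k n))) atTop (𝓝 0)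
  ct : ∀ ρ : ℝ, 0 < ρ → ∃ D : ℝ, 0 < D ∧ ∀ᶠ n in atTop, ∀ A : Set (Fin (k n) → ℝ), MeasurableSet A →
    (PK (k n)).real A ≤ D → (Measure.pi (fun _ : Fin (k n) => ν n)).real A ≤ ρ
  nul : ∀ n, (Measure.pi (fun _ : Fin (k n) => ν n)).real {y | ∀ i, y i ∈ Set.Ioo (0:ℝ) 1}ᶜ = 0

lemma h_lt_one {κ h : ℝ} {m : ℕ} (hκ : κ ∈ Set.Ioo (0:ℝ) 1) (hm : 0 < m) (h4 : 4 * h < min κ (1 - κ) / m) : h < 1 := by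
  have h1 : min κ (1 - κ) / m ≤ min κ (1 - κ) := by
    apply div_le_self
    · exact le_min hκ.1.le (by linarith [hκ.2])
    · exact_mod_cast hm
  have h2 := min_le_left κ (1 - κ)
  linarith [hκ.2]

lemma cmp_blocks {k : ℕ → ℕ} {ν : ℕ → Measure ℝ} {κ : ℝ} (hS : Setup k ν κ) {m : ℕ} {h : ℝ} (hm : 0 < m) (h0 : 0 < h)
    (h4 : 4 * h < min κ (1 - κ) / m) (ρ : ℝ) (hρ : 0 < ρ) : ∀ᶠ n in atTop, ∀ V : ℝ,
    |(Measure.pi (fun _ : Fin (k n) => ν n)).real {y | cnt (cell (k n)) y ∈ 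
      Ebl (k n) (2 * m) (fun b => ee κ m b + h) (fun b => ee κ m (b + 1) - h) V} - 
      (IP (rate (k n) (ν n))).real (Ebl (k n) (2 * m) (fun b => ee κ m b + h) (fun b => ee κ m (b + 1) - h) V)| ≤ ρ := by
  have hh1 := h_lt_one hS.hκ hm h4
  have hM : ∀ᶠ n in atTop, 2 * J (1 - h) (k n) ≤ k n := by
    filter_upwards [hS.hk.eventually (three_J (1 - h) (by linarith) (by linarith)), 
      hS.hk.eventually (J_frac (1 - h) (by linarith) (by linarith) 2 (by norm_num)),
      hS.hk.eventually (tendsto_logK.eventually_ge_atTop 1)] with n g1 g2 g3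
    have h3 : (0:ℝ) ≤ J (1 - h) (k n) := by positivity
    have h5 : 2 * 1 * (J (1 - h) (k n) : ℝ) ≤ 2 * Real.log (k n) * J (1 - h) (k n) := by gcongr
    have : (2 * J (1 - h) (k n) : ℝ) ≤ k n := by linarith
    exact_mod_cast this
  filter_upwards [compareQ hS.hk ν hS.hν _ hM (hS.mass h h0 hh1) ρ hρ, hS.hk.eventually_ge_atTop 1] with n g1 g2 V
  refine g1 _ (dep_Ebl _ _ _ _ _ _ fun b hb => J_mono g2 ?_)
  have : ee κ m (b + 1) ≤ ee κ m (2 * m) := ee_mono hS.hκ hm hb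
  rw [ee_last κ hm] at this; linarith

lemma J_pos {f : ℝ} {K : ℕ} (hK : 1 ≤ K) : 1 ≤ J f K := 
  Nat.ceil_pos.2 (Real.rpow_pos_of_pos (by exact_mod_cast hK) f)

lemma upper {k : ℕ → ℕ} {ν : ℕ → Measure ℝ} {κ : ℝ} (hS : Setup k ν κ) (x θ : ℝ) (hθ : 0 < θ) : ∀ᶠ n in atTop, 
    (Measure.pi (fun _ : Fin (k n) => ν n)).real {y | HCstat (k n) y ≤ Uu (k n) x} ≤ Real.exp (-2 * Real.exp (-x)) + θ := by
  obtain ⟨z, hz0, hz1, hz⟩ : ∃ z : ℝ, 0 < z ∧ z < 1 ∧ 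
      Real.exp (-(2 * ((1 - z) * (Real.exp (-(x + z)) * (1 - z))))) ≤ Real.exp (-2 * Real.exp (-x)) + θ / 3 := by
    have hc : Tendsto (fun z : ℝ => Real.exp (-(2 * ((1 - z) * (Real.exp (-(x + z)) * (1 - z)))))) (𝓝[>] 0) 
        (𝓝 (Real.exp (-(2 * ((1 - 0) * (Real.exp (-(x + 0)) * (1 - 0))))))) := by
      refine tendsto_nhdsWithin_of_tendsto_nhds (Continuous.tendsto (by fun_prop) 0)
    have e : Real.exp (-(2 * ((1 - 0) * (Real.exp (-(x + 0)) * (1 - 0))))) = Real.exp (-2 * Real.exp (-x)) := by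
      congr 1; simp
    rw [e] at hc
    obtain ⟨z, a, b⟩ := ((hc.eventually (ge_mem_nhds (show _ < Real.exp (-2 * Real.exp (-x)) + θ / 3 by linarith))).and 
      (Ioo_mem_nhdsGT (show (0:ℝ) < 1 by norm_num))).exists
    exact ⟨z, b.1, b.2, a⟩
  obtain ⟨w0, hw0, hcore⟩ := core_upper x z z hz0 hz0 hz1
  obtain ⟨m, hm, hmw⟩ : ∃ m : ℕ, 0 < m ∧ 1 / (m:ℝ) ≤ w0 := by
    obtain ⟨m, hm⟩ := exists_nat_one_div_lt hw0
    exact ⟨m + 1, by omega, by push_cast; exact hm.le⟩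
  have hm' : (0:ℝ) < m := by exact_mod_cast hm
  set w := min κ (1 - κ) with hw
  have hwpos : 0 < w := lt_min hS.hκ.1 (by linarith [hS.hκ.2])
  have hw1 : w ≤ 1 := (min_le_left _ _).trans hS.hκ.2.le
  obtain ⟨h, h0, h4, hz4⟩ : ∃ h : ℝ, 0 < h ∧ 4 * h < w / m ∧ 4 * m * h ≤ z := by
    refine ⟨z * w / (8 * m), by positivity, ?_, ?_⟩
    · rw [lt_div_iff₀ hm']; field_simp; linarith
    · field_simp; nlinarith
  filter_upwards [hcore hS.hk (l := fun n => rate (k n) (ν n)) (blk_ee hS.hκ hm h0 h4) 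
      (fun σ b hb => close_ee hS.good hS.hκ hm h0 h4 σ b hb) (fun b _ => (width_ee hS.hκ hm h0 b).trans hmw) (θ / 3) (by positivity),
    cmp_blocks hS hm h0 h4 (θ / 3) (by positivity), hS.hk.eventually_ge_atTop 1,
    hS.hk.eventually ((tendsto_Uu x).eventually_ge_atTop 0), 
    hS.hk.eventually (three_J (1 - h) (by linarith [h_lt_one hS.hκ hm h4]) (by linarith))] with n g1 g2 g3 g4 g5
  have := hS.hν n
  rw [sum_ee hm] at g1
  have hsub : {y | HCstat (k n) y ≤ Uu (k n) x} ⊆ {y | cnt (cell (k n)) y ∈ 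
      Ebl (k n) (2 * m) (fun b => ee κ m b + h) (fun b => ee κ m (b + 1) - h) (Uu (k n) x)} ∪ {y | ∀ i, y i ∈ Set.Ioo (0:ℝ) 1}ᶜ := by
    intro y hy
    by_cases hy1 : ∀ i, y i ∈ Set.Ioo (0:ℝ) 1
    · left
      intro σ b hb j hj1 hj2
      refine grid_of_HC g3 hy1 g4 hy σ j ((J_pos g3).trans hj1) ?_
      have : ee κ m (b + 1) ≤ ee κ m (2 * m) := ee_mono hS.hκ hm hb
      rw [ee_last κ hm] at this
      have := J_mono g3 (show ee κ m (b + 1) - h ≤ 1 - h by linarith)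
      simp only at hj2
      omega
    · right; exact hy1
  have b1 := measureReal_mono (μ := Measure.pi (fun _ : Fin (k n) => ν n)) hsub
  have b2 := measureReal_union_le (μ := Measure.pi (fun _ : Fin (k n) => ν n)) {y | cnt (cell (k n)) y ∈ 
      Ebl (k n) (2 * m) (fun b => ee κ m b + h) (fun b => ee κ m (b + 1) - h) (Uu (k n) x)} {y | ∀ i, y i ∈ Set.Ioo (0:ℝ) 1}ᶜ
  rw [hS.nul n] at b2
  have b3 := (abs_le.1 (g2 (Uu (k n) x))).2
  have b4 : Real.exp (-(2 * ((1 - z) * (Real.exp (-(x + z)) * (1 - 4 * m * h))))) ≤ 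
      Real.exp (-(2 * ((1 - z) * (Real.exp (-(x + z)) * (1 - z))))) := by
    apply Real.exp_le_exp.2
    have : 0 ≤ 1 - z := by linarith
    have : (1 - z) * (Real.exp (-(x + z)) * (1 - z)) ≤ (1 - z) * (Real.exp (-(x + z)) * (1 - 4 * m * h)) := by gcongr
    linarith
  linarith

/-- the exceptional set on one side -/
def BadS (κ : ℝ) (m : ℕ) (h x δ c η : ℝ) (K : ℕ) (σ : Bool) : Set (Fin K → ℝ) :=
  (((Near K σ (η / K) ∪ BadW K σ 1 1 c) ∪ BadW K σ 1 (J0 K) (Uu K x / 4)) ∪ BadW K σ (J1 K) (J2 K) (Uu K x / 4)) ∪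
    ⋃ b ∈ Finset.range (2 * m + 1), BadW K σ (lo κ m h K b) (hi κ m h K b) (Uu K (x - δ))

lemma meas_BadS (κ : ℝ) (m : ℕ) (h x δ c η : ℝ) (K : ℕ) (σ : Bool) : MeasurableSet (BadS κ m h x δ c η K σ) := by
  refine ((((meas_Near _ _ _).union (meas_BadW _ _ _ _ _)).union (meas_BadW _ _ _ _ _)).union (meas_BadW _ _ _ _ _)).union ?_
  exact Finset.measurableSet_biUnion _ fun b _ => meas_BadW _ _ _ _ _

lemma BadS_le (κ : ℝ) (m : ℕ) (h x δ c η : ℝ) (K : ℕ) (σ : Bool) (ρ τ : ℝ)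
    (h1 : (PK K).real (Near K σ (η / K)) ≤ ρ) (h2 : (PK K).real (BadW K σ 1 1 c) ≤ ρ)
    (h3 : (PK K).real (BadW K σ 1 (J0 K) (Uu K x / 4)) ≤ ρ) (h4 : (PK K).real (BadW K σ (J1 K) (J2 K) (Uu K x / 4)) ≤ ρ)
    (h5 : ∀ b ∈ Finset.range (2 * m + 1), (PK K).real (BadW K σ (lo κ m h K b) (hi κ m h K b) (Uu K (x - δ))) ≤ τ) :
    (PK K).real (BadS κ m h x δ c η K σ) ≤ 4 * ρ + (2 * m + 1) * τ := by
  have a1 := measureReal_union_le (μ := PK K) (((Near K σ (η / K) ∪ BadW K σ 1 1 c) ∪ BadW K σ 1 (J0 K) (Uu K x / 4)) ∪ BadW K σ (J1 K) (J2 K) (Uu K x / 4))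
    (⋃ b ∈ Finset.range (2 * m + 1), BadW K σ (lo κ m h K b) (hi κ m h K b) (Uu K (x - δ)))
  have a2 := measureReal_union_le (μ := PK K) ((Near K σ (η / K) ∪ BadW K σ 1 1 c) ∪ BadW K σ 1 (J0 K) (Uu K x / 4)) (BadW K σ (J1 K) (J2 K) (Uu K x / 4))
  have a3 := measureReal_union_le (μ := PK K) (Near K σ (η / K) ∪ BadW K σ 1 1 c) (BadW K σ 1 (J0 K) (Uu K x / 4))
  have a4 := measureReal_union_le (μ := PK K) (Near K σ (η / K)) (BadW K σ 1 1 c)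
  have a5 := measureReal_biUnion_finset_le (μ := PK K) (Finset.range (2 * m + 1)) 
    (fun b => BadW K σ (lo κ m h K b) (hi κ m h K b) (Uu K (x - δ)))
  have a6 := Finset.sum_le_card_nsmul _ _ _ h5
  rw [Finset.card_range, nsmul_eq_mul] at a6
  push_cast at a6
  unfold BadS
  linarith

lemma lower {k : ℕ → ℕ} {ν : ℕ → Measure ℝ} {κ : ℝ} (hS : Setup k ν κ) (x θ : ℝ) (hθ : 0 < θ) : ∀ᶠ n in atTop, 
    Real.exp (-2 * Real.exp (-x)) - θ ≤ (Measure.pi (fun _ : Fin (k n) => ν n)).real {y | HCstat (k n) y ≤ Uu (k n) x} := by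
  obtain ⟨z, hz0, hz1, hz⟩ : ∃ z : ℝ, 0 < z ∧ z < 1 ∧ 
      Real.exp (-2 * Real.exp (-x)) - θ / 4 ≤ Real.exp (-(2 * Real.exp (-(x - z - z)) / (1 - z))) := by
    have hc : Tendsto (fun z : ℝ => Real.exp (-(2 * Real.exp (-(x - z - z)) / (1 - z)))) (𝓝[>] 0) 
        (𝓝 (Real.exp (-(2 * Real.exp (-(x - 0 - 0)) / (1 - 0))))) := by
      refine tendsto_nhdsWithin_of_tendsto_nhds (ContinuousAt.tendsto ?_)
      fun_prop (disch := norm_num)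
    have e : Real.exp (-(2 * Real.exp (-(x - 0 - 0)) / (1 - 0))) = Real.exp (-2 * Real.exp (-x)) := by
      congr 1; simp
    rw [e] at hc
    obtain ⟨z, a, b⟩ := ((hc.eventually (le_mem_nhds (show Real.exp (-2 * Real.exp (-x)) - θ / 4 < _ by linarith))).and 
      (Ioo_mem_nhdsGT (show (0:ℝ) < 1 by norm_num))).exists
    exact ⟨z, b.1, b.2, a⟩
  obtain ⟨m, hm, hmw⟩ : ∃ m : ℕ, 0 < m ∧ 1 / (m:ℝ) < z / Real.exp (-(x - z - z)) := by
    obtain ⟨m, hm⟩ := exists_nat_one_div_lt (show 0 < z / Real.exp (-(x - z - z)) by positivity)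
    exact ⟨m + 1, by omega, by push_cast; exact hm⟩
  have hm' : (0:ℝ) < m := by exact_mod_cast hm
  set w := min κ (1 - κ) with hw
  have hwpos : 0 < w := lt_min hS.hκ.1 (by linarith [hS.hκ.2])
  obtain ⟨D, hD, hct⟩ := hS.ct (θ / 8) (by positivity)
  obtain ⟨ρ, hρ, hρ1, hρD⟩ : ∃ ρ : ℝ, 0 < ρ ∧ ρ ≤ 1 ∧ 4 * ρ + (2 * m + 1) * (2 * ρ) ≤ D := by
    refine ⟨min 1 (D / (4 + (2 * m + 1) * 2)), by positivity, min_le_left _ _, ?_⟩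
    have h1 := min_le_right 1 (D / (4 + (2 * m + 1) * 2))
    rw [le_div_iff₀ (by positivity)] at h1
    linarith
  obtain ⟨c, hc0, hgc⟩ := gap_one ρ hρ
  obtain ⟨h, h0, h4, hρh⟩ : ∃ h : ℝ, 0 < h ∧ 4 * h < w / m ∧ 6 * (Real.exp (-(x - z)) * (2 * h)) ≤ ρ := by
    refine ⟨min (w / m / 8) (ρ / (12 * Real.exp (-(x - z)))), by positivity, ?_, ?_⟩
    · have := min_le_left (w / m / 8) (ρ / (12 * Real.exp (-(x - z))))
      have : 0 < w / m := by positivity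
      linarith
    · have h1 := min_le_right (w / m / 8) (ρ / (12 * Real.exp (-(x - z))))
      rw [le_div_iff₀ (by positivity)] at h1
      linarith
  have hbw : ∀ b < 2 * m, Real.exp (-(x - z - z)) * ((ee κ m (b + 1) - h) - (ee κ m b + h)) < z := by
    intro b _
    have := (width_ee hS.hκ hm h0 b).trans_lt hmw
    rw [lt_div_iff₀ (by positivity)] at this
    linarith
  have hsum : ∑ b ∈ Finset.range (2 * m), ((ee κ m (b + 1) - h) - (ee κ m b + h)) ≤ 1 := by
    rw [sum_ee hm]
    have : 0 ≤ 4 * m * h := by positivity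
    linarith
  filter_upwards [core_lower (x - z) z z hz0 hz0 hz1 hS.hk (l := fun n => rate (k n) (ν n)) (blk_ee hS.hκ hm h0 h4) 
      (fun σ b hb => close_ee hS.good hS.hκ hm h0 h4 σ b hb) hbw hsum (θ / 4) (by positivity),
    cmp_blocks hS hm h0 h4 (θ / 4) (by positivity), hS.hk.eventually_ge_atTop 1, hct,
    hS.hk.eventually hgc, hS.hk.eventually (gap_small x ρ hρ), hS.hk.eventually (gap_top x ρ hρ),
    hS.hk.eventually (gap_all (x - z) ρ hρ hS.hκ hm h0 h4), hS.hk.eventually (grid_real x z c ρ hz0 hρ)] 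
    with n g1 g2 g3 g4 g5 g6 g7 g8 g9
  have := hS.hν n
  have hbad : ∀ σ, (Measure.pi (fun _ : Fin (k n) => ν n)).real (BadS κ m h x z c ρ (k n) σ) ≤ θ / 8 := by
    intro σ
    refine g4 _ (meas_BadS _ _ _ _ _ _ _ _ _) ((BadS_le κ m h x z c ρ (k n) σ ρ (2 * ρ) 
      (near_le g3 σ hρ.le hρ1) (g5 σ) (g6 σ) (g7 σ) fun b hb => (g8 b hb σ).trans (by linarith)).trans hρD)
  have hsub : {y | cnt (cell (k n)) y ∈ Ebl (k n) (2 * m) (fun b => ee κ m b + h) (fun b => ee κ m (b + 1) - h) (Uu (k n) (x - z))} ⊆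
      (({y | HCstat (k n) y ≤ Uu (k n) x} ∪ {y | ∀ i, y i ∈ Set.Ioo (0:ℝ) 1}ᶜ) ∪ BadS κ m h x z c ρ (k n) false) ∪ 
        BadS κ m h x z c ρ (k n) true := by
    intro y hy
    by_cases hy1 : ∀ i, y i ∈ Set.Ioo (0:ℝ) 1
    swap
    · left; left; right; exact hy1
    by_cases hb : ∃ σ, y ∈ BadS κ m h x z c ρ (k n) σ
    · obtain ⟨σ, hσ⟩ := hb
      cases σ
      · left; right; exact hσ
      · right; exact hσ
    left; left; left
    push Not at hb
    refine HC_le_of g3 hy1 fun σ s hs0 hs1 => ?_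
    have hσ := hb σ
    simp only [BadS, Set.mem_union, not_or, Set.mem_iUnion, not_exists] at hσ
    obtain ⟨⟨⟨⟨k1, k2⟩, k3⟩, k4⟩, k5⟩ := hσ
    refine g9 σ y k1 k2 k3 (fun j hj1 hj2 => ?_) k4 s hs0 hs1
    have hj3 : j ≤ hi κ m h (k n) (2 * m) := by simpa [hi] using hj2
    rcases cover hj1 (2 * m) le_rfl hj3 with ⟨b, hb1, hb2, hb3⟩ | ⟨b, hb1, hb2, hb3⟩
    · exact not_BadW (k5 b (Finset.mem_range.2 (by omega))) hb2 hb3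
    · exact hy σ b hb1 j hb2 hb3
  set Q := Measure.pi (fun _ : Fin (k n) => ν n) with hQ
  have b1 := measureReal_mono (μ := Q) hsub
  have b2 := measureReal_union_le (μ := Q) (({y | HCstat (k n) y ≤ Uu (k n) x} ∪ {y | ∀ i, y i ∈ Set.Ioo (0:ℝ) 1}ᶜ) ∪ BadS κ m h x z c ρ (k n) false)
    (BadS κ m h x z c ρ (k n) true)
  have b3 := measureReal_union_le (μ := Q) ({y | HCstat (k n) y ≤ Uu (k n) x} ∪ {y | ∀ i, y i ∈ Set.Ioo (0:ℝ) 1}ᶜ) (BadS κ m h x z c ρ (k n) false)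
  have b4 := measureReal_union_le (μ := Q) {y | HCstat (k n) y ≤ Uu (k n) x} {y | ∀ i, y i ∈ Set.Ioo (0:ℝ) 1}ᶜ
  have b5 := hS.nul n
  have b6 := (abs_le.1 (g2 (Uu (k n) (x - z)))).1
  have b7 := hbad false
  have b8 := hbad true
  linarith

end HC

namespace HC
open MeasureTheory Filter Topology ProbabilityTheory
open scoped ENNReal NNReal

lemma contig_eps {Ω : ℕ → Type*} [∀ n, MeasurableSpace (Ω n)] (P Q : ∀ n, Measure (Ω n)) 
    [∀ n, IsProbabilityMeasure (P n)] [∀ n, IsProbabilityMeasure (Q n)]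
    (hc : ∀ A : ∀ n, Set (Ω n), (∀ n, MeasurableSet (A n)) → Tendsto (fun n => P n (A n)) atTop (𝓝 0) → 
      Tendsto (fun n => Q n (A n)) atTop (𝓝 0)) (ρ : ℝ) (hρ : 0 < ρ) :
    ∃ D : ℝ, 0 < D ∧ ∀ᶠ n in atTop, ∀ A : Set (Ω n), MeasurableSet A → (P n).real A ≤ D → (Q n).real A ≤ ρ := by
  classical
  by_contra hcon
  push Not at hcon
  have hfr : ∀ m : ℕ, ∃ᶠ n in atTop, ∃ A : Set (Ω n), MeasurableSet A ∧ (P n).real A ≤ 1 / ((m:ℝ) + 1) ∧ ρ < (Q n).real A := 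
    fun m => hcon (1 / ((m:ℝ) + 1)) (by positivity)
  obtain ⟨φ, hφ, hA⟩ := extraction_forall_of_frequently hfr
  set g : ℕ → ℝ := Function.extend φ (fun m => 1 / ((m:ℝ) + 1)) 0 with hg
  have hgφ : ∀ m, g (φ m) = 1 / ((m:ℝ) + 1) := fun m => hφ.injective.extend_apply _ _ m
  have hg0 : ∀ n, 0 ≤ g n := by
    intro n
    by_cases h : ∃ m, φ m = n
    · obtain ⟨m, rfl⟩ := h; rw [hgφ]; positivity
    · rw [hg, Function.extend_apply' _ _ _ h]; simp
  have hgt : Tendsto g atTop (𝓝 0) := by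
    rw [Metric.tendsto_atTop]
    intro e he
    obtain ⟨M, hM⟩ := exists_nat_one_div_lt he
    refine ⟨φ M, fun n hn => ?_⟩
    rw [Real.dist_eq, sub_zero, abs_of_nonneg (hg0 n)]
    by_cases h : ∃ m, φ m = n
    · obtain ⟨m, rfl⟩ := h
      rw [hgφ]
      have : M ≤ m := hφ.le_iff_le.1 hn
      have : (M:ℝ) ≤ m := by exact_mod_cast this
      refine lt_of_le_of_lt ?_ hM
      gcongr
    · rw [hg, Function.extend_apply' _ _ _ h]; simpa using he
  set A : ∀ n, Set (Ω n) := fun n => 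
    if h : ∃ A : Set (Ω n), MeasurableSet A ∧ (P n).real A ≤ g n ∧ ρ < (Q n).real A then h.choose else ∅ with hAdef
  have hAm : ∀ n, MeasurableSet (A n) := by
    intro n
    simp only [hAdef]
    split_ifs with h
    · exact h.choose_spec.1
    · exact MeasurableSet.empty
  have hAP : ∀ n, (P n).real (A n) ≤ g n := by
    intro n
    simp only [hAdef]
    split_ifs with h
    · exact h.choose_spec.2.1
    · simpa using hg0 n
  have hAQ : ∀ m, ρ < (Q (φ m)).real (A (φ m)) := by
    intro m
    have h : ∃ A : Set (Ω (φ m)), MeasurableSet A ∧ (P (φ m)).real A ≤ g (φ m) ∧ ρ < (Q (φ m)).real A := by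
      rw [hgφ]; exact hA m
    simp only [hAdef, dif_pos h]
    exact h.choose_spec.2.2
  have hP : Tendsto (fun n => P n (A n)) atTop (𝓝 0) := by
    rw [← ENNReal.tendsto_toReal_iff (fun n => measure_ne_top _ _) ENNReal.zero_ne_top]
    exact squeeze_zero (fun n => ENNReal.toReal_nonneg) hAP hgt
  have hQ := hc A hAm hP
  rw [← ENNReal.tendsto_toReal_iff (fun n => measure_ne_top _ _) ENNReal.zero_ne_top] at hQ
  have hQ2 := hQ.comp hφ.tendsto_atTop
  have := ge_of_tendsto' hQ2 (fun m => (hAQ m).le)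
  simp at this
  linarith

lemma final {k : ℕ → ℕ} {ν : ℕ → Measure ℝ} {κ : ℝ} (hS : Setup k ν κ) (x : ℝ) :
    Tendsto (fun n => ((Measure.pi (fun _ : Fin (k n) => ν n)) 
      {y | aHC (k n) * HCstat (k n) y - bHC (k n) ≤ x}).toReal) atTop (𝓝 (Real.exp (-2 * Real.exp (-x)))) := by
  rw [Metric.tendsto_atTop']
  intro θ hθ
  have key : ∀ᶠ n in atTop, dist (((Measure.pi (fun _ : Fin (k n) => ν n)) 
      {y | aHC (k n) * HCstat (k n) y - bHC (k n) ≤ x}).toReal) (Real.exp (-2 * Real.exp (-x))) < θ := by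
    filter_upwards [upper hS x (θ / 2) (by positivity), lower hS x (θ / 2) (by positivity), 
      hS.hk.eventually (tendsto_aHC.eventually_gt_atTop 0)] with n h1 h2 h3
    have e : {y | aHC (k n) * HCstat (k n) y - bHC (k n) ≤ x} = {y | HCstat (k n) y ≤ Uu (k n) x} := by
      ext y
      simp only [Set.mem_ofPred_eq, Uu]
      rw [le_div_iff₀ h3]
      constructor <;> intro h <;> linarith
    rw [e]
    change dist ((Measure.pi (fun _ : Fin (k n) => ν n)).real _) _ < θ
    rw [Real.dist_eq, abs_lt]
    constructor <;> linarith
  obtain ⟨N, hN⟩ := eventually_atTop.1 key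
  exact ⟨N, fun n hn => hN n hn.le⟩

lemma setup_of
    (k : ℕ → ℕ) (μn : ℕ → Measure ℝ) (εn : ℕ → ℝ)
    (r s t u : ℕ → ℝ) (κ : ℝ)
    (hk : Tendsto k atTop atTop)
    (hμ : ∀ n, IsProbabilityMeasure (μn n))
    (hμ01 : ∀ n, (μn n) (Set.Ioo (0 : ℝ) 1) = 1)
    (hε : ∀ n, εn n ∈ Set.Icc (0 : ℝ) 1)
    (hεmax : Tendsto εn atTop (nhds 0))
    (hcontig : ∀ A : (n : ℕ) → Set (Fin (k n) → ℝ), (∀ n, MeasurableSet (A n)) →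
      (Tendsto (fun n => (QprodU (fun n _ => μn n) (fun n _ => εn n) k n) (A n))
          atTop (nhds 0) ↔
        Tendsto (fun n => (PprodU k n) (A n)) atTop (nhds 0)))
    (hr01 : ∀ n, r n ∈ Set.Ioo (0 : ℝ) 1) (hs01 : ∀ n, s n ∈ Set.Ioo (0 : ℝ) 1)
    (ht01 : ∀ n, t n ∈ Set.Ioo (0 : ℝ) 1) (hu01 : ∀ n, u n ∈ Set.Ioo (0 : ℝ) 1)
    (hκ : κ ∈ Set.Ioo (0 : ℝ) 1)
    (hrlog : Tendsto (fun n => Real.log (r n) / Real.log (k n)) atTop (nhds (-1)))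
    (hulog : Tendsto (fun n => Real.log (u n) / Real.log (k n)) atTop (nhds 0))
    (hslog : Tendsto (fun n => Real.log (s n) / Real.log (k n)) atTop (nhds (-κ)))
    (htlog : Tendsto (fun n => Real.log (t n) / Real.log (k n)) atTop (nhds (-κ)))
    (hsup : Tendsto (fun n => aHC (k n) *
        ⨆ x : (Set.Icc (r n) (s n) ∪ Set.Icc (t n) (u n) : Set ℝ),
          Hfun (fun n _ => μn n) (fun n _ => εn n) k n x.1) atTop (nhds 0)) :
    Setup k (fun n => Qmix unif (μn n) (εn n)) κ := by
  have hQ : ∀ n, IsProbabilityMeasure (Qmix unif (μn n) (εn n)) := fun n => Qmix_prob _ (hε n)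
  set η : ℕ → ℝ := fun n => ⨆ x : (Set.Icc (r n) (s n) ∪ Set.Icc (t n) (u n) : Set ℝ),
          Hfun (fun n _ => μn n) (fun n _ => εn n) k n x.1 with hη
  have hη0 : ∀ n, 0 ≤ η n := fun n => Real.iSup_nonneg fun v => by rw [Hfun_eq]; exact Hs_nonneg _ _ _ _
  have hηt : Tendsto (fun n => η n * aHC (k n)) atTop (𝓝 0) := by
    refine hsup.congr fun n => mul_comm _ _
  have hηs : ∀ᶠ n in atTop, ∀ v ∈ (Set.Icc (r n) (s n) ∪ Set.Icc (t n) (u n) : Set ℝ), Hs (k n) (μn n) (εn n) v ≤ η n := by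
    filter_upwards [hk.eventually_ge_atTop 1] with n hn v hv
    rw [← Hfun_eq]
    refine le_ciSup (f := fun x : (Set.Icc (r n) (s n) ∪ Set.Icc (t n) (u n) : Set ℝ) =>
          Hfun (fun n _ => μn n) (fun n _ => εn n) k n x.1) ⟨2 * k n / Real.sqrt (k n * min (r n) (t n)), ?_⟩ ⟨v, hv⟩
    rintro _ ⟨⟨v, hv⟩, rfl⟩
    simp only [Hfun_eq]
    have := hμ n
    refine Hs_le hn _ (hε n) (lt_min (hr01 n).1 (ht01 n).1) ?_ ?_
    · rcases hv with hv | hv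
      · exact (min_le_left _ _).trans hv.1
      · exact (min_le_right _ _).trans hv.1
    · rcases hv with hv | hv
      · exact hv.2.trans (hs01 n).2.le
      · exact hv.2.trans (hu01 n).2.le
  refine ⟨hk, hQ, hκ, ?_, ?_, ?_, ?_⟩
  · intro f g hf hfg hg hor σ
    rcases hor with h | h
    · exact close_of hk hμ hμ01 hε (fun n => (hr01 n).1) (fun n => (hs01 n).1) (by linarith) (by linarith) hfg hf hg 
        hrlog hslog hη0 hηt (hηs.mono fun n hn v hv => hn v (Or.inl hv)) σ
    · exact close_of hk hμ hμ01 hε (fun n => (ht01 n).1) (fun n => (hu01 n).1) (by linarith) (by linarith) hfg hf hg 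
        htlog hulog hη0 hηt (hηs.mono fun n hn v hv => hn v (Or.inr hv)) σ
  · intro h h0 h1 σ
    have hlim : Tendsto (fun n => (Real.log (k n))⁻¹ + εn n) atTop (𝓝 0) := by
      have := (tendsto_inv_atTop_zero.comp (tendsto_logK.comp hk)).add hεmax
      simpa [Function.comp] using this
    refine squeeze_zero' (Eventually.of_forall fun n => measureReal_nonneg) ?_ hlim
    filter_upwards [hk.eventually (J_frac (1 - h) (by linarith) (by linarith) 1 one_pos), hk.eventually_ge_atTop 1,
      hk.eventually (tendsto_logK.eventually_ge_atTop 1)] with n g1 g2 g3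
    have := hμ n
    have hK : (0:ℝ) < k n := by exact_mod_cast g2
    have e1 : (J (1 - h) (k n) : ℝ) / k n ≤ (Real.log (k n))⁻¹ := by
      rw [div_le_iff₀ hK, ← div_eq_inv_mul, le_div_iff₀ (by linarith)]; linarith
    have e2 : (Real.log (k n))⁻¹ ≤ 1 := inv_le_one_of_one_le₀ g3
    have e3 := Qmix_Iv_le (μn n) (hε n) σ (s := (J (1 - h) (k n) : ℝ) / k n) (by positivity) (e1.trans e2)
    linarith
  · intro ρ hρ
    exact contig_eps (fun n => PK (k n)) (fun n => Measure.pi (fun _ : Fin (k n) => Qmix unif (μn n) (εn n)))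
      (fun A hA h => (hcontig A hA).2 h) ρ hρ
  · intro n
    have e : {y : Fin (k n) → ℝ | ∀ i, y i ∈ Set.Ioo (0:ℝ) 1} = Set.pi Set.univ (fun _ => Set.Ioo (0:ℝ) 1) := by
      ext y; simp [Set.mem_pi]
    rw [e, measureReal_def, (prob_compl_eq_zero_iff (MeasurableSet.univ_pi fun _ => measurableSet_Ioo)).2]
    · simp
    · rw [Measure.pi_pi]
      simp only [Qmix_apply (μn n) (hε n) _ unif_01 (hμ01 n), Finset.prod_const_one]

end HC

noncomputable section

/-- undetectable by higher criticism: under mutual contiguity and the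
vanishing-sup condition on `H_n`, the HC statistic has the same Gumbel-squared limit under
the alternative as under the null. -/
theorem statement9
    (k : ℕ → ℕ) (μn : ℕ → Measure ℝ) (εn : ℕ → ℝ)
    (r s t u : ℕ → ℝ) (κ : ℝ)
    (hk : Tendsto k atTop atTop)
    (hμ : ∀ n, IsProbabilityMeasure (μn n))
    (hμ01 : ∀ n, (μn n) (Set.Ioo (0 : ℝ) 1) = 1)
    (hε : ∀ n, εn n ∈ Set.Icc (0 : ℝ) 1)
    (hεmax : Tendsto εn atTop (nhds 0))
    -- mutual contiguity of P_(n) and Q_(n)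
    (hcontig : ∀ A : (n : ℕ) → Set (Fin (k n) → ℝ), (∀ n, MeasurableSet (A n)) →
      (Tendsto (fun n => (QprodU (fun n _ => μn n) (fun n _ => εn n) k n) (A n))
          atTop (nhds 0) ↔
        Tendsto (fun n => (PprodU k n) (A n)) atTop (nhds 0)))
    -- the sequences r_n, s_n, t_n, u_n
    (hr01 : ∀ n, r n ∈ Set.Ioo (0 : ℝ) 1) (hs01 : ∀ n, s n ∈ Set.Ioo (0 : ℝ) 1)
    (ht01 : ∀ n, t n ∈ Set.Ioo (0 : ℝ) 1) (hu01 : ∀ n, u n ∈ Set.Ioo (0 : ℝ) 1)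
    (hκ : κ ∈ Set.Ioo (0 : ℝ) 1)
    (hrlog : Tendsto (fun n => Real.log (r n) / Real.log (k n)) atTop (nhds (-1)))
    (hulog : Tendsto (fun n => Real.log (u n) / Real.log (k n)) atTop (nhds 0))
    (hslog : Tendsto (fun n => Real.log (s n) / Real.log (k n)) atTop (nhds (-κ)))
    (htlog : Tendsto (fun n => Real.log (t n) / Real.log (k n)) atTop (nhds (-κ)))
    -- the vanishing-sup condition a_n · sup{H_n(v) : v ∈ [r_n,s_n] ∪ [t_n,u_n]} → 0
    (hsup : Tendsto (fun n => aHC (k n) *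
        ⨆ x : (Set.Icc (r n) (s n) ∪ Set.Icc (t n) (u n) : Set ℝ),
          Hfun (fun n _ => μn n) (fun n _ => εn n) k n x.1) atTop (nhds 0)) :
    ∀ x : ℝ,
      Tendsto (fun n =>
          ((QprodU (fun n _ => μn n) (fun n _ => εn n) k n)
            {y | aHC (k n) * HCstat (k n) y - bHC (k n) ≤ x}).toReal)
        atTop (nhds (Real.exp (-2 * Real.exp (-x)))) := by
  have hS := HC.setup_of k μn εn r s t u κ hk hμ hμ01 hε hεmax hcontig hr01 hs01 ht01 hu01 hκ
    hrlog hulog hslog htlog hsup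
  intro x
  exact HC.final hS x

end
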